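/- Let Ω ⊂ ℝⁿ be a convex smooth bounded domain with n ≥ 2 and let f : [0,∞) → ℝ be an increasing positive C¹ function (in particular f(0) > 0) with f(t)/t → ∞ as t → ∞. Let λ* ∈ (0,∞) and, for each λ ∈ (0,λ*), let u_λ, smooth on the closure of Ω, be a positive classical solution of −Δu_λ = λ f(u_λ) in Ω with u_λ = 0 on ∂Ω; assume each u_λ is minimal, meaning u_λ ≤ v pointwise for every nonnegative classical solution v of the same problem with the same λ, assume the family is nondecreasing in λ, and assume the pointwise limit u* := lim_{λ↑λ*} u_λ belongs to L¹(Ω). Then there is a constant C, independent of λ, with ∫_Ω |∇u_λ|² dx ≤ C for all λ ∈ (0,λ*); in particular u* ∈ H¹₀(Ω) and ∫_Ω (u*)^{2n/(n−2)} dx < ∞. -/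

import Mathlib

open MeasureTheory Filter Bornology
open scoped ENNReal Topology

/-- Divergence of a vector field on `ℝⁿ = EuclideanSpace ℝ (Fin n)`. -/
noncomputable def divg {n : ℕ} (V : EuclideanSpace ℝ (Fin n) → EuclideanSpace ℝ (Fin n))
    (x : EuclideanSpace ℝ (Fin n)) : ℝ :=
  ∑ i, fderiv ℝ V x (EuclideanSpace.single i 1) i

/-- `H_u(x) = -(1/(n-1)) div(∇u/|∇u|)(x)`, the mean curvature of the level set of `|u|`
through `x` (at points where `∇u(x) ≠ 0`). -/
noncomputable def meanCurv {n : ℕ} (u : EuclideanSpace ℝ (Fin n) → ℝ)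
    (x : EuclideanSpace ℝ (Fin n)) : ℝ :=
  -(1 / ((n : ℝ) - 1)) * divg (fun y => ‖gradient u y‖⁻¹ • gradient u y) x

/-- The Laplacian `Δu = div ∇u` on `ℝⁿ`. -/
noncomputable def lap {n : ℕ} (u : EuclideanSpace ℝ (Fin n) → ℝ)
    (x : EuclideanSpace ℝ (Fin n)) : ℝ :=
  divg (gradient u) x

/-- Semi-stability of a solution `u` of `-Δu = g(u)` in `Ω`, `u = 0` on `∂Ω`:
`∫_Ω (|∇ξ|² - g'(u) ξ²) dx ≥ 0` for every `C¹` function `ξ` vanishing on `∂Ω`. -/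
def SemiStable {n : ℕ} (Ω : Set (EuclideanSpace ℝ (Fin n))) (g : ℝ → ℝ)
    (u : EuclideanSpace ℝ (Fin n) → ℝ) : Prop :=
  ∀ ξ : EuclideanSpace ℝ (Fin n) → ℝ, ContDiff ℝ 1 ξ → (∀ x ∈ frontier Ω, ξ x = 0) →
    0 ≤ ∫ x in Ω, (‖gradient ξ x‖ ^ 2 - deriv g (u x) * ξ x ^ 2)

/-- Euclidean space `ℝⁿ`. -/
abbrev Eu (n : ℕ) := EuclideanSpace ℝ (Fin n)

section VectorCalculus

variable {n : ℕ}

theorem sum_smul_single (v : Eu n) :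
    ∑ i, v i • (EuclideanSpace.single i (1 : ℝ) : Eu n) = v := by
  ext j
  simp [Finset.sum_apply, Pi.single_apply]

theorem sum_clm_single (L : Eu n →L[ℝ] ℝ) (v : Eu n) :
    ∑ i, L (EuclideanSpace.single i 1) * v i = L v := by
  conv_rhs => rw [← sum_smul_single v]
  simp [mul_comm]

theorem contDiff_gradient {u : Eu n → ℝ} {k m : WithTop ℕ∞} (hu : ContDiff ℝ m u)
    (hk : k + 1 ≤ m) : ContDiff ℝ k (gradient u) :=
  (InnerProductSpace.toDual ℝ (Eu n)).symm.contDiff.comp (hu.fderiv_right hk)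

theorem continuous_gradient {u : Eu n → ℝ} (hu : ContDiff ℝ 1 u) : Continuous (gradient u) :=
  (contDiff_gradient (k := 0) hu (by norm_num)).continuous

theorem inner_gradient (u : Eu n → ℝ) (x v : Eu n) : inner ℝ (gradient u x) v = fderiv ℝ u x v :=
  inner_gradient_left ..

theorem gradient_eq_of_fderiv {u : Eu n → ℝ} {x g : Eu n}
    (h : ∀ v, fderiv ℝ u x v = inner ℝ g v) : gradient u x = g := by
  refine ext_inner_right ℝ fun v => ?_
  rw [inner_gradient, h]

theorem norm_gradient (u : Eu n → ℝ) (x : Eu n) : ‖gradient u x‖ = ‖fderiv ℝ u x‖ := by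
  rw [← toDual_gradient, LinearIsometryEquiv.norm_map]

theorem gradient_comp {g : ℝ → ℝ} {u : Eu n → ℝ} {x : Eu n} (hg : DifferentiableAt ℝ g (u x))
    (hu : DifferentiableAt ℝ u x) :
    gradient (fun y => g (u y)) x = deriv g (u x) • gradient u x := by
  refine gradient_eq_of_fderiv fun v => ?_
  have := (hg.hasDerivAt.comp_hasFDerivAt x hu.hasFDerivAt).fderiv
  rw [show (fun y => g (u y)) = g ∘ u from rfl, this, inner_smul_left]
  simp

theorem gradient_mul {a b : Eu n → ℝ} {x : Eu n} (ha : DifferentiableAt ℝ a x)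
    (hb : DifferentiableAt ℝ b x) :
    gradient (fun y => a y * b y) x = a x • gradient b x + b x • gradient a x := by
  refine gradient_eq_of_fderiv fun v => ?_
  rw [fderiv_fun_mul ha hb]
  simp [inner_add_left, inner_smul_left]

theorem gradient_sq {a : Eu n → ℝ} {x : Eu n} (ha : DifferentiableAt ℝ a x) :
    gradient (fun y => a y ^ 2) x = (2 * a x) • gradient a x := by
  have h : (fun y => a y ^ 2) = fun y => a y * a y := by ext; ring
  rw [h, gradient_mul ha ha, ← add_smul, two_mul]

theorem gradient_sub {a b : Eu n → ℝ} {x : Eu n} (ha : DifferentiableAt ℝ a x)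
    (hb : DifferentiableAt ℝ b x) :
    gradient (fun y => a y - b y) x = gradient a x - gradient b x := by
  refine gradient_eq_of_fderiv fun v => ?_
  rw [fderiv_fun_sub ha hb]
  simp [inner_sub_left]

theorem divg_smul {a : Eu n → ℝ} {V : Eu n → Eu n} {x : Eu n} (ha : DifferentiableAt ℝ a x)
    (hV : DifferentiableAt ℝ V x) :
    divg (fun y => a y • V y) x = a x * divg V x + inner ℝ (gradient a x) (V x) := by
  simp only [divg]
  rw [fderiv_fun_smul ha hV, inner_gradient, ← sum_clm_single, Finset.mul_sum,
    ← Finset.sum_add_distrib]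
  exact Finset.sum_congr rfl fun i _ => by simp

theorem divg_sub {V W : Eu n → Eu n} {x : Eu n} (hV : DifferentiableAt ℝ V x)
    (hW : DifferentiableAt ℝ W x) : divg (fun y => V y - W y) x = divg V x - divg W x := by
  simp only [divg]
  rw [fderiv_fun_sub hV hW, ← Finset.sum_sub_distrib]
  exact Finset.sum_congr rfl fun i _ => by simp

theorem divg_sub_const (z x : Eu n) : divg (fun y => y - z) x = n := by
  simp only [divg]
  rw [fderiv_sub_const, fderiv_fun_id]
  simp

theorem lap_sub {a b : Eu n → ℝ} (ha : ContDiff ℝ 2 a) (hb : ContDiff ℝ 2 b) (x : Eu n) :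
    lap (fun y => a y - b y) x = lap a x - lap b x := by
  have h : gradient (fun y => a y - b y) = fun y => gradient a y - gradient b y :=
    funext fun y => gradient_sub (ha.differentiable (by norm_num) y)
      (hb.differentiable (by norm_num) y)
  rw [lap, h]
  exact divg_sub ((contDiff_gradient (k := 1) ha (by norm_num)).differentiable (by norm_num) x)
    ((contDiff_gradient (k := 1) hb (by norm_num)).differentiable (by norm_num) x)

theorem inner_hess_comm {u : Eu n → ℝ} (hu : ContDiff ℝ 2 u) (x v w : Eu n) :
    inner ℝ (fderiv ℝ (gradient u) x v) w = inner ℝ (fderiv ℝ (gradient u) x w) v := by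
  have h : ∀ v w : Eu n, inner ℝ (fderiv ℝ (gradient u) x v) w
      = fderiv ℝ (fderiv ℝ u) x v w := by
    intro v w
    have h1 : gradient u = fun y => (InnerProductSpace.toDual ℝ (Eu n)).symm (fderiv ℝ u y) := rfl
    have h2 : DifferentiableAt ℝ (fderiv ℝ u) x :=
      (hu.fderiv_right (m := 1) (by norm_num)).differentiable (by norm_num) x
    have h3 := (((InnerProductSpace.toDual ℝ (Eu n)).symm.toContinuousLinearEquiv.toContinuousLinearMap).hasFDerivAt
      (x := fderiv ℝ u x)).comp x h2.hasFDerivAt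
    have h4 : fderiv ℝ (gradient u) x v
        = (InnerProductSpace.toDual ℝ (Eu n)).symm (fderiv ℝ (fderiv ℝ u) x v) := by
      have := h3.fderiv
      change fderiv ℝ (gradient u) x = _ at this
      rw [this]
      rfl
    rw [h4, InnerProductSpace.toDual_symm_apply]
  rw [h, h]
  exact (hu.contDiffAt.isSymmSndFDerivAt (by simp)) v w

/-- The gradient of `x ↦ ⟪X x, ∇u x⟫`. -/
theorem fderiv_inner_gradient {u : Eu n → ℝ} (hu : ContDiff ℝ 2 u) {X : Eu n → Eu n} {x : Eu n}
    (hX : DifferentiableAt ℝ X x) (v : Eu n) :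
    fderiv ℝ (fun y => inner ℝ (X y) (gradient u y)) x v
      = inner ℝ (fderiv ℝ (gradient u) x (X x)) v + inner ℝ (fderiv ℝ X x v) (gradient u x) := by
  have h2 : DifferentiableAt ℝ (gradient u) x :=
    (contDiff_gradient (k := 1) hu (by norm_num)).differentiable (by norm_num) x
  rw [fderiv_inner_apply ℝ hX h2, real_inner_comm, inner_hess_comm hu]

theorem gradient_half_sq_gradient {u : Eu n → ℝ} (hu : ContDiff ℝ 2 u) (x : Eu n) :
    gradient (fun y => (1 / 2) * ‖gradient u y‖ ^ 2) x
      = fderiv ℝ (gradient u) x (gradient u x) := by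
  have h2 : DifferentiableAt ℝ (gradient u) x :=
    (contDiff_gradient (k := 1) hu (by norm_num)).differentiable (by norm_num) x
  refine gradient_eq_of_fderiv fun v => ?_
  have : (fun y => (1 / 2) * ‖gradient u y‖ ^ 2)
      = fun y => (1 / 2) * inner ℝ (gradient u y) (gradient u y) := by
    ext y; rw [real_inner_self_eq_norm_sq]
  rw [this, fderiv_const_mul (h2.inner ℝ h2)]
  have := fderiv_inner_gradient hu h2 v
  rw [smul_apply, this, inner_hess_comm hu x v]
  simp; ring

theorem lap_inner_sub_gradient {u : Eu n → ℝ} (hu : ContDiff ℝ 3 u) (z x : Eu n) :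
    lap (fun y => inner ℝ (z - y) (gradient u y)) x
      = fderiv ℝ (lap u) x (z - x) - 2 * lap u x := by
  have hu2 : ContDiff ℝ 2 u := hu.of_le (by norm_num)
  have hg2 : ContDiff ℝ 2 (gradient u) := contDiff_gradient hu (by norm_num)
  have hg1 : Differentiable ℝ (gradient u) := hg2.differentiable (by norm_num)
  have hh1 : Differentiable ℝ (fderiv ℝ (gradient u)) :=
    (hg2.fderiv_right (m := 1) (by norm_num)).differentiable (by norm_num)
  have hgrad : gradient (fun y => inner ℝ (z - y) (gradient u y))
      = fun y => fderiv ℝ (gradient u) y (z - y) - gradient u y := by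
    ext1 y
    refine gradient_eq_of_fderiv fun v => ?_
    rw [fderiv_inner_gradient hu2 (by fun_prop)]
    rw [fderiv_const_sub, fderiv_fun_id, inner_sub_left]
    simp [real_inner_comm, sub_eq_add_neg]
  have hW : ∀ v, fderiv ℝ (fun y => fderiv ℝ (gradient u) y (z - y)) x v
      = fderiv ℝ (fderiv ℝ (gradient u)) x v (z - x) - fderiv ℝ (gradient u) x v := by
    intro v
    rw [fderiv_clm_apply (hh1 x) (by fun_prop), fderiv_const_sub, fderiv_fun_id]
    simp [sub_eq_neg_add]
  have hsym : ∀ v, fderiv ℝ (fderiv ℝ (gradient u)) x v (z - x)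
      = fderiv ℝ (fderiv ℝ (gradient u)) x (z - x) v := fun v =>
    (hg2.contDiffAt.isSymmSndFDerivAt (by simp)) v (z - x)
  have hlap : fderiv ℝ (lap u) x (z - x)
      = ∑ i, fderiv ℝ (fderiv ℝ (gradient u)) x (z - x) (EuclideanSpace.single i 1) i := by
    have h1 : ∀ i, HasFDerivAt (fun y => fderiv ℝ (gradient u) y (EuclideanSpace.single i 1) i)
        ((EuclideanSpace.proj i : Eu n →L[ℝ] ℝ).comp
          ((fderiv ℝ (fderiv ℝ (gradient u)) x).flip (EuclideanSpace.single i 1))) x := by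
      intro i
      have h2 := (hh1 x).hasFDerivAt.clm_apply
        (hasFDerivAt_const (EuclideanSpace.single i (1 : ℝ) : Eu n) x)
      have h3 := (EuclideanSpace.proj i : Eu n →L[ℝ] ℝ).hasFDerivAt.comp x h2
      refine h3.congr_fderiv ?_
      ext v; simp
    have h4 := (HasFDerivAt.fun_sum (u := Finset.univ) fun i _ => h1 i).fderiv
    have h5 : lap u = fun y => ∑ i, fderiv ℝ (gradient u) y (EuclideanSpace.single i 1) i := rfl
    rw [h5, h4]
    simp
  rw [lap, hgrad, divg_sub (by
    exact (hh1 x).clm_apply (by fun_prop)) (hg1 x)]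
  have : divg (fun y => fderiv ℝ (gradient u) y (z - y)) x
      = fderiv ℝ (lap u) x (z - x) - lap u x := by
    rw [hlap, lap, divg, divg, ← Finset.sum_sub_distrib]
    refine Finset.sum_congr rfl fun i _ => ?_
    rw [hW, hsym]; simp
  rw [this, lap]; ring

end VectorCalculus

section Cutoff

variable {n : ℕ} {F : Type*} [NormedAddCommGroup F]

/-- `V`, considered on `Ω` only, vanishes in a neighbourhood of the boundary of `Ω`. -/
def VanishesNearFrontier (Ω : Set (Eu n)) (V : Eu n → F) : Prop :=
  ∀ x ∈ frontier Ω, ∀ᶠ y in 𝓝 x, y ∈ Ω → V y = 0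

theorem VanishesNearFrontier.imp {F' : Type*} [NormedAddCommGroup F']
    {Ω : Set (Eu n)} {V : Eu n → F} {W : Eu n → F'}
    (hV : VanishesNearFrontier Ω V) (h : ∀ y ∈ Ω, V y = 0 → W y = 0) :
    VanishesNearFrontier Ω W := fun x hx => by
  filter_upwards [hV x hx] with y hy hyΩ using h y hyΩ (hy hyΩ)

theorem VanishesNearFrontier.eventually_indicator {Ω : Set (Eu n)} (hΩ : IsOpen Ω)
    {V : Eu n → F} (hV : VanishesNearFrontier Ω V) {x : Eu n} (hx : x ∉ Ω) :
    Ω.indicator V =ᶠ[𝓝 x] 0 := by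
  by_cases hc : x ∈ closure Ω
  · have : x ∈ frontier Ω := by rw [hΩ.frontier_eq]; exact ⟨hc, hx⟩
    filter_upwards [hV x this] with y hy
    by_cases h : y ∈ Ω <;> simp [h, hy]
  · filter_upwards [isClosed_closure.isOpen_compl.mem_nhds hc] with y hy
    have : y ∉ Ω := fun h => hy (subset_closure h)
    simp [this]

theorem indicator_eventuallyEq_self {Ω : Set (Eu n)} (hΩ : IsOpen Ω) (V : Eu n → F) {x : Eu n}
    (hx : x ∈ Ω) : Ω.indicator V =ᶠ[𝓝 x] V := by
  filter_upwards [hΩ.mem_nhds hx] with y hy using by simp [hy]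

theorem contDiff_indicator [NormedSpace ℝ F] {Ω : Set (Eu n)} (hΩ : IsOpen Ω) {k : WithTop ℕ∞} {V : Eu n → F}
    (hV : VanishesNearFrontier Ω V) (hc : ContDiffOn ℝ k V Ω) :
    ContDiff ℝ k (Ω.indicator V) := by
  rw [contDiff_iff_contDiffAt]
  intro x
  by_cases hx : x ∈ Ω
  · exact (hc.contDiffAt (hΩ.mem_nhds hx)).congr_of_eventuallyEq
      (indicator_eventuallyEq_self hΩ V hx)
  · exact (contDiffAt_const (c := (0 : F))).congr_of_eventuallyEq
      (hV.eventually_indicator hΩ hx)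

theorem tsupport_indicator_subset {Ω : Set (Eu n)} (hΩ : IsOpen Ω) {V : Eu n → F}
    (hV : VanishesNearFrontier Ω V) : tsupport (Ω.indicator V) ⊆ Ω := by
  intro x hx
  by_contra h
  exact (notMem_tsupport_iff_eventuallyEq.2 (hV.eventually_indicator hΩ h)) hx

theorem hasCompactSupport_indicator {Ω : Set (Eu n)} (hΩb : IsBounded Ω) (V : Eu n → F) :
    HasCompactSupport (Ω.indicator V) :=
  hΩb.isCompact_closure.of_isClosed_subset (isClosed_tsupport _)
    (closure_mono Set.support_indicator_subset)

theorem integrableOn_of_vanishesNearFrontier [NormedSpace ℝ F] {Ω : Set (Eu n)} (hΩ : IsOpen Ω)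
    (hΩb : IsBounded Ω) {V : Eu n → F} (hV : VanishesNearFrontier Ω V)
    (hc : ContinuousOn V Ω) : IntegrableOn V Ω := by
  rw [← integrable_indicator_iff hΩ.measurableSet]
  refine Continuous.integrable_of_hasCompactSupport ?_ (hasCompactSupport_indicator hΩb V)
  exact (contDiff_indicator hΩ (k := 0) hV (contDiffOn_zero.2 hc)).continuous

theorem integrableOn_of_continuous {Ω : Set (Eu n)} (hΩb : IsBounded Ω) {V : Eu n → F}
    (hc : Continuous V) : IntegrableOn V Ω :=
  (hc.continuousOn.integrableOn_compact hΩb.isCompact_closure).mono_set subset_closure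

theorem integral_fderiv_apply_eq_zero {g : Eu n → ℝ} (hg : ContDiff ℝ 1 g)
    (hc : HasCompactSupport g) (v : Eu n) : ∫ x, fderiv ℝ g x v = 0 := by
  have hcont : Continuous fun x => fderiv ℝ g x v :=
    (hg.continuous_fderiv (by norm_num)).clm_apply continuous_const
  have hint : Integrable fun x => fderiv ℝ g x v :=
    hcont.integrable_of_hasCompactSupport (hc.fderiv_apply (𝕜 := ℝ) v)
  have := integral_mul_fderiv_eq_neg_fderiv_mul_of_integrable (μ := (volume : Measure (Eu n)))
    (f := fun _ => (1 : ℝ)) (g := g) (v := v) (by simp) (by simpa using hint)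
    (by simpa using hg.continuous.integrable_of_hasCompactSupport hc) (by simp)
    (fun x _ => hg.differentiable (by norm_num) x)
  simpa using this

theorem integral_divg_eq_zero {Ω : Set (Eu n)} (hΩ : IsOpen Ω) (hΩb : IsBounded Ω)
    {V : Eu n → Eu n} (hV : VanishesNearFrontier Ω V) (hc : ContDiffOn ℝ 1 V Ω) :
    ∫ x in Ω, divg V x = 0 := by
  set Y := Ω.indicator V with hY
  have hY1 : ContDiff ℝ 1 Y := contDiff_indicator hΩ hV hc
  have hYc : HasCompactSupport Y := hasCompactSupport_indicator hΩb V
  have h1 : ∀ i, ContDiff ℝ 1 fun x => Y x i := fun i =>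
    (EuclideanSpace.proj i : Eu n →L[ℝ] ℝ).contDiff.comp hY1
  have h2 : ∀ i x v, fderiv ℝ Y x v i = fderiv ℝ (fun x => Y x i) x v := fun i x v => by
    have := ((EuclideanSpace.proj i : Eu n →L[ℝ] ℝ).hasFDerivAt.comp x
      (hY1.differentiable (by norm_num) x).hasFDerivAt).fderiv
    change fderiv ℝ (fun x => Y x i) x = _ at this
    rw [this]; rfl
  have h3 : ∀ i, HasCompactSupport fun x => Y x i := fun i =>
    hYc.comp_left (g := fun v : Eu n => v i) rfl
  have h4 : ∫ x, divg Y x = 0 := by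
    simp only [divg, h2]
    rw [integral_finsetSum]
    · exact Finset.sum_eq_zero fun i _ => integral_fderiv_apply_eq_zero (h1 i) (h3 i) _
    · intro i _
      exact (((h1 i).continuous_fderiv (by norm_num)).clm_apply
        continuous_const).integrable_of_hasCompactSupport ((h3 i).fderiv_apply (𝕜 := ℝ) _)
  rw [← h4, ← integral_indicator hΩ.measurableSet]
  congr 1
  ext x
  by_cases hx : x ∈ Ω
  · rw [Set.indicator_of_mem hx, divg, divg, (indicator_eventuallyEq_self hΩ V hx).fderiv_eq]
  · rw [Set.indicator_of_notMem hx, divg, (hV.eventually_indicator hΩ hx).fderiv_eq]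
    simp

theorem vanishesNearFrontier_of_eq_zero_of_le {Ω : Set (Eu n)} {φ : Eu n → ℝ} (hφ : Continuous φ)
    {ε : ℝ} (h0 : ∀ x ∈ frontier Ω, φ x < ε) {V : Eu n → F}
    (hV : ∀ x ∈ Ω, φ x ≤ ε → V x = 0) : VanishesNearFrontier Ω V := fun x hx => by
  filter_upwards [hφ.continuousAt.eventually_lt continuousAt_const (h0 x hx)] with y hy hyΩ
  exact hV y hyΩ hy.le

/-- A smooth step, `0` for `t ≤ ε` and `1` for `t ≥ 2ε`. -/
noncomputable def cutStep (ε t : ℝ) : ℝ := Real.smoothTransition (t / ε - 1)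

/-- A smooth convex approximation of `max t 0`, vanishing for `t ≤ ε`. -/
noncomputable def cutPos (ε t : ℝ) : ℝ := ∫ s in (0 : ℝ)..t, cutStep ε s

theorem contDiff_cutStep (ε : ℝ) {k : ℕ∞} : ContDiff ℝ k (cutStep ε) :=
  Real.smoothTransition.contDiff.comp (by fun_prop)

theorem continuous_cutStep (ε : ℝ) : Continuous (cutStep ε) := (contDiff_cutStep ε (k := 0)).continuous

theorem cutStep_nonneg (ε t : ℝ) : 0 ≤ cutStep ε t := Real.smoothTransition.nonneg _

theorem cutStep_le_one (ε t : ℝ) : cutStep ε t ≤ 1 := Real.smoothTransition.le_one _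

theorem cutStep_of_le {ε t : ℝ} (hε : 0 < ε) (h : t ≤ ε) : cutStep ε t = 0 :=
  Real.smoothTransition.zero_of_nonpos (by
    have := (div_le_one hε).2 h; linarith)

theorem cutStep_of_ge {ε t : ℝ} (hε : 0 < ε) (h : 2 * ε ≤ t) : cutStep ε t = 1 :=
  Real.smoothTransition.one_of_one_le (by
    have := (le_div_iff₀ hε).2 h; linarith)

theorem monotone_cutStep {ε : ℝ} (hε : 0 < ε) : Monotone (cutStep ε) := fun a b h =>
  Real.smoothTransition.monotone (by gcongr)

theorem deriv_cutStep_nonneg {ε : ℝ} (hε : 0 < ε) (t : ℝ) : 0 ≤ deriv (cutStep ε) t :=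
  (monotone_cutStep hε).deriv_nonneg

theorem hasDerivAt_cutPos (ε t : ℝ) : HasDerivAt (cutPos ε) (cutStep ε t) t :=
  ((continuous_cutStep ε).integral_hasStrictDerivAt 0 t).hasDerivAt

theorem deriv_cutPos (ε : ℝ) : deriv (cutPos ε) = cutStep ε :=
  funext fun t => (hasDerivAt_cutPos ε t).deriv

theorem contDiff_cutPos (ε : ℝ) {k : ℕ∞} : ContDiff ℝ k (cutPos ε) := by
  have : ContDiff ℝ (⊤ : ℕ∞) (cutPos ε) := by
    rw [contDiff_infty_iff_deriv]
    exact ⟨fun t => (hasDerivAt_cutPos ε t).differentiableAt, by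
      rw [deriv_cutPos]; exact contDiff_cutStep ε⟩
  exact this.of_le (by exact_mod_cast le_top)

theorem continuous_cutPos (ε : ℝ) : Continuous (cutPos ε) := (contDiff_cutPos ε (k := 0)).continuous

theorem monotone_cutPos (ε : ℝ) : Monotone (cutPos ε) :=
  monotone_of_deriv_nonneg (fun t => (hasDerivAt_cutPos ε t).differentiableAt) fun t => by
    rw [deriv_cutPos]; exact cutStep_nonneg ε t

theorem cutPos_zero (ε : ℝ) : cutPos ε 0 = 0 := intervalIntegral.integral_same

theorem cutPos_of_le {ε t : ℝ} (hε : 0 < ε) (h : t ≤ ε) : cutPos ε t = 0 := by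
  rw [cutPos, intervalIntegral.integral_congr (g := fun _ => 0)]
  · simp
  · intro s hs
    refine cutStep_of_le hε ?_
    rcases Set.mem_uIcc.1 hs with h' | h' <;> linarith [h'.1, h'.2]

theorem cutPos_nonneg {ε : ℝ} (hε : 0 < ε) (t : ℝ) : 0 ≤ cutPos ε t := by
  rcases le_total t ε with h | h
  · rw [cutPos_of_le hε h]
  · rw [← cutPos_of_le hε le_rfl]; exact monotone_cutPos ε h

theorem cutPos_le_mul {ε : ℝ} (hε : 0 < ε) {t : ℝ} (ht : 0 ≤ t) :
    cutPos ε t ≤ t * cutStep ε t := by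
  have := intervalIntegral.integral_mono_on (a := 0) (b := t) (μ := volume) ht
    ((continuous_cutStep ε).intervalIntegrable _ _) (continuous_const.intervalIntegrable _ _)
    (g := fun _ => cutStep ε t) (fun s hs => monotone_cutStep hε hs.2)
  simpa [cutPos] using this

theorem cutPos_le {ε : ℝ} (hε : 0 < ε) {t : ℝ} (ht : 0 ≤ t) : cutPos ε t ≤ t :=
  (cutPos_le_mul hε ht).trans (mul_le_of_le_one_right ht (cutStep_le_one ε t))

theorem le_cutPos_add {ε : ℝ} (hε : 0 < ε) (t : ℝ) : t ≤ cutPos ε t + 2 * ε := by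
  rcases le_total t (2 * ε) with h | h
  · linarith [cutPos_nonneg hε t]
  · have h0 : cutPos ε t = cutPos ε (2 * ε) + ∫ s in (2 * ε)..t, cutStep ε s :=
      (intervalIntegral.integral_add_adjacent_intervals
        ((continuous_cutStep ε).intervalIntegrable _ _)
        ((continuous_cutStep ε).intervalIntegrable _ _)).symm
    have h1 : ∫ s in (2 * ε)..t, cutStep ε s = t - 2 * ε := by
      rw [intervalIntegral.integral_congr (g := fun _ => (1 : ℝ))]
      · simp
      · intro s hs
        rw [Set.uIcc_of_le h] at hs
        exact cutStep_of_ge hε hs.1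
    linarith [cutPos_nonneg hε (2 * ε)]

theorem cutPos_le_max {ε : ℝ} (hε : 0 < ε) (t : ℝ) : cutPos ε t ≤ max t 0 := by
  rcases le_total 0 t with h | h
  · exact (cutPos_le hε h).trans (le_max_left _ _)
  · rw [cutPos_of_le hε (h.trans hε.le)]; exact le_max_right _ _

theorem abs_cutPos_le {ε : ℝ} (hε : 0 < ε) (t : ℝ) : |cutPos ε t| ≤ |t| := by
  rw [abs_of_nonneg (cutPos_nonneg hε t)]
  exact (cutPos_le_max hε t).trans (max_le (le_abs_self t) (abs_nonneg t))

theorem max_le_cutPos_add {ε : ℝ} (hε : 0 < ε) (t : ℝ) : max t 0 ≤ cutPos ε t + 2 * ε :=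
  max_le (le_cutPos_add hε t) (by linarith [cutPos_nonneg hε t])

/-- A sequence of positive reals decreasing to zero. -/
noncomputable def epsSeq (k : ℕ) : ℝ := 1 / ((k : ℝ) + 1)

theorem epsSeq_pos (k : ℕ) : 0 < epsSeq k := Nat.one_div_pos_of_nat

theorem tendsto_epsSeq : Tendsto epsSeq atTop (𝓝 0) := tendsto_one_div_add_atTop_nhds_zero_nat

theorem tendsto_cutPos (t : ℝ) :
    Tendsto (fun k => cutPos (epsSeq k) t) atTop (𝓝 (max t 0)) := by
  refine tendsto_of_tendsto_of_tendsto_of_le_of_le (g := fun k => max t 0 - 2 * epsSeq k)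
    (h := fun _ => max t 0) ?_ tendsto_const_nhds
    (fun k => by have := max_le_cutPos_add (epsSeq_pos k) t; simp only; linarith)
    (fun k => cutPos_le_max (epsSeq_pos k) t)
  simpa using tendsto_const_nhds.sub (tendsto_epsSeq.const_mul 2)

theorem tendsto_cutStep_of_pos {t : ℝ} (ht : 0 < t) :
    Tendsto (fun k => cutStep (epsSeq k) t) atTop (𝓝 1) := by
  refine tendsto_const_nhds.congr' ?_
  have : ∀ᶠ k in atTop, 2 * epsSeq k < t := by
    have := tendsto_epsSeq.const_mul 2
    rw [mul_zero] at this
    exact this.eventually_lt_const ht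
  filter_upwards [this] with k hk
  exact (cutStep_of_ge (epsSeq_pos k) hk.le).symm

theorem cutStep_mul_sub_cutPos_nonneg {ε : ℝ} (hε : 0 < ε) (t : ℝ) :
    0 ≤ t * cutStep ε t - cutPos ε t := by
  rcases le_total 0 t with h | h
  · linarith [cutPos_le_mul hε h]
  · rw [cutPos_of_le hε (by linarith), cutStep_of_le hε (by linarith)]; simp

theorem cutStep_mul_sub_cutPos_le {ε : ℝ} (hε : 0 < ε) (t : ℝ) :
    t * cutStep ε t - cutPos ε t ≤ 2 * ε := by
  rcases le_total 0 t with h | h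
  · have := le_cutPos_add hε t
    nlinarith [cutStep_le_one ε t]
  · rw [cutPos_of_le hε (by linarith), cutStep_of_le hε (by linarith)]; linarith

end Cutoff

section Green

variable {n : ℕ} {Ω : Set (Eu n)}

theorem continuous_lap {v : Eu n → ℝ} (hv : ContDiff ℝ 2 v) : Continuous (lap v) := by
  have h : ContDiff ℝ 1 (gradient v) := contDiff_gradient hv (by norm_num)
  have h1 : Continuous (fderiv ℝ (gradient v)) := h.continuous_fderiv (by norm_num)
  have h2 : lap v = fun y => ∑ i, fderiv ℝ (gradient v) y (EuclideanSpace.single i 1) i := rfl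
  rw [h2]
  refine continuous_finsetSum _ fun i _ => ?_
  exact (EuclideanSpace.proj i : Eu n →L[ℝ] ℝ).continuous.comp (h1.clm_apply continuous_const)

theorem tendsto_setIntegral_of_dominated (hΩ : IsOpen Ω) (hΩb : IsBounded Ω)
    {g : ℕ → Eu n → ℝ} {G : Eu n → ℝ} (B : Eu n → ℝ) (hg : ∀ k, ContinuousOn (g k) Ω)
    (hB : Continuous B) (hgB : ∀ k, ∀ x ∈ Ω, |g k x| ≤ B x)
    (hlim : ∀ x ∈ Ω, Tendsto (fun k => g k x) atTop (𝓝 (G x))) :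
    Tendsto (fun k => ∫ x in Ω, g k x) atTop (𝓝 (∫ x in Ω, G x)) := by
  refine tendsto_integral_of_dominated_convergence B
    (fun k => (hg k).aestronglyMeasurable hΩ.measurableSet)
    (integrableOn_of_continuous hΩb hB) (fun k => ?_) ?_
  · exact (ae_restrict_iff' hΩ.measurableSet).2 (ae_of_all _ fun x hx => hgB k x hx)
  · exact (ae_restrict_iff' hΩ.measurableSet).2 (ae_of_all _ hlim)

theorem integral_inner_gradient_eq (hΩ : IsOpen Ω) (hΩb : IsBounded Ω) {φ v : Eu n → ℝ}
    (hφ : ContDiff ℝ 1 φ) (hv : ContDiff ℝ 2 v) (hpos : ∀ x ∈ Ω, 0 ≤ φ x)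
    (h0 : ∀ x ∈ frontier Ω, φ x = 0) :
    ∫ x in Ω, inner ℝ (gradient φ x) (gradient v x) = -∫ x in Ω, φ x * lap v x := by
  have hgv : ContDiff ℝ 1 (gradient v) := contDiff_gradient hv (by norm_num)
  have hgφ := continuous_gradient hφ
  have hlv := continuous_lap hv
  have hc1 : Continuous fun x => inner ℝ (gradient φ x) (gradient v x) := hgφ.inner hgv.continuous
  have hc2 : Continuous fun x => φ x * lap v x := hφ.continuous.mul hlv
  have hk : ∀ k, ∫ x in Ω, (cutPos (epsSeq k) (φ x) * lap v x
      + cutStep (epsSeq k) (φ x) * inner ℝ (gradient φ x) (gradient v x)) = 0 := by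
    intro k
    have hV : VanishesNearFrontier Ω fun y => cutPos (epsSeq k) (φ y) • gradient v y :=
      vanishesNearFrontier_of_eq_zero_of_le hφ.continuous (ε := epsSeq k)
        (fun x hx => by rw [h0 x hx]; exact epsSeq_pos k)
        (fun x _ hx => by rw [cutPos_of_le (epsSeq_pos k) hx, zero_smul])
    have hcp : ContDiff ℝ 1 fun y => cutPos (epsSeq k) (φ y) :=
      (contDiff_cutPos (epsSeq k) (k := 1)).comp hφ
    have := integral_divg_eq_zero hΩ hΩb hV (hcp.smul hgv).contDiffOn
    rw [← this]
    congr 1; ext x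
    rw [divg_smul (hcp.differentiable (by norm_num) x) (hgv.differentiable (by norm_num) x),
      gradient_comp (hasDerivAt_cutPos _ _).differentiableAt (hφ.differentiable (by norm_num) x),
      deriv_cutPos, inner_smul_left]
    rfl
  have hlim := tendsto_setIntegral_of_dominated hΩ hΩb
    (g := fun k x => cutPos (epsSeq k) (φ x) * lap v x
      + cutStep (epsSeq k) (φ x) * inner ℝ (gradient φ x) (gradient v x))
    (G := fun x => φ x * lap v x + inner ℝ (gradient φ x) (gradient v x))
    (fun x => |φ x * lap v x| + |inner ℝ (gradient φ x) (gradient v x)|)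
    (fun k => (((continuous_cutPos _).comp hφ.continuous).mul hlv |>.add
      (((continuous_cutStep _).comp hφ.continuous).mul hc1)).continuousOn)
    (hc2.abs.add hc1.abs) (fun k x _ => by
      refine (abs_add_le _ _).trans (add_le_add ?_ ?_)
      · rw [abs_mul, abs_mul]
        exact mul_le_mul_of_nonneg_right (abs_cutPos_le (epsSeq_pos k) _) (abs_nonneg _)
      · rw [abs_mul, abs_of_nonneg (cutStep_nonneg _ _)]
        exact mul_le_of_le_one_left (abs_nonneg _) (cutStep_le_one _ _))
    (fun x hx => by
      refine Tendsto.add ?_ ?_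
      · have := (tendsto_cutPos (φ x)).mul_const (lap v x)
        rwa [max_eq_left (hpos x hx)] at this
      · rcases (hpos x hx).eq_or_lt with h | h
        · have hmin : IsLocalMin φ x := by
            filter_upwards [hΩ.mem_nhds hx] with y hy
            rw [← h]; exact hpos y hy
          have hg0 : gradient φ x = 0 := gradient_eq_of_fderiv fun w => by
            rw [hmin.fderiv_eq_zero]; simp
          simp [hg0]
        · simpa using (tendsto_cutStep_of_pos h).mul_const (inner ℝ (gradient φ x) (gradient v x)))
  simp only [hk] at hlim
  have h1 := tendsto_nhds_unique hlim tendsto_const_nhds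
  rw [integral_add (integrableOn_of_continuous hΩb hc2) (integrableOn_of_continuous hΩb hc1)] at h1
  linarith

theorem gradient_half_sq_dist (y x : Eu n) :
    gradient (fun x => (1 / 2 : ℝ) * inner ℝ (x - y) (x - y)) x = x - y := by
  refine gradient_eq_of_fderiv fun v => ?_
  have h : DifferentiableAt ℝ (fun x : Eu n => x - y) x := by fun_prop
  rw [fderiv_const_mul (h.inner ℝ h)]
  rw [smul_apply, fderiv_inner_apply ℝ (by fun_prop) (by fun_prop), fderiv_sub_const,
    fderiv_fun_id]
  simp only [ContinuousLinearMap.id_apply, smul_eq_mul, real_inner_comm v]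
  ring

theorem integral_inner_gradient_sub_eq (hΩ : IsOpen Ω) (hΩb : IsBounded Ω) {φ : Eu n → ℝ}
    (hφ : ContDiff ℝ 1 φ) (hpos : ∀ x ∈ Ω, 0 ≤ φ x) (h0 : ∀ x ∈ frontier Ω, φ x = 0) (y : Eu n) :
    ∫ x in Ω, inner ℝ (gradient φ x) (x - y) = -(n * ∫ x in Ω, φ x) := by
  have hg : gradient (fun x : Eu n => (1 / 2 : ℝ) * inner ℝ (x - y) (x - y)) = fun x => x - y :=
    funext fun x => gradient_half_sq_dist y x
  have hl : ∀ x, lap (fun x : Eu n => (1 / 2 : ℝ) * inner ℝ (x - y) (x - y)) x = n := fun x => by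
    rw [lap, hg, divg_sub_const]
  have := integral_inner_gradient_eq hΩ hΩb hφ
    (v := fun x : Eu n => (1 / 2 : ℝ) * inner ℝ (x - y) (x - y))
    (contDiff_const.mul ((contDiff_id.sub contDiff_const).inner ℝ (contDiff_id.sub contDiff_const)))
    hpos h0
  simp only [hg, hl] at this
  rw [this, integral_mul_const, mul_comm]

theorem integral_sq_le_integral_sq_gradient (hn : 2 ≤ n) (hΩ : IsOpen Ω) (hΩb : IsBounded Ω)
    {φ : Eu n → ℝ}
    (hφ : ContDiff ℝ 1 φ) (h0 : ∀ x ∈ frontier Ω, φ x = 0)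
    {y : Eu n} {R : ℝ} (hR : ∀ x ∈ Ω, ‖x - y‖ ≤ R) :
    ∫ x in Ω, φ x ^ 2 ≤ R ^ 2 * ∫ x in Ω, ‖gradient φ x‖ ^ 2 := by
  have hgφ := continuous_gradient hφ
  have hg : ∀ x, gradient (fun x => φ x ^ 2) x = (2 * φ x) • gradient φ x := fun x =>
    gradient_sq (hφ.differentiable (by norm_num) x)
  have h := integral_inner_gradient_sub_eq hΩ hΩb (φ := fun x => φ x ^ 2) (by fun_prop)
    (fun x _ => sq_nonneg _) (fun x hx => by simp [h0 x hx]) y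
  simp only [hg, inner_smul_left] at h
  have hi1 : IntegrableOn (fun x => φ x ^ 2) Ω :=
    integrableOn_of_continuous hΩb (hφ.continuous.pow 2)
  have hi2 : IntegrableOn (fun x => R ^ 2 * ‖gradient φ x‖ ^ 2) Ω :=
    integrableOn_of_continuous hΩb (by fun_prop)
  have h2 : -∫ x in Ω, 2 * φ x * inner ℝ (gradient φ x) (x - y)
      ≤ ∫ x in Ω, (φ x ^ 2 + R ^ 2 * ‖gradient φ x‖ ^ 2) := by
    rw [← integral_neg]
    refine setIntegral_mono_on (integrableOn_of_continuous hΩb ?_) (hi1.add hi2)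
      hΩ.measurableSet fun x hx => ?_
    · have := hφ.continuous
      fun_prop
    · have h3 := abs_real_inner_le_norm (gradient φ x) (x - y)
      have h4 : |inner ℝ (gradient φ x) (x - y)| ≤ R * ‖gradient φ x‖ := by
        rw [mul_comm]; exact h3.trans (by gcongr; exact hR x hx)
      have h5 : -(2 * φ x * inner ℝ (gradient φ x) (x - y))
          ≤ 2 * (|φ x| * |inner ℝ (gradient φ x) (x - y)|) := by
        rw [← abs_mul]
        have := neg_abs_le (φ x * inner ℝ (gradient φ x) (x - y))
        linarith
      have h6 : |φ x| * |inner ℝ (gradient φ x) (x - y)| ≤ |φ x| * (R * ‖gradient φ x‖) := by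
        gcongr
      nlinarith [sq_nonneg (|φ x| - R * ‖gradient φ x‖), sq_abs (φ x)]
  rw [integral_add hi1 hi2, integral_const_mul] at h2
  simp only [conj_trivial] at h
  rw [h, neg_neg] at h2
  have h7 : 0 ≤ ∫ x in Ω, φ x ^ 2 := integral_nonneg fun x => sq_nonneg _
  have : (2 : ℝ) ≤ n := by exact_mod_cast hn
  nlinarith

/-- A positive classical solution of `-Δu = λ f(u)` in `Ω`, `u = 0` on `∂Ω`. -/
structure IsPositiveSolution (Ω : Set (Eu n)) (f : ℝ → ℝ) (lam : ℝ) (u : Eu n → ℝ) : Prop where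
  smooth : ContDiff ℝ (⊤ : ℕ∞) u
  pos : ∀ x ∈ Ω, 0 < u x
  eq : ∀ x ∈ Ω, lap u x = -(lam * f (u x))
  bc : ∀ x ∈ frontier Ω, u x = 0

namespace IsPositiveSolution

variable {f : ℝ → ℝ} {lam : ℝ} {u : Eu n → ℝ}

theorem contDiff (h : IsPositiveSolution Ω f lam u) {k : ℕ∞} : ContDiff ℝ k u :=
  h.smooth.of_le (by exact_mod_cast le_top)

theorem continuous (h : IsPositiveSolution Ω f lam u) : Continuous u := h.smooth.continuous

theorem continuous_grad (h : IsPositiveSolution Ω f lam u) : Continuous (gradient u) :=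
  continuous_gradient (h.contDiff (k := 1))

theorem differentiable (h : IsPositiveSolution Ω f lam u) : Differentiable ℝ u :=
  (h.contDiff (k := 1)).differentiable (by norm_num)

theorem integral_inner_gradient (h : IsPositiveSolution Ω f lam u) (hΩ : IsOpen Ω)
    (hΩb : IsBounded Ω) {φ : Eu n → ℝ} (hφ : ContDiff ℝ 1 φ) (hpos : ∀ x ∈ Ω, 0 ≤ φ x)
    (h0 : ∀ x ∈ frontier Ω, φ x = 0) :
    ∫ x in Ω, inner ℝ (gradient φ x) (gradient u x) = lam * ∫ x in Ω, f (u x) * φ x := by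
  rw [integral_inner_gradient_eq hΩ hΩb hφ (h.contDiff (k := 2)) hpos h0, ← integral_neg,
    ← integral_const_mul]
  refine setIntegral_congr_fun hΩ.measurableSet fun x hx => ?_
  simp only [h.eq x hx]; ring

theorem integral_deriv_mul_sq (h : IsPositiveSolution Ω f lam u) (hΩ : IsOpen Ω)
    (hΩb : IsBounded Ω) {β : ℝ → ℝ} (hβ : ContDiff ℝ 1 β) (hβ0 : β 0 = 0)
    (hpos : ∀ t, 0 ≤ t → 0 ≤ β t) :
    ∫ x in Ω, deriv β (u x) * ‖gradient u x‖ ^ 2 = lam * ∫ x in Ω, f (u x) * β (u x) := by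
  rw [← h.integral_inner_gradient hΩ hΩb (φ := fun y => β (u y)) (hβ.comp (h.contDiff (k := 1)))
    (fun x hx => hpos _ (h.pos x hx).le) (fun x hx => by simp [h.bc x hx, hβ0])]
  congr 1; ext x
  rw [gradient_comp (hβ.differentiable (by norm_num) _) (h.differentiable x),
    inner_smul_left, real_inner_self_eq_norm_sq]
  simp

theorem integral_sq_gradient (h : IsPositiveSolution Ω f lam u) (hΩ : IsOpen Ω)
    (hΩb : IsBounded Ω) :
    ∫ x in Ω, ‖gradient u x‖ ^ 2 = lam * ∫ x in Ω, f (u x) * u x := by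
  simpa using h.integral_deriv_mul_sq hΩ hΩb (β := fun t => t) contDiff_id rfl fun t ht => ht

end IsPositiveSolution

/-- The primitive of `f` vanishing at the origin. -/
noncomputable def prim (f : ℝ → ℝ) (t : ℝ) : ℝ := ∫ s in (0 : ℝ)..t, f s

theorem hasDerivAt_prim {f : ℝ → ℝ} (hf : Continuous f) (t : ℝ) : HasDerivAt (prim f) (f t) t :=
  (hf.integral_hasStrictDerivAt 0 t).hasDerivAt

theorem deriv_prim {f : ℝ → ℝ} (hf : Continuous f) : deriv (prim f) = f :=
  funext fun t => (hasDerivAt_prim hf t).deriv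

theorem contDiff_prim {f : ℝ → ℝ} (hf : Continuous f) : ContDiff ℝ 1 (prim f) := by
  rw [contDiff_one_iff_deriv, deriv_prim hf]
  exact ⟨fun t => (hasDerivAt_prim hf t).differentiableAt, hf⟩

theorem prim_zero (f : ℝ → ℝ) : prim f 0 = 0 := intervalIntegral.integral_same

theorem prim_nonneg {f : ℝ → ℝ} (hf : ∀ t, 0 ≤ t → 0 ≤ f t) {t : ℝ} (ht : 0 ≤ t) :
    0 ≤ prim f t :=
  intervalIntegral.integral_nonneg ht fun s hs => hf s hs.1

theorem IsPositiveSolution.integral_mul_inner_sub {f : ℝ → ℝ} {lam : ℝ} {u : Eu n → ℝ}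
    (h : IsPositiveSolution Ω f lam u) (hΩ : IsOpen Ω) (hΩb : IsBounded Ω) (hf : Continuous f)
    (hfpos : ∀ t, 0 ≤ t → 0 ≤ f t) (y : Eu n) :
    ∫ x in Ω, f (u x) * inner ℝ (gradient u x) (x - y) = -(n * ∫ x in Ω, prim f (u x)) := by
  rw [← integral_inner_gradient_sub_eq hΩ hΩb (φ := fun x => prim f (u x))
    ((contDiff_prim hf).comp (h.contDiff (k := 1))) (fun x hx => prim_nonneg hfpos (h.pos x hx).le)
    (fun x hx => by rw [h.bc x hx, prim_zero]) y]
  congr 1; ext x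
  rw [gradient_comp (hasDerivAt_prim hf _).differentiableAt (h.differentiable x), deriv_prim hf,
    inner_smul_left]
  simp

end Green

theorem integrable_and_integral_le_of_tendsto {α : Type*} [MeasurableSpace α] {μ : Measure α}
    {g : ℕ → α → ℝ} {G : α → ℝ} {C : ℝ} (hg : ∀ k, Integrable (g k) μ)
    (h0 : ∀ k, 0 ≤ᵐ[μ] g k) (hC : ∀ k, ∫ x, g k x ∂μ ≤ C)
    (hlim : ∀ᵐ x ∂μ, Tendsto (fun k => g k x) atTop (𝓝 (G x))) :
    Integrable G μ ∧ ∫ x, G x ∂μ ≤ C := by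
  have hGm : AEStronglyMeasurable G μ :=
    aestronglyMeasurable_of_tendsto_ae atTop (fun k => (hg k).aestronglyMeasurable) hlim
  have hG0 : 0 ≤ᵐ[μ] G := by
    filter_upwards [hlim, ae_all_iff.2 h0] with x hx h
    exact ge_of_tendsto' hx h
  have hC0 : 0 ≤ C := (integral_nonneg_of_ae (h0 0)).trans (hC 0)
  have h1 : ∫⁻ x, ENNReal.ofReal (G x) ∂μ ≤ ENNReal.ofReal C := by
    calc ∫⁻ x, ENNReal.ofReal (G x) ∂μ
        = ∫⁻ x, liminf (fun k => ENNReal.ofReal (g k x)) atTop ∂μ := by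
          refine lintegral_congr_ae ?_
          filter_upwards [hlim] with x hx
          exact ((ENNReal.continuous_ofReal.tendsto _).comp hx).liminf_eq.symm
      _ ≤ liminf (fun k => ∫⁻ x, ENNReal.ofReal (g k x) ∂μ) atTop :=
          lintegral_liminf_le' fun k => (hg k).aemeasurable.ennreal_ofReal
      _ ≤ ENNReal.ofReal C := by
          refine liminf_le_of_le (by isBoundedDefault) fun b hb => ?_
          obtain ⟨k, hk⟩ := hb.exists
          refine hk.trans ?_
          rw [← ofReal_integral_eq_lintegral_ofReal (hg k) (h0 k)]
          exact ENNReal.ofReal_le_ofReal (hC k)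
  refine ⟨⟨hGm, ?_⟩, ?_⟩
  · rw [hasFiniteIntegral_iff_ofReal hG0]
    exact h1.trans_lt ENNReal.ofReal_lt_top
  · rw [integral_eq_lintegral_of_nonneg_ae hG0 hGm]
    exact ENNReal.toReal_le_of_le_ofReal hC0 h1

theorem deriv_deriv_nonneg_of_isLocalMin {g : ℝ → ℝ} {x : ℝ} (hg : ContinuousAt g x)
    (h : IsLocalMin g x) : 0 ≤ deriv (deriv g) x := by
  by_contra! hneg
  have hmax := isLocalMax_of_deriv_deriv_neg hneg h.deriv_eq_zero hg
  have hconst : g =ᶠ[𝓝 x] fun _ => g x := by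
    filter_upwards [h, hmax] with y h1 h2 using le_antisymm h2 h1
  have h2 : deriv g =ᶠ[𝓝 x] fun _ => 0 := by
    have := hconst.deriv
    simpa using this
  rw [h2.deriv_eq] at hneg
  simp at hneg

section Stability

variable {n : ℕ} {Ω : Set (Eu n)}

theorem lap_nonneg_of_isLocalMin {w : Eu n → ℝ} (hw : ContDiff ℝ 2 w) {x : Eu n}
    (h : IsLocalMin w x) : 0 ≤ lap w x := by
  have hg : Differentiable ℝ (gradient w) :=
    (contDiff_gradient (k := 1) hw (by norm_num)).differentiable (by norm_num)
  rw [lap, divg]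
  refine Finset.sum_nonneg fun i _ => ?_
  set e : Eu n := EuclideanSpace.single i 1
  have hline : ∀ t : ℝ, HasDerivAt (fun t : ℝ => x + t • e) e t := fun t => by
    simpa using ((hasDerivAt_id t).smul_const e).const_add x
  have h1 : deriv (fun t : ℝ => w (x + t • e)) = fun t => gradient w (x + t • e) i := by
    ext t
    have := ((hw.differentiable (by norm_num) (x + t • e)).hasFDerivAt.comp_hasDerivAt t
      (hline t)).deriv
    have hin : ∀ a : Eu n, inner ℝ a e = a i := fun a => by
      simp [e, EuclideanSpace.inner_single_right]
    rw [show (fun t : ℝ => w (x + t • e)) = w ∘ fun t : ℝ => x + t • e from rfl, this,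
      ← inner_gradient, hin]
  have h2 : deriv (fun t : ℝ => gradient w (x + t • e) i) 0 = fderiv ℝ (gradient w) x e i := by
    have h3 := (hg (x + (0 : ℝ) • e)).hasFDerivAt.comp_hasDerivAt 0 (hline 0)
    have h4 := ((EuclideanSpace.proj i : Eu n →L[ℝ] ℝ).hasFDerivAt.comp_hasDerivAt 0 h3).deriv
    simp only [zero_smul, add_zero] at h4
    exact h4
  have hcont : Continuous fun t : ℝ => w (x + t • e) := hw.continuous.comp (by fun_prop)
  have hmin : IsLocalMin (fun t : ℝ => w (x + t • e)) 0 := by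
    have : Tendsto (fun t : ℝ => x + t • e) (𝓝 0) (𝓝 x) := by
      have := (hline 0).continuousAt.tendsto
      simpa using this
    have := this.eventually h
    filter_upwards [this] with t ht
    simpa using ht
  have := deriv_deriv_nonneg_of_isLocalMin hcont.continuousAt hmin
  rwa [h1, h2] at this

theorem integral_neg_lap_div_mul_sq_le (hΩ : IsOpen Ω) (hΩb : IsBounded Ω) {w ξ : Eu n → ℝ}
    (hw : ContDiff ℝ 2 w) (hpos : ∀ x ∈ Ω, 0 < w x) (hξ : ContDiff ℝ 1 ξ)
    (hξ0 : VanishesNearFrontier Ω ξ) :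
    ∫ x in Ω, -lap w x / w x * ξ x ^ 2 ≤ ∫ x in Ω, ‖gradient ξ x‖ ^ 2 := by
  have hgw : ContDiff ℝ 1 (gradient w) := contDiff_gradient hw (by norm_num)
  have hw1 : ContDiff ℝ 1 w := hw.of_le (by norm_num)
  have hgξ := continuous_gradient hξ
  have hlw := continuous_lap hw
  have ha : ContDiffOn ℝ 1 (fun x => ξ x ^ 2 / w x) Ω :=
    (hξ.pow 2).contDiffOn.div hw1.contDiffOn fun x hx => (hpos x hx).ne'
  have hV0 : VanishesNearFrontier Ω fun x => (ξ x ^ 2 / w x) • gradient w x :=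
    hξ0.imp fun y _ h => by simp [h]
  have hdiv : ∀ x ∈ Ω, divg (fun x => (ξ x ^ 2 / w x) • gradient w x) x
      ≤ ‖gradient ξ x‖ ^ 2 - -lap w x / w x * ξ x ^ 2 := by
    intro x hx
    have hwx := hpos x hx
    have hξd : DifferentiableAt ℝ ξ x := hξ.differentiable (by norm_num) x
    have hwd : DifferentiableAt ℝ w x := hw1.differentiable (by norm_num) x
    rw [divg_smul ((ha.contDiffAt (hΩ.mem_nhds hx)).differentiableAt (by norm_num))
      (hgw.differentiable (by norm_num) x)]
    have hgr : gradient (fun x => ξ x ^ 2 / w x) x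
        = (2 * ξ x / w x) • gradient ξ x - (ξ x ^ 2 / w x ^ 2) • gradient w x := by
      have hinv : gradient (fun y => (w y)⁻¹) x = -(w x ^ 2)⁻¹ • gradient w x := by
        rw [gradient_comp (g := fun t => t⁻¹) (differentiableAt_inv hwx.ne') hwd, deriv_inv]
      simp only [div_eq_mul_inv]
      rw [gradient_mul (a := fun x => ξ x ^ 2) (b := fun x => (w x)⁻¹) (hξd.pow 2)
        (hwd.inv hwx.ne'), hinv, gradient_sq hξd]
      module
    rw [hgr, inner_sub_left, inner_smul_left, inner_smul_left, real_inner_self_eq_norm_sq]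
    have h1 := real_inner_le_norm (gradient ξ x) ((ξ x / w x) • gradient w x)
    rw [inner_smul_right, norm_smul] at h1
    have h2 : ‖ξ x / w x‖ ^ 2 = ξ x ^ 2 / w x ^ 2 := by rw [Real.norm_eq_abs, sq_abs, div_pow]
    have h3 : (2 * ξ x / w x) = 2 * (ξ x / w x) := by ring
    have h4 : -lap w x / w x * ξ x ^ 2 = -(ξ x ^ 2 / w x * lap w x) := by ring
    simp only [conj_trivial]
    rw [h3, h4, ← h2, show divg (gradient w) x = lap w x from rfl]
    nlinarith [sq_nonneg (‖gradient ξ x‖ - ‖ξ x / w x‖ * ‖gradient w x‖)]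
  have hi1 : IntegrableOn (fun x => ‖gradient ξ x‖ ^ 2) Ω :=
    integrableOn_of_continuous hΩb (by fun_prop)
  have hi2 : IntegrableOn (fun x => -lap w x / w x * ξ x ^ 2) Ω :=
    integrableOn_of_vanishesNearFrontier hΩ hΩb (hξ0.imp fun y _ h => by simp [h])
      ((hlw.neg.continuousOn.div hw.continuous.continuousOn fun x hx => (hpos x hx).ne').mul
        (hξ.continuous.pow 2).continuousOn)
  have hi3 : IntegrableOn (fun x => divg (fun x => (ξ x ^ 2 / w x) • gradient w x) x) Ω := by
    refine integrableOn_of_vanishesNearFrontier hΩ hΩb ?_ ?_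
    · intro x hx
      filter_upwards [(hV0 x hx).eventually_nhds] with y hy hyΩ
      have : (fun x => (ξ x ^ 2 / w x) • gradient w x) =ᶠ[𝓝 y] fun _ => 0 := by
        filter_upwards [hy, hΩ.mem_nhds hyΩ] with z hz hzΩ using hz hzΩ
      rw [divg, this.fderiv_eq]; simp
    · have h1 := (ha.smul hgw.contDiffOn).continuousOn_fderiv_of_isOpen hΩ (by norm_num)
      refine continuousOn_finsetSum _ fun i _ => ?_
      exact (EuclideanSpace.proj i : Eu n →L[ℝ] ℝ).continuous.comp_continuousOn
        (h1.clm_apply continuousOn_const)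
  have h := setIntegral_mono_on hi3 (hi1.sub hi2) hΩ.measurableSet hdiv
  rw [integral_divg_eq_zero hΩ hΩb hV0 (ha.smul hgw.contDiffOn)] at h
  have h5 := integral_sub hi1 hi2
  simp only [Pi.sub_apply] at h
  linarith

/-- Stability of `u` against perturbations supported away from the boundary. -/
def IsStable (Ω : Set (Eu n)) (f : ℝ → ℝ) (lam : ℝ) (u : Eu n → ℝ) : Prop :=
  ∀ ξ : Eu n → ℝ, ContDiff ℝ 1 ξ → VanishesNearFrontier Ω ξ →
    lam * ∫ x in Ω, deriv f (u x) * ξ x ^ 2 ≤ ∫ x in Ω, ‖gradient ξ x‖ ^ 2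

theorem isStable_of_tendsto (hΩ : IsOpen Ω) (hΩb : IsBounded Ω) {f : ℝ → ℝ}
    (hf : ContDiff ℝ 1 f) (hfpos : ∀ t, 0 ≤ t → 0 < f t) (hfmono : StrictMonoOn f (Set.Ici 0))
    {lam : ℝ} (hlam : 0 < lam) {u : Eu n → ℝ} (hu : IsPositiveSolution Ω f lam u)
    {nu : ℕ → ℝ} (hnu : ∀ k, lam < nu k) {v : ℕ → Eu n → ℝ}
    (hv : ∀ k, IsPositiveSolution Ω f (nu k) (v k)) (hle : ∀ k, ∀ x ∈ Ω, u x ≤ v k x)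
    (hlim : ∀ᵐ x ∂volume.restrict Ω, Tendsto (fun k => v k x) atTop (𝓝 (u x))) :
    IsStable Ω f lam u := by
  intro ξ hξ hξ0
  have hw : ∀ k, ContDiff ℝ 2 fun x => v k x - u x := fun k =>
    ((hv k).contDiff (k := 2)).sub (hu.contDiff (k := 2))
  have hlap : ∀ k, ∀ x ∈ Ω, -lap (fun x => v k x - u x) x
      = nu k * f (v k x) - lam * f (u x) := fun k x hx => by
    rw [lap_sub ((hv k).contDiff (k := 2)) (hu.contDiff (k := 2)), (hv k).eq x hx, hu.eq x hx]
    ring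
  have hfle : ∀ k, ∀ x ∈ Ω, f (u x) ≤ f (v k x) := fun k x hx =>
    hfmono.monotoneOn (hu.pos x hx).le ((hv k).pos x hx).le (hle k x hx)
  have hpos : ∀ k, ∀ x ∈ Ω, 0 < v k x - u x := by
    intro k x hx
    refine lt_of_le_of_ne (sub_nonneg.2 (hle k x hx)) fun h => ?_
    have hmin : IsLocalMin (fun x => v k x - u x) x := by
      filter_upwards [hΩ.mem_nhds hx] with y hy
      rw [← h]; exact sub_nonneg.2 (hle k y hy)
    have h1 := lap_nonneg_of_isLocalMin (hw k) hmin
    have h2 := hlap k x hx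
    have h3 := hfpos _ (hu.pos x hx).le
    nlinarith [hfle k x hx, hnu k]
  have hmain : ∀ k, ∫ x in Ω, lam * ((f (v k x) - f (u x)) / (v k x - u x) * ξ x ^ 2)
      ≤ ∫ x in Ω, ‖gradient ξ x‖ ^ 2 := by
    intro k
    refine le_trans ?_ (integral_neg_lap_div_mul_sq_le hΩ hΩb (hw k) (hpos k) hξ hξ0)
    refine integral_mono_of_nonneg ?_ ?_ ?_
    · refine (ae_restrict_iff' hΩ.measurableSet).2 (ae_of_all _ fun x hx => ?_)
      have h1 := hpos k x hx
      have h2 := sub_nonneg.2 (hfle k x hx)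
      simp only [Pi.zero_apply]
      positivity
    · exact integrableOn_of_vanishesNearFrontier hΩ hΩb (hξ0.imp fun y _ h => by simp [h])
        (((continuous_lap (hw k)).neg.continuousOn.div (hw k).continuous.continuousOn
          fun x hx => (hpos k x hx).ne').mul (hξ.continuous.pow 2).continuousOn)
    · refine (ae_restrict_iff' hΩ.measurableSet).2 (ae_of_all _ fun x hx => ?_)
      have h1 := hpos k x hx
      simp only
      rw [hlap k x hx, ← mul_assoc, ← mul_div_assoc]
      gcongr
      have := hfpos _ ((hv k).pos x hx).le
      nlinarith [hnu k]
  rw [← integral_const_mul]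
  refine (integrable_and_integral_le_of_tendsto
    (g := fun k x => lam * ((f (v k x) - f (u x)) / (v k x - u x) * ξ x ^ 2)) (fun k => ?_)
    (fun k => ?_) hmain ?_).2
  · have h1 := (hv k).continuous
    have h2 := hu.continuous
    have h3 := hf.continuous
    exact integrableOn_of_vanishesNearFrontier hΩ hΩb (hξ0.imp fun y _ h => by simp [h])
        (continuousOn_const.mul (((by fun_prop : Continuous fun x => f (v k x) - f (u x)).continuousOn.div
        (hw k).continuous.continuousOn
          fun x hx => (hpos k x hx).ne').mul (hξ.continuous.pow 2).continuousOn))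
  · refine (ae_restrict_iff' hΩ.measurableSet).2 (ae_of_all _ fun x hx => ?_)
    have h1 := hpos k x hx
    have h2 := sub_nonneg.2 (hfle k x hx)
    simp only [Pi.zero_apply]
    positivity
  · filter_upwards [hlim, ae_restrict_mem hΩ.measurableSet] with x hx hxΩ
    refine Tendsto.const_mul _ (Tendsto.mul_const _ ?_)
    have h1 := (hf.differentiable (by norm_num) (u x)).hasDerivAt.tendsto_slope
    have h2 : Tendsto (fun k => v k x) atTop (𝓝[≠] (u x)) :=
      tendsto_nhdsWithin_iff.2 ⟨hx, Eventually.of_forall fun k => by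
        have := hpos k x hxΩ
        simp only [Set.mem_compl_iff, Set.mem_singleton_iff]
        linarith⟩
    refine (h1.comp h2).congr fun k => ?_
    simp [slope_def_field]

end Stability

section ConvexDomain

variable {n : ℕ} {Ω : Set (Eu n)} {f : ℝ → ℝ} {lam : ℝ} {u : Eu n → ℝ}

theorem IsPositiveSolution.inner_gradient_nonneg (hu : IsPositiveSolution Ω f lam u)
    (hΩ : IsOpen Ω) (hΩc : Convex ℝ Ω) {x y : Eu n} (hx : x ∈ frontier Ω) (hy : y ∈ closure Ω) :
    0 ≤ inner ℝ (y - x) (gradient u x) := by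
  have hmin : IsLocalMinOn u (closure Ω) x := by
    filter_upwards [self_mem_nhdsWithin] with z hz
    rw [hu.bc x hx]
    by_cases hzΩ : z ∈ Ω
    · exact (hu.pos z hzΩ).le
    · exact (hu.bc z (by rw [hΩ.frontier_eq]; exact ⟨hz, hzΩ⟩)).ge
  have h := hmin.hasFDerivWithinAt_nonneg (hu.differentiable x).hasFDerivAt.hasFDerivWithinAt
    (sub_mem_posTangentConeAt_of_segment_subset
      (hΩc.closure.segment_subset (frontier_subset_closure hx) hy))
  rwa [← inner_gradient, real_inner_comm] at h

theorem IsPositiveSolution.lap_inner_sub_gradient (hu : IsPositiveSolution Ω f lam u)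
    (hΩ : IsOpen Ω) (hf : ContDiff ℝ 1 f) (z : Eu n) {x : Eu n} (hx : x ∈ Ω) :
    lap (fun y => inner ℝ (z - y) (gradient u y)) x
      = -(lam * (deriv f (u x) * inner ℝ (z - x) (gradient u x))) + 2 * lam * f (u x) := by
  rw [_root_.lap_inner_sub_gradient (hu.contDiff (k := 3)), hu.eq x hx]
  have h1 : lap u =ᶠ[𝓝 x] fun y => -(lam * f (u y)) := by
    filter_upwards [hΩ.mem_nhds hx] with y hy using hu.eq y hy
  have h2 : HasFDerivAt (fun y => -(lam * f (u y))) (-(lam • (deriv f (u x) • fderiv ℝ u x))) x :=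
    (((hf.differentiable (by norm_num) (u x)).hasDerivAt.comp_hasFDerivAt x
      (hu.differentiable x).hasFDerivAt).const_mul lam).neg
  rw [h1.fderiv_eq, h2.fderiv]
  have h3 := inner_gradient u x (z - x)
  rw [real_inner_comm] at h3
  simp only [neg_apply, smul_apply, smul_eq_mul, ← h3]
  ring

/-- Testing stability with the positive part of the derivative of `u` under the dilation centred
at `z`, localised by a cutoff which only sees those points `x` with `2x - z` in `Ω`. -/
theorem IsStable.integral_dilation_le (hs : IsStable Ω f lam u)
    (hu : IsPositiveSolution Ω f lam u) (hΩ : IsOpen Ω) (hΩb : IsBounded Ω) (hΩc : Convex ℝ Ω)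
    (hf : ContDiff ℝ 1 f) {χ : Eu n → ℝ}
    (hχ : ContDiff ℝ 1 χ) (hχΩ : tsupport χ ⊆ Ω) (z : Eu n) :
    ∫ x in Ω, 2 * lam * (f (u x) * (max (inner ℝ (z - x) (gradient u x)) 0
        * χ ((2 : ℝ) • x - z) ^ 2))
      ≤ ∫ x in Ω, max (inner ℝ (z - x) (gradient u x)) 0 ^ 2
        * ‖gradient (fun x => χ ((2 : ℝ) • x - z)) x‖ ^ 2 := by
  set η : Eu n → ℝ := fun x => χ ((2 : ℝ) • x - z) with hη
  set b : Eu n → ℝ := fun x => inner ℝ (z - x) (gradient u x) with hb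
  have hη1 : ContDiff ℝ 1 η := hχ.comp (by fun_prop)
  have hb2 : ContDiff ℝ 2 b :=
    (contDiff_const.sub contDiff_id).inner ℝ
      (contDiff_gradient (k := 2) (hu.contDiff (k := 3)) (by norm_num))
  have hb1 : ContDiff ℝ 1 b := hb2.of_le (by norm_num)
  have hgb : ContDiff ℝ 1 (gradient b) := contDiff_gradient hb2 (by norm_num)
  have hgη := continuous_gradient hη1
  have hηc := hη1.continuous
  have hbc := hb1.continuous
  have huc := hu.continuous
  have hfc := hf.continuous
  have hf'c := hf.continuous_deriv (by norm_num)
  have hvan : ∀ k, VanishesNearFrontier Ω fun x => cutPos (epsSeq k) (b x) * η x := by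
    intro k x hx
    by_cases hy : (2 : ℝ) • x - z ∈ tsupport χ
    · have hbx : b x ≤ 0 := by
        have h := hu.inner_gradient_nonneg hΩ hΩc hx (subset_closure (hχΩ hy))
        rw [show (2 : ℝ) • x - z - x = -(z - x) by module, inner_neg_left] at h
        simp only [hb]; linarith
      filter_upwards [hbc.continuousAt.eventually_lt continuousAt_const
        (hbx.trans_lt (epsSeq_pos k))] with y hy _
      rw [cutPos_of_le (epsSeq_pos k) hy.le, zero_mul]
    · have h1 : ∀ᶠ y in 𝓝 ((2 : ℝ) • x - z), χ y = 0 := by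
        filter_upwards [(isClosed_tsupport χ).isOpen_compl.mem_nhds hy] with y hy
        exact image_eq_zero_of_notMem_tsupport hy
      have h2 : ContinuousAt (fun x : Eu n => (2 : ℝ) • x - z) x := by fun_prop
      filter_upwards [h2.eventually h1] with y hy _
      simp [hη, hy]
  have hk : ∀ k, 0 ≤ ∫ x in Ω, (cutPos (epsSeq k) (b x) ^ 2 * ‖gradient η x‖ ^ 2
      + lam * deriv f (u x) * (cutPos (epsSeq k) (b x)
        * (b x * cutStep (epsSeq k) (b x) - cutPos (epsSeq k) (b x))) * η x ^ 2
      - 2 * lam * f (u x) * (cutPos (epsSeq k) (b x) * cutStep (epsSeq k) (b x)) * η x ^ 2) := by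
    intro k
    set ε := epsSeq k
    have hε : 0 < ε := epsSeq_pos k
    have hθ : ContDiff ℝ 1 fun x => cutPos ε (b x) := (contDiff_cutPos ε (k := 1)).comp hb1
    have hψ : ContDiff ℝ 1 fun x => cutStep ε (b x) := (contDiff_cutStep ε (k := 1)).comp hb1
    have hξ : ContDiff ℝ 1 fun x => cutPos ε (b x) * η x := hθ.mul hη1
    have hθc := hθ.continuous
    have hψc := hψ.continuous
    have hstab := hs _ hξ (hvan k)
    have ha : ContDiff ℝ 1 fun x => (cutPos ε (b x) * η x) * (cutStep ε (b x) * η x) :=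
      hξ.mul (hψ.mul hη1)
    have hV : VanishesNearFrontier Ω fun x =>
        ((cutPos ε (b x) * η x) * (cutStep ε (b x) * η x)) • gradient b x :=
      (hvan k).imp fun y _ h => by
        beta_reduce at h ⊢; rw [h, zero_mul, zero_smul]
    have hdiv := integral_divg_eq_zero hΩ hΩb hV (ha.smul hgb).contDiffOn
    have hgθ : ∀ x, gradient (fun x => cutPos ε (b x)) x = cutStep ε (b x) • gradient b x :=
      fun x => by
        rw [gradient_comp (hasDerivAt_cutPos _ _).differentiableAt
          (hb1.differentiable (by norm_num) x), deriv_cutPos]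
    have hgψ : ∀ x, gradient (fun x => cutStep ε (b x)) x
        = deriv (cutStep ε) (b x) • gradient b x := fun x =>
      gradient_comp ((contDiff_cutStep ε (k := 1)).differentiable (by norm_num) _)
          (hb1.differentiable (by norm_num) x)
    have hpt : ∀ x ∈ Ω, ‖gradient (fun x => cutPos ε (b x) * η x) x‖ ^ 2
        ≤ divg (fun x => ((cutPos ε (b x) * η x) * (cutStep ε (b x) * η x)) • gradient b x) x
        + (cutPos ε (b x) ^ 2 * ‖gradient η x‖ ^ 2
          + lam * deriv f (u x) * (cutPos ε (b x) * (b x * cutStep ε (b x))) * η x ^ 2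
          - 2 * lam * f (u x) * (cutPos ε (b x) * cutStep ε (b x)) * η x ^ 2) := by
      intro x hx
      have hθd := hθ.differentiable (by norm_num) x
      have hψd := hψ.differentiable (by norm_num) x
      have hηd := hη1.differentiable (by norm_num) x
      rw [divg_smul (ha.differentiable (by norm_num) x) (hgb.differentiable (by norm_num) x),
        gradient_mul (a := fun x => cutPos ε (b x) * η x) (b := fun x => cutStep ε (b x) * η x)
          (hθd.mul hηd) (hψd.mul hηd), gradient_mul hθd hηd, gradient_mul hψd hηd, hgθ, hgψ,
        show divg (gradient b) x = lap b x from rfl, hu.lap_inner_sub_gradient hΩ hf z hx,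
        show inner ℝ (z - x) (gradient u x) = b x from rfl, ← real_inner_self_eq_norm_sq,
        ← real_inner_self_eq_norm_sq]
      simp only [inner_add_left, inner_add_right, inner_smul_left, inner_smul_right, conj_trivial,
        real_inner_comm (gradient η x) (gradient b x), smul_smul]
      have h1 : 0 ≤ cutPos ε (b x) * deriv (cutStep ε) (b x) * η x ^ 2
          * inner ℝ (gradient b x) (gradient b x) := by
        have := cutPos_nonneg hε (b x)
        have := deriv_cutStep_nonneg hε (b x)
        have := real_inner_self_nonneg (x := gradient b x)
        positivity
      nlinarith [h1]
    have hdc : Continuous fun x =>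
        divg (fun x => ((cutPos ε (b x) * η x) * (cutStep ε (b x) * η x)) • gradient b x) x := by
      have h1 := (ha.smul hgb).continuous_fderiv (by norm_num)
      refine continuous_finsetSum _ fun i _ => ?_
      exact (EuclideanSpace.proj i : Eu n →L[ℝ] ℝ).continuous.comp (h1.clm_apply continuous_const)
    have hgξ := continuous_gradient hξ
    have hi1 : IntegrableOn (fun x => ‖gradient (fun x => cutPos ε (b x) * η x) x‖ ^ 2) Ω :=
      integrableOn_of_continuous hΩb (by fun_prop)
    have hi2 := integrableOn_of_continuous hΩb hdc
    have hi3 : IntegrableOn (fun x => cutPos ε (b x) ^ 2 * ‖gradient η x‖ ^ 2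
          + lam * deriv f (u x) * (cutPos ε (b x) * (b x * cutStep ε (b x))) * η x ^ 2
          - 2 * lam * f (u x) * (cutPos ε (b x) * cutStep ε (b x)) * η x ^ 2) Ω :=
      integrableOn_of_continuous hΩb (by fun_prop)
    have hi4 : IntegrableOn (fun x => lam * (deriv f (u x) * (cutPos ε (b x) * η x) ^ 2)) Ω :=
      integrableOn_of_continuous hΩb (by fun_prop)
    have hmono := setIntegral_mono_on hi1 (hi2.add hi3) hΩ.measurableSet hpt
    have hadd := integral_add hi2 hi3
    simp only [Pi.add_apply] at hmono
    rw [hadd, hdiv, zero_add] at hmono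
    rw [← integral_const_mul] at hstab
    have hsub := integral_sub hi3 hi4
    rw [← sub_nonneg] at hmono hstab
    have : 0 ≤ ∫ x in Ω, (cutPos ε (b x) ^ 2 * ‖gradient η x‖ ^ 2
          + lam * deriv f (u x) * (cutPos ε (b x) * (b x * cutStep ε (b x))) * η x ^ 2
          - 2 * lam * f (u x) * (cutPos ε (b x) * cutStep ε (b x)) * η x ^ 2
          - lam * (deriv f (u x) * (cutPos ε (b x) * η x) ^ 2)) := by
      rw [hsub]; linarith
    refine this.trans_eq (integral_congr_ae (ae_of_all _ fun x => ?_))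
    simp only; ring
  have hlim := tendsto_setIntegral_of_dominated hΩ hΩb
    (g := fun k x => cutPos (epsSeq k) (b x) ^ 2 * ‖gradient η x‖ ^ 2
      + lam * deriv f (u x) * (cutPos (epsSeq k) (b x)
        * (b x * cutStep (epsSeq k) (b x) - cutPos (epsSeq k) (b x))) * η x ^ 2
      - 2 * lam * f (u x) * (cutPos (epsSeq k) (b x) * cutStep (epsSeq k) (b x)) * η x ^ 2)
    (G := fun x => max (b x) 0 ^ 2 * ‖gradient η x‖ ^ 2
      - 2 * lam * (f (u x) * (max (b x) 0 * η x ^ 2)))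
    (fun x => |b x| ^ 2 * ‖gradient η x‖ ^ 2 + |lam * deriv f (u x)| * (|b x| * |b x|) * η x ^ 2
      + |2 * lam * f (u x)| * |b x| * η x ^ 2)
    (fun k => by
      have := continuous_cutPos (epsSeq k)
      have := continuous_cutStep (epsSeq k)
      exact Continuous.continuousOn (by fun_prop))
    (by fun_prop)
    (fun k x _ => by
      have hε := epsSeq_pos k
      have h1 := abs_cutPos_le hε (b x)
      have h2 := cutPos_nonneg hε (b x)
      have h3 := cutStep_nonneg (epsSeq k) (b x)
      have h4 := cutStep_le_one (epsSeq k) (b x)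
      have h5 : |b x * cutStep (epsSeq k) (b x) - cutPos (epsSeq k) (b x)| ≤ |b x| := by
        rw [abs_of_nonneg (cutStep_mul_sub_cutPos_nonneg hε _)]
        nlinarith [le_abs_self (b x), abs_nonneg (b x)]
      have h6 : |cutPos (epsSeq k) (b x) * cutStep (epsSeq k) (b x)| ≤ |b x| := by
        rw [abs_mul, abs_of_nonneg h3]
        exact (mul_le_of_le_one_right (abs_nonneg _) h4).trans h1
      refine (abs_sub _ _).trans (add_le_add ((abs_add_le _ _).trans (add_le_add ?_ ?_)) ?_)
      · rw [abs_mul, abs_pow, abs_of_nonneg (sq_nonneg ‖gradient η x‖)]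
        gcongr
      · rw [abs_mul, abs_mul, abs_mul (cutPos _ _), abs_of_nonneg (sq_nonneg (η x))]
        gcongr
      · rw [abs_mul, abs_mul, abs_of_nonneg (sq_nonneg (η x))]
        gcongr)
    (fun x _ => by
      have h1 := tendsto_cutPos (b x)
      have h2 : Tendsto (fun k => b x * cutStep (epsSeq k) (b x) - cutPos (epsSeq k) (b x)) atTop
          (𝓝 0) := by
        refine tendsto_of_tendsto_of_tendsto_of_le_of_le tendsto_const_nhds
          (h := fun k => 2 * epsSeq k) ?_ (fun k => cutStep_mul_sub_cutPos_nonneg (epsSeq_pos k) _)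
          (fun k => cutStep_mul_sub_cutPos_le (epsSeq_pos k) _)
        simpa using tendsto_epsSeq.const_mul 2
      have h3 : Tendsto (fun k => cutPos (epsSeq k) (b x) * cutStep (epsSeq k) (b x)) atTop
          (𝓝 (max (b x) 0)) := by
        rcases le_or_gt (b x) 0 with h | h
        · rw [max_eq_right h]
          refine tendsto_const_nhds.congr fun k => ?_
          rw [cutPos_of_le (epsSeq_pos k) (h.trans (epsSeq_pos k).le), zero_mul]
        · simpa using h1.mul (tendsto_cutStep_of_pos h)
      have h4 := (((h1.pow 2).mul_const (‖gradient η x‖ ^ 2)).add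
        (((h1.mul h2).const_mul (lam * deriv f (u x))).mul_const (η x ^ 2))).sub
        ((h3.const_mul (2 * lam * f (u x))).mul_const (η x ^ 2))
      convert h4 using 2
      ring)
  have h0 := ge_of_tendsto' hlim hk
  rw [integral_sub (integrableOn_of_continuous hΩb (by fun_prop))
    (integrableOn_of_continuous hΩb (by fun_prop))] at h0
  linarith

end ConvexDomain

section GradientBound

variable {n : ℕ} {Ω : Set (Eu n)}

theorem integrableOn_prod_of_continuous {A B : Set (Eu n)} (hA : IsBounded A) (hB : IsBounded B)
    {g : Eu n → Eu n → ℝ} (hg : Continuous fun p : Eu n × Eu n => g p.1 p.2) :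
    Integrable (Function.uncurry g) ((volume.restrict A).prod (volume.restrict B)) := by
  rw [Measure.prod_restrict]
  have h : IsCompact (closure A ×ˢ closure B) := hA.isCompact_closure.prod hB.isCompact_closure
  exact ((hg.locallyIntegrable (μ := (volume : Measure (Eu n)).prod volume)).integrableOn_isCompact
    h).mono_set (Set.prod_mono subset_closure subset_closure)

theorem integrableOn_integral_of_continuous {A B : Set (Eu n)} (hA : IsBounded A)
    (hB : IsBounded B) {g : Eu n → Eu n → ℝ}
    (hg : Continuous fun p : Eu n × Eu n => g p.1 p.2) :
    IntegrableOn (fun x => ∫ z in B, g x z) A :=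
  (integrableOn_prod_of_continuous hA hB hg).integral_prod_left

theorem integral_le_integral_of_forall_integral_le {A B : Set (Eu n)} (hA : IsBounded A)
    (hB : IsBounded B) {g₁ g₂ : Eu n → Eu n → ℝ}
    (hg₁ : Continuous fun p : Eu n × Eu n => g₁ p.1 p.2)
    (hg₂ : Continuous fun p : Eu n × Eu n => g₂ p.1 p.2)
    (h : ∀ z, ∫ x in A, g₁ x z ≤ ∫ x in A, g₂ x z) :
    ∫ x in A, ∫ z in B, g₁ x z ≤ ∫ x in A, ∫ z in B, g₂ x z := by
  have h1 := integrableOn_prod_of_continuous hA hB hg₁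
  have h2 := integrableOn_prod_of_continuous hA hB hg₂
  rw [integral_integral_swap h1, integral_integral_swap h2]
  exact integral_mono h1.integral_prod_right h2.integral_prod_right h

/-- A weighted mean of `|⟪x - y, g⟫|` controls `‖g‖` when the weight is `1` on a ball. -/
theorem norm_mul_le_integral_mul_abs_inner {w : Eu n → ℝ} (hw : Continuous w)
    (hwc : HasCompactSupport w) (hw0 : ∀ y, 0 ≤ w y) {z : Eu n} {r : ℝ} (hr : 0 < r)
    (hw1 : ∀ y ∈ Metric.closedBall z r, w y = 1) (x g : Eu n) :
    r / 2 * volume.real (Metric.ball z (r / 2)) * ‖g‖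
      ≤ 2 * ∫ y, w y * |inner ℝ (x - y) g| := by
  set e : Eu n := (r / 2 * ‖g‖⁻¹) • g with he
  have hne : ‖e‖ ≤ r / 2 := by
    rw [he, norm_smul, Real.norm_of_nonneg (by positivity), mul_assoc]
    exact mul_le_of_le_one_right (by positivity) (inv_mul_le_one_of_le₀ le_rfl (norm_nonneg _))
  have heg : inner ℝ e g = r / 2 * ‖g‖ := by
    rw [he, inner_smul_left, real_inner_self_eq_norm_sq, conj_trivial]
    rcases eq_or_ne ‖g‖ 0 with h | h
    · simp [h]
    · field_simp
  have hint : Integrable fun y => w y * |inner ℝ (x - y) g| :=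
    Continuous.integrable_of_hasCompactSupport (by fun_prop) hwc.mul_right
  have hint2 := hint.comp_add_right e
  have hnn : ∀ y, 0 ≤ w y * |inner ℝ (x - y) g| := fun y => mul_nonneg (hw0 y) (abs_nonneg _)
  have h1 := integral_add_right_eq_self (μ := volume) (fun y => w y * |inner ℝ (x - y) g|) e
  calc r / 2 * volume.real (Metric.ball z (r / 2)) * ‖g‖
      = ∫ _ in Metric.ball z (r / 2), r / 2 * ‖g‖ := by
        rw [setIntegral_const, smul_eq_mul]; ring
    _ ≤ ∫ y in Metric.ball z (r / 2),
          (w y * |inner ℝ (x - y) g| + w (y + e) * |inner ℝ (x - (y + e)) g|) := by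
        refine setIntegral_mono_on (integrableOn_const measure_ball_lt_top.ne)
          (hint.add hint2).integrableOn measurableSet_ball fun y hy => ?_
        rw [hw1 y (Metric.closedBall_subset_closedBall (by linarith)
          (Metric.ball_subset_closedBall hy)), hw1 (y + e)]
        · have h3 : inner ℝ (x - y) g - inner ℝ (x - (y + e)) g = r / 2 * ‖g‖ := by
            rw [← inner_sub_left, ← heg]; congr 1; abel
          rw [← h3, one_mul, one_mul]
          exact (le_abs_self _).trans (abs_sub _ _)
        · rw [mem_closedBall_iff_norm]
          rw [mem_ball_iff_norm] at hy
          calc ‖y + e - z‖ = ‖(y - z) + e‖ := by congr 1; abel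
            _ ≤ ‖y - z‖ + ‖e‖ := norm_add_le _ _
            _ ≤ r := by linarith
    _ ≤ ∫ y, (w y * |inner ℝ (x - y) g| + w (y + e) * |inner ℝ (x - (y + e)) g|) :=
        setIntegral_le_integral (hint.add hint2) (ae_of_all _ fun y => add_nonneg (hnn y) (hnn _))
    _ = 2 * ∫ y, w y * |inner ℝ (x - y) g| := by
        rw [integral_add hint hint2, h1]; ring

theorem exists_integral_mul_norm_gradient_le (hΩ : IsOpen Ω) (hΩb : IsBounded Ω)
    (hΩc : Convex ℝ Ω) (hne : Ω.Nonempty) :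
    ∃ C, 0 ≤ C ∧ ∀ (f : ℝ → ℝ) (lam : ℝ) (u : Eu n → ℝ), ContDiff ℝ 1 f → (∀ t, 0 ≤ t → 0 < f t) →
      0 < lam → IsPositiveSolution Ω f lam u → IsStable Ω f lam u →
      lam * ∫ x in Ω, f (u x) * ‖gradient u x‖
        ≤ C * ((∫ x in Ω, ‖gradient u x‖ ^ 2) + lam * ∫ x in Ω, prim f (u x)) := by
  obtain ⟨z₀, hz₀⟩ := hne
  obtain ⟨ρ, hρ, hρΩ⟩ := Metric.isOpen_iff.1 hΩ z₀ hz₀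
  let χ : ContDiffBump z₀ := ⟨ρ / 4, ρ / 2, by positivity, by linarith⟩
  have hχ : ContDiff ℝ 1 χ := χ.contDiff
  have hχc : Continuous χ := hχ.continuous
  have hgχ : Continuous (gradient (χ : Eu n → ℝ)) := continuous_gradient hχ
  have hχs : HasCompactSupport (χ : Eu n → ℝ) := χ.hasCompactSupport
  have hχΩ : tsupport χ ⊆ Ω := by
    rw [χ.tsupport_eq]
    exact (Metric.closedBall_subset_ball (by change ρ / 2 < ρ; linarith)).trans hρΩ
  obtain ⟨D, hD0, hD⟩ : ∃ D, 0 ≤ D ∧ ∀ x ∈ Ω, ∀ y ∈ Ω, ‖x - y‖ ≤ D :=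
    ⟨Metric.diam Ω, Metric.diam_nonneg, fun x hx y hy => by
      rw [← dist_eq_norm]; exact Metric.dist_le_diam_of_mem hΩb hx hy⟩
  set A := ∫ y, ‖gradient (χ : Eu n → ℝ) y‖ ^ 2 with hA
  set c := ∫ y, χ y ^ 2 with hc
  set m := ∫ y, χ y ^ 2 • y with hm
  set κ := ρ / 4 / 2 * volume.real (Metric.ball z₀ (ρ / 4 / 2)) / 2 with hκ
  have hA0 : 0 ≤ A := integral_nonneg fun y => sq_nonneg _
  have hc0 : 0 ≤ c := integral_nonneg fun y => sq_nonneg _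
  have hκ0 : 0 < κ := by
    have : 0 < volume.real (Metric.ball z₀ (ρ / 4 / 2)) :=
      ENNReal.toReal_pos (Metric.measure_ball_pos _ _ (by positivity)).ne' measure_ball_lt_top.ne
    positivity
  have hχ2s : HasCompactSupport fun y => χ y ^ 2 :=
    hχs.comp_left (g := fun t : ℝ => t ^ 2) (by simp)
  have hlow : ∀ x g : Eu n, κ * ‖g‖ ≤ ∫ y, χ y ^ 2 * |inner ℝ (x - y) g| := by
    intro x g
    have := norm_mul_le_integral_mul_abs_inner (w := fun y => χ y ^ 2) (by fun_prop) hχ2s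
      (fun y => sq_nonneg _) (z := z₀) (r := ρ / 4) (by positivity)
      (fun y hy => by rw [χ.one_of_mem_closedBall hy, one_pow]) x g
    rw [hκ]; linarith
  have hic : Integrable fun y => χ y ^ 2 :=
    Continuous.integrable_of_hasCompactSupport (by fun_prop) hχ2s
  have him : Integrable fun y => χ y ^ 2 • y :=
    Continuous.integrable_of_hasCompactSupport (by fun_prop) hχ2s.smul_right
  have hlin : ∀ x g : Eu n, ∫ y, χ y ^ 2 * inner ℝ (x - y) g = inner ℝ (c • x - m) g := by
    intro x g
    have h1 : ∀ y, χ y ^ 2 * inner ℝ (x - y) g = inner ℝ g (χ y ^ 2 • x - χ y ^ 2 • y) := by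
      intro y
      rw [← smul_sub, inner_smul_right, real_inner_comm]
    simp only [h1]
    have hi : Integrable fun y => χ y ^ 2 • x - χ y ^ 2 • y := (hic.smul_const x).sub him
    rw [integral_inner hi, integral_sub (hic.smul_const x) him,
      integral_smul_const, real_inner_comm]
  have hcpos : 0 < c := Continuous.integral_pos_of_hasCompactSupport_nonneg_nonzero (x := z₀)
    (by fun_prop) hχ2s (fun y => sq_nonneg _)
    (by simp [χ.one_of_mem_closedBall (Metric.mem_closedBall_self χ.rIn_pos.le)])
  have hplus : ∀ x g : Eu n, κ / 2 * ‖g‖ + inner ℝ (c • x - m) g / 2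
      ≤ ∫ y, max (inner ℝ (x - y) g) 0 * χ y ^ 2 := by
    intro x g
    have h1 : Integrable fun y => χ y ^ 2 * |inner ℝ (x - y) g| :=
      Continuous.integrable_of_hasCompactSupport (by fun_prop) hχ2s.mul_right
    have h2 : Integrable fun y => χ y ^ 2 * inner ℝ (x - y) g :=
      Continuous.integrable_of_hasCompactSupport (by fun_prop) hχ2s.mul_right
    have h3 : ∫ y, max (inner ℝ (x - y) g) 0 * χ y ^ 2
        = ((∫ y, χ y ^ 2 * |inner ℝ (x - y) g|) + ∫ y, χ y ^ 2 * inner ℝ (x - y) g) / 2 := by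
      rw [← integral_add h1 h2, ← integral_div]
      congr 1; ext y
      rcases le_total (inner ℝ (x - y) g) 0 with h | h
      · rw [max_eq_right h, abs_of_nonpos h]; ring
      · rw [max_eq_left h, abs_of_nonneg h]; ring
    rw [h3, hlin]
    linarith [hlow x g]
  refine ⟨(4 * D ^ 2 * A + n * c) / κ, by positivity, fun f lam u hf hfpos hlam hu hs => ?_⟩
  set B : Set (Eu n) := (fun p : Eu n × Eu n => (2 : ℝ) • p.1 - p.2) '' (closure Ω ×ˢ closure Ω)
  have hB : IsBounded B := by
    refine ((hΩb.isCompact_closure.prod hΩb.isCompact_closure).image ?_).isBounded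
    fun_prop
  have hgη : ∀ x z : Eu n, gradient (fun x => χ ((2 : ℝ) • x - z)) x
      = (2 : ℝ) • gradient (χ : Eu n → ℝ) ((2 : ℝ) • x - z) := by
    intro x z
    refine gradient_eq_of_fderiv fun v => ?_
    have h1 : HasFDerivAt (fun x : Eu n => (2 : ℝ) • x - z)
        ((2 : ℝ) • ContinuousLinearMap.id ℝ (Eu n)) x :=
      ((hasFDerivAt_id x).const_smul (2 : ℝ)).sub_const z
    have h2 := ((hχ.differentiable (by norm_num) ((2 : ℝ) • x - z)).hasFDerivAt.comp x h1).fderiv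
    change fderiv ℝ ((χ : Eu n → ℝ) ∘ fun x => (2 : ℝ) • x - z) x v = _
    rw [h2, inner_smul_left, inner_gradient]
    simp
  have hgu := hu.continuous_grad
  have huc := hu.continuous
  have hfc := hf.continuous
  have hmain := integral_le_integral_of_forall_integral_le hΩb hB
    (g₁ := fun x z => 2 * lam * (f (u x) * (max (inner ℝ (z - x) (gradient u x)) 0
        * χ ((2 : ℝ) • x - z) ^ 2)))
    (g₂ := fun x z => max (inner ℝ (z - x) (gradient u x)) 0 ^ 2
        * ‖(2 : ℝ) • gradient (χ : Eu n → ℝ) ((2 : ℝ) • x - z)‖ ^ 2)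
    (by fun_prop) (by fun_prop)
    (fun z => by simpa only [hgη] using hs.integral_dilation_le hu hΩ hΩb hΩc hf hχ hχΩ z)
  have hsub : ∀ x ∈ Ω, ∀ F : Eu n → ℝ, (∀ z, (2 : ℝ) • x - z ∉ tsupport χ → F z = 0) →
      ∫ z in B, F z = ∫ y, F ((2 : ℝ) • x - y) := by
    intro x hx F hF
    rw [integral_sub_left_eq_self F volume ((2 : ℝ) • x)]
    refine setIntegral_eq_integral_of_forall_compl_eq_zero fun z hz => hF z fun hz' => hz ?_
    exact ⟨(x, (2 : ℝ) • x - z), ⟨subset_closure hx, subset_closure (hχΩ hz')⟩, by simp⟩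
  have hL : ∀ x ∈ Ω, lam * (f (u x) * (κ * ‖gradient u x‖))
        + lam * (f (u x) * inner ℝ (gradient u x) (c • x - m))
      ≤ ∫ z in B, 2 * lam * (f (u x) * (max (inner ℝ (z - x) (gradient u x)) 0
        * χ ((2 : ℝ) • x - z) ^ 2)) := by
    intro x hx
    rw [hsub x hx _ fun z hz => by simp [image_eq_zero_of_notMem_tsupport hz]]
    have h1 : ∀ y, (2 : ℝ) • x - y - x = x - y := fun y => by module
    simp only [sub_sub_cancel, h1]
    rw [integral_const_mul, integral_const_mul]
    have := mul_le_mul_of_nonneg_left (hplus x (gradient u x))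
      (mul_nonneg hlam.le (hfpos _ (hu.pos x hx).le).le)
    rw [real_inner_comm (gradient u x)] at this
    linarith
  have hR : ∀ x ∈ Ω, ∫ z in B, max (inner ℝ (z - x) (gradient u x)) 0 ^ 2
        * ‖(2 : ℝ) • gradient (χ : Eu n → ℝ) ((2 : ℝ) • x - z)‖ ^ 2
      ≤ 4 * D ^ 2 * A * ‖gradient u x‖ ^ 2 := by
    intro x hx
    have hgsupp : ∀ y, y ∉ tsupport χ → gradient (χ : Eu n → ℝ) y = 0 := fun y hy => by
      rw [← norm_eq_zero, norm_gradient, norm_eq_zero]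
      exact image_eq_zero_of_notMem_tsupport fun h => hy (tsupport_fderiv_subset ℝ h)
    rw [hsub x hx _ fun z hz => by simp [hgsupp _ hz]]
    have h1 : ∀ y, (2 : ℝ) • x - y - x = x - y := fun y => by module
    simp only [sub_sub_cancel, h1]
    have hgs : HasCompactSupport fun y => ‖gradient (χ : Eu n → ℝ) y‖ ^ 2 :=
      HasCompactSupport.intro hχs fun y hy => by simp [hgsupp y hy]
    have hgs2 : HasCompactSupport fun y => ‖(2 : ℝ) • gradient (χ : Eu n → ℝ) y‖ ^ 2 :=
      HasCompactSupport.intro hχs fun y hy => by simp [hgsupp y hy]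
    calc ∫ y, max (inner ℝ (x - y) (gradient u x)) 0 ^ 2
          * ‖(2 : ℝ) • gradient (χ : Eu n → ℝ) y‖ ^ 2
        ≤ ∫ y, 4 * D ^ 2 * ‖gradient u x‖ ^ 2 * ‖gradient (χ : Eu n → ℝ) y‖ ^ 2 := by
          refine integral_mono
            (Continuous.integrable_of_hasCompactSupport (by fun_prop) hgs2.mul_left)
            (Continuous.integrable_of_hasCompactSupport (by fun_prop) hgs.mul_left) fun y => ?_
          by_cases hy : y ∈ tsupport χ
          · have h2 : max (inner ℝ (x - y) (gradient u x)) 0 ≤ D * ‖gradient u x‖ :=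
              max_le ((real_inner_le_norm _ _).trans
                (mul_le_mul_of_nonneg_right (hD x hx y (hχΩ hy)) (norm_nonneg _)))
                (by positivity)
            have h3 : max (inner ℝ (x - y) (gradient u x)) 0 ^ 2 ≤ (D * ‖gradient u x‖) ^ 2 :=
              pow_le_pow_left₀ (le_max_right _ _) h2 2
            rw [norm_smul, Real.norm_two]
            nlinarith [mul_le_mul_of_nonneg_right h3 (sq_nonneg ‖gradient (χ : Eu n → ℝ) y‖)]
          · simp [hgsupp y hy]
      _ = 4 * D ^ 2 * A * ‖gradient u x‖ ^ 2 := by rw [integral_const_mul, hA]; ring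
  have hi1 : IntegrableOn (fun x => lam * (f (u x) * (κ * ‖gradient u x‖))) Ω :=
    integrableOn_of_continuous hΩb (by fun_prop)
  have hi2 : IntegrableOn (fun x => lam * (f (u x) * inner ℝ (gradient u x) (c • x - m))) Ω :=
    integrableOn_of_continuous hΩb (by fun_prop)
  have hi3 : IntegrableOn (fun x => 4 * D ^ 2 * A * ‖gradient u x‖ ^ 2) Ω :=
    integrableOn_of_continuous hΩb (by fun_prop)
  have hi4 : IntegrableOn (fun x => ∫ z in B, 2 * lam * (f (u x)
      * (max (inner ℝ (z - x) (gradient u x)) 0 * χ ((2 : ℝ) • x - z) ^ 2))) Ω :=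
    integrableOn_integral_of_continuous hΩb hB (by fun_prop)
  have hi5 : IntegrableOn (fun x => ∫ z in B, max (inner ℝ (z - x) (gradient u x)) 0 ^ 2
      * ‖(2 : ℝ) • gradient (χ : Eu n → ℝ) ((2 : ℝ) • x - z)‖ ^ 2) Ω :=
    integrableOn_integral_of_continuous hΩb hB (by fun_prop)
  have h4 := (setIntegral_mono_on (hi1.add hi2) hi4 hΩ.measurableSet hL).trans
    (hmain.trans (setIntegral_mono_on hi5 hi3 hΩ.measurableSet hR))
  have h5 : ∀ x, lam * (f (u x) * inner ℝ (gradient u x) (c • x - m))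
      = lam * c * (f (u x) * inner ℝ (gradient u x) (x - c⁻¹ • m)) := by
    intro x
    have : c • x - m = c • (x - c⁻¹ • m) := by
      rw [smul_sub, smul_smul, mul_inv_cancel₀ hcpos.ne', one_smul]
    rw [this, inner_smul_right]; ring
  have h6 := integral_add hi1 hi2
  simp only [Pi.add_apply] at h4
  rw [h6] at h4
  simp only [h5] at h4
  rw [integral_const_mul (lam * c), hu.integral_mul_inner_sub hΩ hΩb hfc
    (fun t ht => (hfpos t ht).le), integral_const_mul (4 * D ^ 2 * A), integral_const_mul lam] at h4
  have h7 : ∫ x in Ω, f (u x) * (κ * ‖gradient u x‖) = κ * ∫ x in Ω, f (u x) * ‖gradient u x‖ := by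
    rw [← integral_const_mul]; congr 1; ext x; ring
  rw [h7] at h4
  have hE : 0 ≤ ∫ x in Ω, ‖gradient u x‖ ^ 2 := integral_nonneg fun x => sq_nonneg _
  have hF : 0 ≤ lam * ∫ x in Ω, prim f (u x) :=
    mul_nonneg hlam.le (setIntegral_nonneg hΩ.measurableSet fun x hx =>
      prim_nonneg (fun t ht => (hfpos t ht).le) (hu.pos x hx).le)
  rw [div_mul_eq_mul_div, le_div_iff₀ hκ0]
  have h8 : 0 ≤ 4 * D ^ 2 * A * (lam * ∫ x in Ω, prim f (u x)) := by positivity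
  have h9 : 0 ≤ n * c * ∫ x in Ω, ‖gradient u x‖ ^ 2 := by positivity
  linarith

end GradientBound

section SmallSupport

variable {n : ℕ} {Ω : Set (Eu n)}

/-- The `W^{1,1}` Poincaré inequality for functions living on a set of small measure. -/
theorem exists_integral_abs_le_measure_rpow_mul (hn : 2 ≤ n) :
    ∃ K : ℝ, 0 ≤ K ∧ ∀ (w : Eu n → ℝ) (S : Set (Eu n)), ContDiff ℝ 1 w → HasCompactSupport w →
      MeasurableSet S → volume S ≠ ∞ → (∀ x ∉ S, w x = 0) →
      ∫ x, |w x| ≤ K * volume.real S ^ (1 / (n : ℝ)) * ∫ x, ‖gradient w x‖ := by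
  have hn1 : (1 : ℝ) < n := by exact_mod_cast hn
  set p : ℝ := Real.conjExponent n with hp
  have hnp : Real.HolderConjugate n p := Real.HolderConjugate.conjExponent hn1
  have hnp' : Real.HolderConjugate (Module.finrank ℝ (Eu n)) p := by
    rwa [finrank_euclideanSpace_fin]
  set c := lintegralPowLePowLIntegralFDerivConst (volume : Measure (Eu n)) p
  refine ⟨(c : ℝ) ^ (1 / p), by positivity, fun w S hw hwc hS hSf h0 => ?_⟩
  have hp0 : 0 < p := hnp.symm.pos
  have h1 := lintegral_pow_le_pow_lintegral_fderiv (volume : Measure (Eu n)) hw hwc hnp'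
  have h2 := ENNReal.lintegral_mul_le_Lp_mul_Lq volume hnp.symm (f := fun x => ‖w x‖ₑ)
    (g := S.indicator 1) hw.continuous.enorm.aemeasurable
    (measurable_one.indicator hS).aemeasurable
  have h3 : ∀ x, ((fun x => ‖w x‖ₑ) * S.indicator (1 : Eu n → ℝ≥0∞)) x = ‖w x‖ₑ := by
    intro x
    by_cases hx : x ∈ S
    · simp [hx]
    · simp [hx, h0 x hx]
  have h4 : ∀ x, (S.indicator (1 : Eu n → ℝ≥0∞) x) ^ (n : ℝ) = S.indicator 1 x := by
    intro x
    by_cases hx : x ∈ S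
    · simp [hx]
    · simp only [hx, not_false_eq_true, Set.indicator_of_notMem]
      exact ENNReal.zero_rpow_of_pos (by positivity)
  simp only [h3, h4] at h2
  rw [lintegral_indicator_one hS] at h2
  have h5 : (∫⁻ x, ‖w x‖ₑ ^ p) ^ (1 / p) ≤ (c : ℝ≥0∞) ^ (1 / p) * ∫⁻ x, ‖fderiv ℝ w x‖ₑ := by
    refine (ENNReal.rpow_le_rpow h1 (by positivity)).trans_eq ?_
    rw [ENNReal.mul_rpow_of_nonneg _ _ (by positivity), ← ENNReal.rpow_mul,
      mul_one_div_cancel hp0.ne', ENNReal.rpow_one]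
  have hwi : Integrable w := hw.continuous.integrable_of_hasCompactSupport hwc
  have hdi : Integrable (fderiv ℝ w) :=
    (hw.continuous_fderiv (by norm_num)).integrable_of_hasCompactSupport (hwc.fderiv (𝕜 := ℝ))
  have h6 := h2.trans (mul_le_mul_left h5 _)
  simp only [norm_gradient, ← Real.norm_eq_abs]
  rw [integral_norm_eq_lintegral_enorm hwi.1, integral_norm_eq_lintegral_enorm hdi.1]
  have h7 : (c : ℝ≥0∞) ^ (1 / p) * (∫⁻ x, ‖fderiv ℝ w x‖ₑ) * volume S ^ (1 / (n : ℝ)) ≠ ∞ := by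
    refine ENNReal.mul_ne_top (ENNReal.mul_ne_top ?_ hdi.2.ne) ?_
    · exact ENNReal.rpow_ne_top_of_nonneg (by positivity) ENNReal.coe_ne_top
    · exact ENNReal.rpow_ne_top_of_nonneg (by positivity) hSf
  refine (ENNReal.toReal_mono h7 h6).trans_eq ?_
  rw [ENNReal.toReal_mul, ENNReal.toReal_mul, ← ENNReal.toReal_rpow, ← ENNReal.toReal_rpow,
    ENNReal.coe_toReal, measureReal_def]
  ring

/-- The part of the primitive of `f` produced beyond the level `T`. -/
noncomputable def primAbove (f : ℝ → ℝ) (T : ℝ) : ℝ → ℝ := prim fun s => f s * cutStep T s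

theorem primAbove_of_le {f : ℝ → ℝ} {T t : ℝ} (hT : 0 < T) (ht : t ≤ T) : primAbove f T t = 0 := by
  refine (intervalIntegral.integral_congr (g := fun _ => (0 : ℝ)) fun s hs => ?_).trans
    intervalIntegral.integral_zero
  beta_reduce
  rw [cutStep_of_le hT, mul_zero]
  rcases Set.mem_uIcc.1 hs with h | h
  · exact h.2.trans ht
  · exact h.2.trans hT.le

theorem prim_le_add_primAbove {f : ℝ → ℝ} (hf : Continuous f) (hpos : ∀ t, 0 ≤ t → 0 ≤ f t)
    {T t : ℝ} (hT : 0 < T) (ht : 0 ≤ t) : prim f t ≤ prim f (2 * T) + primAbove f T t := by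
  have hc : Continuous fun s => f s * cutStep T s := hf.mul (continuous_cutStep T)
  have hi : ∀ a b, IntervalIntegrable f volume a b := fun a b => hf.intervalIntegrable _ _
  have hic : ∀ a b, IntervalIntegrable (fun s => f s * cutStep T s) volume a b :=
    fun a b => hc.intervalIntegrable _ _
  have hcpos : ∀ t, 0 ≤ t → 0 ≤ f t * cutStep T t := fun t ht =>
    mul_nonneg (hpos t ht) (cutStep_nonneg _ _)
  rcases le_total t (2 * T) with h | h
  · have h1 : prim f t ≤ prim f (2 * T) := by
      have := intervalIntegral.integral_add_adjacent_intervals (hi 0 t) (hi t (2 * T))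
      have h2 : 0 ≤ ∫ s in t..(2 * T), f s :=
        intervalIntegral.integral_nonneg h fun s hs => hpos s (ht.trans hs.1)
      simp only [prim]; linarith
    have : 0 ≤ primAbove f T t := prim_nonneg hcpos ht
    linarith
  · have h1 := intervalIntegral.integral_add_adjacent_intervals (hi 0 (2 * T)) (hi (2 * T) t)
    have h2 := intervalIntegral.integral_add_adjacent_intervals (hic 0 (2 * T)) (hic (2 * T) t)
    have h3 : ∫ s in (2 * T)..t, f s * cutStep T s = ∫ s in (2 * T)..t, f s := by
      refine intervalIntegral.integral_congr fun s hs => ?_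
      rw [Set.uIcc_of_le h] at hs
      rw [cutStep_of_ge hT hs.1, mul_one]
    have h4 : 0 ≤ ∫ s in (0 : ℝ)..(2 * T), f s * cutStep T s :=
      prim_nonneg hcpos (by positivity)
    simp only [primAbove, prim]
    linarith

theorem measureReal_superlevel_le (hΩ : IsOpen Ω) {u : Eu n → ℝ} (hu : ∀ x ∈ Ω, 0 < u x)
    (hi : IntegrableOn u Ω) {M T : ℝ} (hT : 0 < T) (hM : ∫ x in Ω, u x ≤ M) :
    volume.real {x ∈ Ω | T < u x} ≤ M / T := by
  rw [le_div_iff₀ hT, mul_comm]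
  have h0 : 0 ≤ᵐ[volume.restrict Ω] u :=
    (ae_restrict_iff' hΩ.measurableSet).2 (ae_of_all _ fun x hx => (hu x hx).le)
  have h1 := mul_meas_ge_le_integral_of_nonneg h0 hi T
  refine (mul_le_mul_of_nonneg_left ?_ hT.le).trans (h1.trans hM)
  refine ENNReal.toReal_mono (hi.measure_ge_lt_top hT).ne ?_
  rw [Measure.restrict_apply' hΩ.measurableSet]
  exact measure_mono fun x hx => ⟨hx.2.le, hx.1⟩

theorem exists_integral_prim_le (hn : 2 ≤ n) (hΩ : IsOpen Ω) (hΩb : IsBounded Ω)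
    (hΩc : Convex ℝ Ω) (hne : Ω.Nonempty) {f : ℝ → ℝ} (hf : ContDiff ℝ 1 f)
    (hfpos : ∀ t, 0 ≤ t → 0 < f t) (Λ M : ℝ) {σ : ℝ} (hσ : 0 < σ) :
    ∃ C, ∀ (lam : ℝ) (u : Eu n → ℝ), 0 < lam → lam ≤ Λ → IsPositiveSolution Ω f lam u →
      IsStable Ω f lam u → ∫ x in Ω, u x ≤ M →
      lam * ∫ x in Ω, prim f (u x) ≤ C + σ * ∫ x in Ω, ‖gradient u x‖ ^ 2 := by
  obtain ⟨K, hK, hKw⟩ := exists_integral_abs_le_measure_rpow_mul hn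
  obtain ⟨C₀, hC₀, hC₀u⟩ := exists_integral_mul_norm_gradient_le hΩ hΩb hΩc hne
  have hn0 : (0 : ℝ) < 1 / n := by positivity
  have hlim : Tendsto (fun T : ℝ => K * (M / T) ^ (1 / (n : ℝ)) * C₀) atTop (𝓝 0) := by
    have h1 : Tendsto (fun T : ℝ => M / T) atTop (𝓝 0) := tendsto_const_nhds.div_atTop tendsto_id
    have h2 := ((h1.rpow_const (Or.inr hn0.le)).const_mul K).mul_const C₀
    rwa [Real.zero_rpow hn0.ne', mul_zero, zero_mul] at h2
  obtain ⟨T, hT, hTlt⟩ : ∃ T : ℝ, 0 < T ∧ K * (M / T) ^ (1 / (n : ℝ)) * C₀ < min (1 / 2) (σ / 2) :=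
    ((eventually_gt_atTop 0).and
      (hlim.eventually_lt_const (u := min (1 / 2) (σ / 2)) (by positivity))).exists
  set δ := K * (M / T) ^ (1 / (n : ℝ)) * C₀ with hδ
  have hfpos' : ∀ t, 0 ≤ t → 0 ≤ f t := fun t ht => (hfpos t ht).le
  have hF0 : 0 ≤ prim f (2 * T) := prim_nonneg hfpos' (by positivity)
  refine ⟨2 * (Λ * (volume.real Ω * prim f (2 * T))), fun lam u hlam hlamΛ hu hs hM => ?_⟩
  have hfc := hf.continuous
  have hgc : Continuous fun s => f s * cutStep T s := hfc.mul (continuous_cutStep T)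
  have hgu := hu.continuous_grad
  have huc := hu.continuous
  have hP : ContDiff ℝ 1 fun x => primAbove f T (u x) :=
    (contDiff_prim hgc).comp (hu.contDiff (k := 1))
  have hPF : Continuous fun x => prim f (u x) := (contDiff_prim hfc).continuous.comp huc
  have hvan : VanishesNearFrontier Ω fun x => primAbove f T (u x) :=
    vanishesNearFrontier_of_eq_zero_of_le huc (fun x hx => by rwa [hu.bc x hx])
      fun x _ h => primAbove_of_le hT h
  set S := {x ∈ Ω | T < u x} with hS
  have hSm : MeasurableSet S := hΩ.measurableSet.inter (measurableSet_lt measurable_const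
    huc.measurable)
  have hSf : volume S ≠ ∞ := ((measure_mono fun x hx => hx.1).trans_lt hΩb.measure_lt_top).ne
  have hSM : volume.real S ≤ M / T :=
    measureReal_superlevel_le hΩ hu.pos (integrableOn_of_continuous hΩb huc) hT hM
  have h1 := hKw (Ω.indicator fun x => primAbove f T (u x)) S
    (contDiff_indicator hΩ hvan hP.contDiffOn) (hasCompactSupport_indicator hΩb _) hSm hSf
    (fun x hx => by
      by_cases hxΩ : x ∈ Ω
      · rw [Set.indicator_of_mem hxΩ, primAbove_of_le hT (not_lt.1 fun h => hx ⟨hxΩ, h⟩)]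
      · rw [Set.indicator_of_notMem hxΩ])
  have hPnn : ∀ x ∈ Ω, 0 ≤ primAbove f T (u x) := fun x hx =>
    prim_nonneg (fun t ht => mul_nonneg (hfpos' t ht) (cutStep_nonneg _ _)) (hu.pos x hx).le
  have h2 : ∫ x, |Ω.indicator (fun x => primAbove f T (u x)) x|
      = ∫ x in Ω, primAbove f T (u x) := by
    rw [← integral_indicator hΩ.measurableSet]
    congr 1; ext x
    by_cases hx : x ∈ Ω
    · simp [hx, abs_of_nonneg (hPnn x hx)]
    · simp [hx]
  have h3 : ∫ x, ‖gradient (Ω.indicator fun x => primAbove f T (u x)) x‖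
      = ∫ x in Ω, f (u x) * cutStep T (u x) * ‖gradient u x‖ := by
    rw [← integral_indicator hΩ.measurableSet]
    congr 1; ext x
    rw [norm_gradient]
    by_cases hx : x ∈ Ω
    · rw [(indicator_eventuallyEq_self hΩ _ hx).fderiv_eq, ← norm_gradient, primAbove,
        gradient_comp (hasDerivAt_prim hgc _).differentiableAt (hu.differentiable x),
        deriv_prim hgc, norm_smul, Set.indicator_of_mem hx, Real.norm_of_nonneg
        (mul_nonneg (hfpos' _ (hu.pos x hx).le) (cutStep_nonneg _ _))]
    · rw [(hvan.eventually_indicator hΩ hx).fderiv_eq, Set.indicator_of_notMem hx]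
      simp
  rw [h2, h3] at h1
  have hiE : IntegrableOn (fun x => f (u x) * ‖gradient u x‖) Ω :=
    integrableOn_of_continuous hΩb (by fun_prop)
  have hct := continuous_cutStep T
  have h4 : ∫ x in Ω, f (u x) * cutStep T (u x) * ‖gradient u x‖
      ≤ ∫ x in Ω, f (u x) * ‖gradient u x‖ :=
    setIntegral_mono_on (integrableOn_of_continuous hΩb (by fun_prop)) hiE hΩ.measurableSet
      fun x hx => mul_le_mul_of_nonneg_right (mul_le_of_le_one_right
        (hfpos' _ (hu.pos x hx).le) (cutStep_le_one _ _)) (norm_nonneg _)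
  have h5 := hC₀u f lam u hf hfpos hlam hu hs
  set E := ∫ x in Ω, ‖gradient u x‖ ^ 2 with hE
  set I := ∫ x in Ω, prim f (u x) with hI
  have hE0 : 0 ≤ E := integral_nonneg fun x => sq_nonneg _
  have hI0 : 0 ≤ I := setIntegral_nonneg hΩ.measurableSet fun x hx =>
    prim_nonneg hfpos' (hu.pos x hx).le
  have hSn : K * volume.real S ^ (1 / (n : ℝ)) ≤ K * (M / T) ^ (1 / (n : ℝ)) :=
    mul_le_mul_of_nonneg_left (Real.rpow_le_rpow measureReal_nonneg hSM hn0.le) hK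
  have h40 : 0 ≤ ∫ x in Ω, f (u x) * ‖gradient u x‖ := setIntegral_nonneg hΩ.measurableSet
    fun x hx => mul_nonneg (hfpos' _ (hu.pos x hx).le) (norm_nonneg _)
  have hKS0 : 0 ≤ K * volume.real S ^ (1 / (n : ℝ)) :=
    mul_nonneg hK (Real.rpow_nonneg measureReal_nonneg _)
  have h6 : lam * ∫ x in Ω, primAbove f T (u x) ≤ δ * (E + lam * I) := by
    have h7 : lam * ∫ x in Ω, primAbove f T (u x)
        ≤ K * (M / T) ^ (1 / (n : ℝ)) * (lam * ∫ x in Ω, f (u x) * ‖gradient u x‖) := by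
      calc lam * ∫ x in Ω, primAbove f T (u x)
          ≤ lam * (K * volume.real S ^ (1 / (n : ℝ)) * ∫ x in Ω, f (u x) * ‖gradient u x‖) :=
            mul_le_mul_of_nonneg_left (h1.trans (mul_le_mul_of_nonneg_left h4 hKS0)) hlam.le
        _ ≤ lam * (K * (M / T) ^ (1 / (n : ℝ)) * ∫ x in Ω, f (u x) * ‖gradient u x‖) := by
            gcongr
        _ = _ := by ring
    refine h7.trans ((mul_le_mul_of_nonneg_left h5 (hKS0.trans hSn)).trans_eq ?_)
    rw [hδ]; ring
  have h8 : I ≤ volume.real Ω * prim f (2 * T) + ∫ x in Ω, primAbove f T (u x) := by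
    have hiP := integrableOn_of_continuous hΩb hP.continuous
    have hic : IntegrableOn (fun _ : Eu n => prim f (2 * T)) Ω :=
      integrableOn_const hΩb.measure_lt_top.ne
    have h9 := setIntegral_mono_on (integrableOn_of_continuous hΩb hPF) (hic.add hiP)
      hΩ.measurableSet fun x hx => prim_le_add_primAbove hfc hfpos' hT (hu.pos x hx).le
    have h10 := integral_add hic hiP
    simp only [Pi.add_apply] at h9
    rwa [h10, setIntegral_const, smul_eq_mul] at h9
  have h11 : lam * (volume.real Ω * prim f (2 * T)) ≤ Λ * (volume.real Ω * prim f (2 * T)) :=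
    mul_le_mul_of_nonneg_right hlamΛ (by positivity)
  have h12 : lam * I ≤ lam * (volume.real Ω * prim f (2 * T))
      + lam * ∫ x in Ω, primAbove f T (u x) := by
    rw [← mul_add]; exact mul_le_mul_of_nonneg_left h8 hlam.le
  have hlI : 0 ≤ lam * I := by positivity
  have h13 : δ * (lam * I) ≤ 1 / 2 * (lam * I) :=
    mul_le_mul_of_nonneg_right (hTlt.le.trans (min_le_left _ _)) hlI
  have h14 : δ * E ≤ σ / 2 * E :=
    mul_le_mul_of_nonneg_right (hTlt.le.trans (min_le_right _ _)) hE0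
  linarith

end SmallSupport

section Pohozaev

variable {n : ℕ} {Ω : Set (Eu n)} {f : ℝ → ℝ} {lam : ℝ} {u : Eu n → ℝ}

theorem continuous_divg {V : Eu n → Eu n} (hV : ContDiff ℝ 1 V) : Continuous (divg V) := by
  refine continuous_finsetSum _ fun i _ => ?_
  exact (EuclideanSpace.proj i : Eu n →L[ℝ] ℝ).continuous.comp
    ((hV.continuous_fderiv (by norm_num)).clm_apply continuous_const)

/-- The Pohozaev identity for a general multiplier `⟪X, ∇u⟫`, with a cutoff near `∂Ω`. -/
theorem IsPositiveSolution.pohozaev (hu : IsPositiveSolution Ω f lam u) (hΩ : IsOpen Ω)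
    (hΩb : IsBounded Ω) {X : Eu n → Eu n} (hX : ContDiff ℝ 1 X) {ε : ℝ} (hε : 0 < ε) :
    ∫ x in Ω, (1 / 2 * deriv (cutStep ε) (u x) * ‖gradient u x‖ ^ 2 * inner ℝ (X x) (gradient u x)
      + cutStep ε (u x) * (inner ℝ (fderiv ℝ X x (gradient u x)) (gradient u x)
        - 1 / 2 * ‖gradient u x‖ ^ 2 * divg X x
        - lam * f (u x) * inner ℝ (X x) (gradient u x))) = 0 := by
  have hu2 : ContDiff ℝ 2 u := hu.contDiff
  have hg : ContDiff ℝ 1 (gradient u) := contDiff_gradient hu2 (by norm_num)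
  have hψ : ContDiff ℝ 1 fun x => cutStep ε (u x) :=
    (contDiff_cutStep ε (k := 1)).comp (hu.contDiff (k := 1))
  have ha : ContDiff ℝ 1 fun x => inner ℝ (X x) (gradient u x) := hX.inner ℝ hg
  have hb : ContDiff ℝ 1 fun x => (1 / 2) * ‖gradient u x‖ ^ 2 :=
    contDiff_const.mul (hg.norm_sq ℝ)
  have hW : ContDiff ℝ 1 fun x => inner ℝ (X x) (gradient u x) • gradient u x
      - ((1 / 2) * ‖gradient u x‖ ^ 2) • X x := (ha.smul hg).sub (hb.smul hX)
  have hvan : VanishesNearFrontier Ω fun x => cutStep ε (u x) •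
      (inner ℝ (X x) (gradient u x) • gradient u x - ((1 / 2) * ‖gradient u x‖ ^ 2) • X x) :=
    vanishesNearFrontier_of_eq_zero_of_le hu.continuous (fun x hx => by rwa [hu.bc x hx])
      fun x _ h => by rw [cutStep_of_le hε h, zero_smul]
  rw [← integral_divg_eq_zero hΩ hΩb hvan (hψ.smul hW).contDiffOn]
  refine setIntegral_congr_fun hΩ.measurableSet fun x hx => ?_
  have hψd := hψ.differentiable (by norm_num) x
  have had := ha.differentiable (by norm_num) x
  have hbd := hb.differentiable (by norm_num) x
  have hgd := hg.differentiable (by norm_num) x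
  have hXd := hX.differentiable (by norm_num) x
  have hd1 : DifferentiableAt ℝ (fun y => inner ℝ (X y) (gradient u y) • gradient u y) x :=
    had.smul hgd
  have hd2 : DifferentiableAt ℝ (fun y => (1 / 2 * ‖gradient u y‖ ^ 2) • X y) x := hbd.smul hXd
  beta_reduce
  rw [divg_smul hψd (hW.differentiable (by norm_num) x), divg_sub hd1 hd2,
    divg_smul had hgd, divg_smul hbd hXd, show divg (gradient u) x = lap u x from rfl, hu.eq x hx,
    gradient_comp ((contDiff_cutStep ε (k := 1)).differentiable (by norm_num) _)
      (hu.differentiable x), inner_gradient (fun y => inner ℝ (X y) (gradient u y)),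
    fderiv_inner_gradient hu2 hXd, gradient_half_sq_gradient hu2, inner_hess_comm hu2 x (X x)]
  simp only [inner_sub_right, inner_smul_left, inner_smul_right, real_inner_self_eq_norm_sq,
    conj_trivial, real_inner_comm (X x) (gradient u x)]
  ring

theorem IsPositiveSolution.inner_gradient_add_norm_le (hu : IsPositiveSolution Ω f lam u)
    (hΩ : IsOpen Ω) (hΩc : Convex ℝ Ω) {z : Eu n} {ρ : ℝ} (hρ : 0 ≤ ρ)
    (hball : Metric.closedBall z ρ ⊆ Ω) {x : Eu n} (hx : x ∈ frontier Ω) :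
    inner ℝ (x - z) (gradient u x) + ρ * ‖gradient u x‖ ≤ 0 := by
  set g := gradient u x with hg
  have hy : z - (ρ * ‖g‖⁻¹) • g ∈ closure Ω := by
    refine subset_closure (hball ?_)
    rw [mem_closedBall_iff_norm, sub_sub_cancel_left, norm_neg, norm_smul,
      Real.norm_of_nonneg (by positivity), mul_assoc]
    exact mul_le_of_le_one_right hρ (inv_mul_le_one_of_le₀ le_rfl (norm_nonneg _))
  have h := hu.inner_gradient_nonneg hΩ hΩc hx hy
  have h1 : z - (ρ * ‖g‖⁻¹) • g - x = -(x - z) - (ρ * ‖g‖⁻¹) • g := by module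
  rw [← hg, h1, inner_sub_left, inner_neg_left, inner_smul_left, real_inner_self_eq_norm_sq,
    conj_trivial] at h
  have h2 : ρ * ‖g‖⁻¹ * ‖g‖ ^ 2 = ρ * ‖g‖ := by
    rcases eq_or_ne ‖g‖ 0 with h | h
    · simp [h]
    · field_simp
  linarith

theorem IsPositiveSolution.exists_inner_gradient_add_norm_le (hu : IsPositiveSolution Ω f lam u)
    (hΩ : IsOpen Ω) (hΩb : IsBounded Ω) (hΩc : Convex ℝ Ω) {z : Eu n} {ρ : ℝ} (hρ : 0 ≤ ρ)
    (hball : Metric.closedBall z ρ ⊆ Ω) {τ : ℝ} (hτ : 0 < τ) :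
    ∃ ε₀, 0 < ε₀ ∧ ∀ x ∈ Ω, u x ≤ ε₀ →
      inner ℝ (x - z) (gradient u x) + ρ * ‖gradient u x‖ ≤ τ := by
  have hgu := hu.continuous_grad
  set K := closure Ω ∩ {x | τ ≤ inner ℝ (x - z) (gradient u x) + ρ * ‖gradient u x‖} with hK
  have hKc : IsCompact K :=
    hΩb.isCompact_closure.inter_right (isClosed_le continuous_const (by fun_prop))
  have hpos : ∀ x ∈ K, 0 < u x := by
    intro x hx
    by_cases hxΩ : x ∈ Ω
    · exact hu.pos x hxΩ
    · have hxf : x ∈ frontier Ω := by rw [hΩ.frontier_eq]; exact ⟨hx.1, hxΩ⟩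
      have := hu.inner_gradient_add_norm_le hΩ hΩc hρ hball hxf
      have := hx.2
      simp only [Set.mem_ofPred_eq] at this
      linarith
  rcases K.eq_empty_or_nonempty with h | h
  · refine ⟨1, one_pos, fun x hx _ => le_of_not_gt fun h' => ?_⟩
    have : x ∈ K := ⟨subset_closure hx, h'.le⟩
    rw [h] at this
    exact this
  · obtain ⟨x₀, hx₀, hmin⟩ := hKc.exists_isMinOn h hu.continuous.continuousOn
    refine ⟨u x₀ / 2, half_pos (hpos x₀ hx₀), fun x hx hux => le_of_not_gt fun h' => ?_⟩
    have h1 : u x₀ ≤ u x := hmin (show x ∈ K from ⟨subset_closure hx, h'.le⟩)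
    linarith [hpos x₀ hx₀]

theorem deriv_cutStep_of_gt {ε t : ℝ} (hε : 0 < ε) (h : 2 * ε < t) : deriv (cutStep ε) t = 0 := by
  have : cutStep ε =ᶠ[𝓝 t] fun _ => 1 := by
    filter_upwards [lt_mem_nhds h] with s hs using cutStep_of_ge hε hs.le
  rw [this.deriv_eq, deriv_const]

theorem IsPositiveSolution.integral_deriv_cutStep_mul_sq_le (hu : IsPositiveSolution Ω f lam u)
    (hΩ : IsOpen Ω) (hΩb : IsBounded Ω) (hf : Continuous f) (hfpos : ∀ t, 0 ≤ t → 0 ≤ f t)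
    (hlam : 0 ≤ lam) {ε : ℝ} (hε : 0 < ε) :
    ∫ x in Ω, deriv (cutStep ε) (u x) * ‖gradient u x‖ ^ 2 ≤ lam * ∫ x in Ω, f (u x) := by
  rw [hu.integral_deriv_mul_sq hΩ hΩb (contDiff_cutStep ε (k := 1)) (cutStep_of_le hε hε.le)
    fun t _ => cutStep_nonneg _ _]
  have huc := hu.continuous
  have hψ := continuous_cutStep ε
  exact mul_le_mul_of_nonneg_left (setIntegral_mono_on
    (integrableOn_of_continuous hΩb (by fun_prop)) (integrableOn_of_continuous hΩb (by fun_prop))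
    hΩ.measurableSet fun x hx => mul_le_of_le_one_right (hfpos _ (hu.pos x hx).le)
      (cutStep_le_one _ _)) hlam

/-- Pohozaev's identity with `X = x - z`, near the boundary of a domain containing
`closedBall z ρ`. -/
theorem IsPositiveSolution.pohozaev_radial_le (hu : IsPositiveSolution Ω f lam u)
    (hΩ : IsOpen Ω) (hΩb : IsBounded Ω) (hΩc : Convex ℝ Ω) (hf : Continuous f)
    (hfpos : ∀ t, 0 ≤ t → 0 ≤ f t) (hlam : 0 ≤ lam) {z : Eu n} {ρ : ℝ} (hρ : 0 ≤ ρ)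
    (hball : Metric.closedBall z ρ ⊆ Ω) {τ : ℝ} (hτ : 0 < τ) :
    ∃ ε₀, 0 < ε₀ ∧ ∀ ε, 0 < ε → ε ≤ ε₀ →
      ((n : ℝ) / 2 - 1) * (∫ x in Ω, cutStep ε (u x) * ‖gradient u x‖ ^ 2)
        + ρ / 2 * ∫ x in Ω, deriv (cutStep ε) (u x) * ‖gradient u x‖ ^ 3
      ≤ τ / 2 * (lam * ∫ x in Ω, f (u x))
        - lam * ∫ x in Ω, cutStep ε (u x) * (f (u x) * inner ℝ (gradient u x) (x - z)) := by
  obtain ⟨ε₀, hε₀, hle⟩ := hu.exists_inner_gradient_add_norm_le hΩ hΩb hΩc hρ hball hτ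
  refine ⟨ε₀ / 2, half_pos hε₀, fun ε hε hεε => ?_⟩
  have hP := hu.pohozaev hΩ hΩb (X := fun x => x - z) (by fun_prop) hε
  have hm := hu.integral_deriv_cutStep_mul_sq_le hΩ hΩb hf hfpos hlam hε
  have huc := hu.continuous
  have hgu := hu.continuous_grad
  have hψ := continuous_cutStep ε
  have hψ' : Continuous (deriv (cutStep ε)) :=
    (contDiff_cutStep ε (k := 1)).continuous_deriv (by norm_num)
  have hi1 : IntegrableOn (fun x => τ / 2 * (deriv (cutStep ε) (u x) * ‖gradient u x‖ ^ 2)) Ω :=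
    integrableOn_of_continuous hΩb (by fun_prop)
  have hi2 : IntegrableOn (fun x => lam * (cutStep ε (u x)
      * (f (u x) * inner ℝ (gradient u x) (x - z)))) Ω :=
    integrableOn_of_continuous hΩb (by fun_prop)
  have hi3 : IntegrableOn (fun x => ((n : ℝ) / 2 - 1) * (cutStep ε (u x) * ‖gradient u x‖ ^ 2)) Ω :=
    integrableOn_of_continuous hΩb (by fun_prop)
  have hi4 : IntegrableOn (fun x => ρ / 2 * (deriv (cutStep ε) (u x) * ‖gradient u x‖ ^ 3)) Ω :=
    integrableOn_of_continuous hΩb (by fun_prop)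
  have hi34 : IntegrableOn (fun x => ((n : ℝ) / 2 - 1) * (cutStep ε (u x) * ‖gradient u x‖ ^ 2)
      + ρ / 2 * (deriv (cutStep ε) (u x) * ‖gradient u x‖ ^ 3)) Ω := hi3.add hi4
  have hmono : ∫ x in Ω, (((n : ℝ) / 2 - 1) * (cutStep ε (u x) * ‖gradient u x‖ ^ 2)
        + ρ / 2 * (deriv (cutStep ε) (u x) * ‖gradient u x‖ ^ 3)
        + (1 / 2 * deriv (cutStep ε) (u x) * ‖gradient u x‖ ^ 2 * inner ℝ (x - z) (gradient u x)
      + cutStep ε (u x) * (inner ℝ (fderiv ℝ (fun x => x - z) x (gradient u x)) (gradient u x)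
        - 1 / 2 * ‖gradient u x‖ ^ 2 * divg (fun x => x - z) x
        - lam * f (u x) * inner ℝ (x - z) (gradient u x))))
      ≤ ∫ x in Ω, (τ / 2 * (deriv (cutStep ε) (u x) * ‖gradient u x‖ ^ 2)
        - lam * (cutStep ε (u x) * (f (u x) * inner ℝ (gradient u x) (x - z)))) := by
    have hid : ∀ x, fderiv ℝ (fun x : Eu n => x - z) x (gradient u x) = gradient u x := fun x => by
      rw [fderiv_sub_const, fderiv_fun_id]; rfl
    simp only [hid, divg_sub_const]
    refine setIntegral_mono_on (integrableOn_of_continuous hΩb (by fun_prop)) (hi1.sub hi2)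
      hΩ.measurableSet fun x hx => ?_
    rw [real_inner_self_eq_norm_sq, real_inner_comm (gradient u x) (x - z)]
    have h1 : deriv (cutStep ε) (u x) * ‖gradient u x‖ ^ 2
        * (inner ℝ (x - z) (gradient u x) + ρ * ‖gradient u x‖)
        ≤ deriv (cutStep ε) (u x) * ‖gradient u x‖ ^ 2 * τ := by
      rcases le_or_gt (u x) (2 * ε) with h | h
      · exact mul_le_mul_of_nonneg_left (hle x hx (by linarith))
          (mul_nonneg (deriv_cutStep_nonneg hε _) (sq_nonneg _))
      · rw [deriv_cutStep_of_gt hε h]; simp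
    rw [real_inner_comm (gradient u x) (x - z)] at h1
    linarith
  have hXc := continuous_divg (V := fun x : Eu n => x - z) (by fun_prop)
  have hX : Continuous fun x => fderiv ℝ (fun x : Eu n => x - z) x :=
    ContDiff.continuous_fderiv (n := 1) (by fun_prop) (by norm_num)
  rw [integral_sub hi1 hi2, integral_add hi34 (integrableOn_of_continuous hΩb (by fun_prop)), integral_add hi3 hi4, hP, add_zero, integral_const_mul, integral_const_mul,
    integral_const_mul, integral_const_mul] at hmono
  linarith [mul_le_mul_of_nonneg_left hm (half_pos hτ).le]

end Pohozaev

section Energy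

variable {n : ℕ} {Ω : Set (Eu n)} {f : ℝ → ℝ} {lam : ℝ} {u : Eu n → ℝ}

theorem IsPositiveSolution.half_sub_one_mul_integral_sq_le (hu : IsPositiveSolution Ω f lam u)
    (hΩ : IsOpen Ω) (hΩb : IsBounded Ω) (hΩc : Convex ℝ Ω) (hne : Ω.Nonempty)
    (hf : Continuous f) (hfpos : ∀ t, 0 ≤ t → 0 ≤ f t) (hlam : 0 ≤ lam) :
    ((n : ℝ) / 2 - 1) * ∫ x in Ω, ‖gradient u x‖ ^ 2
      ≤ n * (lam * ∫ x in Ω, prim f (u x)) := by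
  obtain ⟨z, hz⟩ := hne
  have huc := hu.continuous
  have hgu := hu.continuous_grad
  have hm : 0 ≤ lam * ∫ x in Ω, f (u x) :=
    mul_nonneg hlam (setIntegral_nonneg hΩ.measurableSet fun x hx => hfpos _ (hu.pos x hx).le)
  refine le_of_forall_pos_le_add fun δ hδ => ?_
  obtain ⟨ε₀, hε₀, hle⟩ := hu.pohozaev_radial_le hΩ hΩb hΩc hf hfpos hlam (z := z) le_rfl
    (by simpa using hz) (τ := δ / (lam * (∫ x in Ω, f (u x)) + 1)) (by positivity)
  have hbd : ∀ g : Eu n → ℝ, Continuous g → Tendsto (fun k =>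
      ∫ x in Ω, cutStep (epsSeq k) (u x) * g x) atTop (𝓝 (∫ x in Ω, g x)) := fun g hg =>
    tendsto_setIntegral_of_dominated hΩ hΩb (fun x => |g x|)
      (fun k => (((continuous_cutStep _).comp huc).mul hg).continuousOn) hg.abs
      (fun k x _ => by
        rw [abs_mul, abs_of_nonneg (cutStep_nonneg _ _)]
        exact mul_le_of_le_one_left (abs_nonneg _) (cutStep_le_one _ _))
      (fun x hx => by simpa using (tendsto_cutStep_of_pos (hu.pos x hx)).mul_const (g x))
  have h1 := (hbd (fun x => ‖gradient u x‖ ^ 2) (by fun_prop)).const_mul ((n : ℝ) / 2 - 1)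
  have h2 := ((hbd (fun x => f (u x) * inner ℝ (gradient u x) (x - z))
    (by fun_prop)).const_mul lam).const_sub
      (δ / (lam * (∫ x in Ω, f (u x)) + 1) / 2 * (lam * ∫ x in Ω, f (u x)))
  have h3 := le_of_tendsto_of_tendsto h1 h2 (by
    filter_upwards [tendsto_epsSeq.eventually (gt_mem_nhds hε₀)] with k hk
    simpa using hle _ (epsSeq_pos k) (le_of_lt hk))
  rw [hu.integral_mul_inner_sub hΩ hΩb hf hfpos z] at h3
  have h4 : δ / (lam * (∫ x in Ω, f (u x)) + 1) / 2 * (lam * ∫ x in Ω, f (u x)) ≤ δ := by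
    rw [div_div, div_mul_eq_mul_div, div_le_iff₀ (by positivity)]
    nlinarith
  linarith

theorem exists_integral_sq_gradient_le_of_three_le (hn : 3 ≤ n) (hΩ : IsOpen Ω)
    (hΩb : IsBounded Ω) (hΩc : Convex ℝ Ω) (hne : Ω.Nonempty) (hf : ContDiff ℝ 1 f)
    (hfpos : ∀ t, 0 ≤ t → 0 < f t) (Λ M : ℝ) :
    ∃ C, ∀ lam u, 0 < lam → lam ≤ Λ → IsPositiveSolution Ω f lam u → IsStable Ω f lam u →
      ∫ x in Ω, u x ≤ M → ∫ x in Ω, ‖gradient u x‖ ^ 2 ≤ C := by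
  have hn' : (3 : ℝ) ≤ n := by exact_mod_cast hn
  have ha : 0 < (n : ℝ) / 2 - 1 := by linarith
  obtain ⟨C, hC⟩ := exists_integral_prim_le (by omega) hΩ hΩb hΩc hne hf hfpos Λ M
    (σ := ((n : ℝ) / 2 - 1) / (2 * n)) (by positivity)
  refine ⟨n * C / (((n : ℝ) / 2 - 1) / 2), fun lam u hlam hle hu hs hM => ?_⟩
  have h1 := hu.half_sub_one_mul_integral_sq_le hΩ hΩb hΩc hne hf.continuous
    (fun t ht => (hfpos t ht).le) hlam.le
  have h2 := mul_le_mul_of_nonneg_left (hC lam u hlam hle hu hs hM) (by positivity : (0 : ℝ) ≤ n)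
  rw [le_div_iff₀ (by linarith)]
  have h3 : (n : ℝ) * (((n : ℝ) / 2 - 1) / (2 * n) * ∫ x in Ω, ‖gradient u x‖ ^ 2)
      = ((n : ℝ) / 2 - 1) / 2 * ∫ x in Ω, ‖gradient u x‖ ^ 2 := by field_simp
  rw [mul_add, h3] at h2
  nlinarith

end Energy

section Planar

theorem planar_identity (a b : ℝ) (y g : Eu 2) :
    2 * (inner ℝ (!₂[a * y 0 + b * y 1, b * y 0 - a * y 1] : Eu 2) g * inner ℝ y g)
      = ‖g‖ ^ 2 * inner ℝ (!₂[a * y 0 + b * y 1, b * y 0 - a * y 1] : Eu 2) y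
        + ‖y‖ ^ 2 * inner ℝ (!₂[a * g 0 + b * g 1, b * g 0 - a * g 1] : Eu 2) g := by
  simp [EuclideanSpace.real_norm_sq_eq, PiLp.inner_apply, Fin.sum_univ_two]
  ring

theorem exists_setLIntegral_inv_norm_sub_le {η : ℝ≥0∞} (hη : η ≠ 0) :
    ∃ δ > 0, ∀ S : Set (Eu 2), MeasurableSet S → volume S < δ →
      ∀ x, ∫⁻ p in S, ENNReal.ofReal ‖x - p‖⁻¹ ≤ η := by
  let G : Eu 2 → ℝ≥0∞ := fun y => (Metric.ball 0 1).indicator (fun y => ENNReal.ofReal ‖y‖⁻¹) y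
  have hGm : Measurable G :=
    Measurable.indicator (by fun_prop) Metric.isOpen_ball.measurableSet
  have hG : ∫⁻ y, G y ≠ ∞ := by
    have hi : IntegrableOn (fun y : Eu 2 => ‖y‖⁻¹) (Metric.ball 0 1) := by
      rw [integrableOn_fun_norm_addHaar volume (f := fun t => t⁻¹)]
      refine (integrableOn_congr_fun (g := fun _ => (1 : ℝ)) (fun t ht => ?_)
        measurableSet_Ioo).2 (by simp)
      have : t ≠ 0 := ht.1.ne'
      simp [this]
    rw [lintegral_indicator Metric.isOpen_ball.measurableSet]
    exact (hasFiniteIntegral_iff_ofReal (ae_of_all _ fun y => by positivity)).1 hi.2 |>.ne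
  obtain ⟨δ, hδ, hle⟩ := exists_pos_setLIntegral_lt_of_measure_lt hG
    (ENNReal.half_pos hη).ne'
  refine ⟨min δ (η / 2), lt_min hδ (ENNReal.half_pos hη), fun S hS hvol x => ?_⟩
  have hmp : MeasurePreserving (fun p : Eu 2 => x - p) volume volume :=
    Measure.measurePreserving_sub_left volume x
  have h1 : ∫⁻ p in S, G (x - p) ≤ η / 2 := by
    have := hmp.setLIntegral_comp_preimage (hmp.measurable hS) hGm
    rw [← Set.preimage_comp] at this
    have hid : ((fun p : Eu 2 => x - p) ∘ fun p => x - p) = id := by ext p; simp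
    rw [hid, Set.preimage_id] at this
    rw [this]
    refine (hle _ ?_).le
    rw [hmp.measure_preimage hS.nullMeasurableSet]
    exact hvol.trans_le (min_le_left _ _)
  calc ∫⁻ p in S, ENNReal.ofReal ‖x - p‖⁻¹ ≤ ∫⁻ p in S, (1 + G (x - p)) := by
        refine lintegral_mono fun p => ?_
        by_cases h : x - p ∈ Metric.ball (0 : Eu 2) 1
        · simp only [G, Set.indicator_of_mem h]; exact le_add_self
        · have : 1 ≤ ‖x - p‖ := by simpa using h
          refine le_add_right ?_
          rw [← ENNReal.ofReal_one]
          exact ENNReal.ofReal_le_ofReal (inv_le_one_of_one_le₀ this)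
    _ = volume S + ∫⁻ p in S, G (x - p) := by
        rw [lintegral_add_left measurable_const]; simp
    _ ≤ η / 2 + η / 2 := add_le_add (hvol.le.trans (min_le_right _ _)) h1
    _ = η := ENNReal.add_halves η

theorem exists_tendsto_integral_kernel : ∃ c₀ > 0, ∀ (h : Eu 2 → ℝ) (p : Eu 2), Continuous h →
    Integrable h → Tendsto (fun k : ℕ => ∫ x, ((k : ℝ) + 1) ^ 2 /
      (1 + (((k : ℝ) + 1) * ‖p - x‖) ^ 2) ^ 2 * h x) atTop (𝓝 (c₀ * h p)) := by
  have hi : Integrable (fun y : Eu 2 => ((1 + ‖y‖ ^ 2) ^ 2)⁻¹) := by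
    have := integrable_rpow_neg_one_add_norm_sq (E := Eu 2) (μ := volume) (r := 4)
      (by simp; norm_num)
    refine this.congr (ae_of_all _ fun y => ?_)
    have h0 : (0 : ℝ) ≤ 1 + ‖y‖ ^ 2 := by positivity
    norm_num [Real.rpow_neg h0]
  obtain ⟨c₀, hc₀⟩ : ∃ c : ℝ, c = ∫ y : Eu 2, ((1 + ‖y‖ ^ 2) ^ 2)⁻¹ := ⟨_, rfl⟩
  have hc : 0 < c₀ := by
    rw [hc₀, integral_pos_iff_support_of_nonneg (fun y => by positivity) hi]
    have : Function.support (fun y : Eu 2 => ((1 + ‖y‖ ^ 2) ^ 2)⁻¹) = Set.univ := by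
      refine Set.eq_univ_of_forall fun y => ?_
      have : (0 : ℝ) < ((1 + ‖y‖ ^ 2) ^ 2)⁻¹ := by positivity
      exact this.ne'
    rw [this]; simp
  refine ⟨c₀, hc, fun h p hcont hint => ?_⟩
  have hlim := tendsto_integral_comp_smul_smul_of_integrable' (μ := volume)
    (φ := fun y : Eu 2 => ((1 + ‖y‖ ^ 2) ^ 2)⁻¹ / c₀) (fun y => by positivity)
    (by rw [integral_div, ← hc₀, div_self hc.ne']) (by
      have h2 : Tendsto (fun y : Eu 2 => (‖y‖ ^ 2)⁻¹ / c₀) (cobounded _) (𝓝 0) := by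
        simpa using ((tendsto_inv_atTop_zero.comp ((tendsto_pow_atTop two_ne_zero).comp
          tendsto_norm_cobounded_atTop)).div_const c₀)
      refine squeeze_zero (fun y => by positivity) (fun y => ?_) h2
      rcases eq_or_ne y 0 with rfl | hy
      · simp
      have hy : 0 < ‖y‖ := norm_pos_iff.2 hy
      simp only [finrank_euclideanSpace, Fintype.card_fin]
      rw [← mul_div_assoc]
      gcongr
      rw [← div_eq_mul_inv, inv_eq_one_div, div_le_div_iff₀ (by positivity) (by positivity)]
      nlinarith [sq_nonneg (‖y‖ ^ 2)]) hint hcont.continuousAt (x₀ := p)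
  have ht : Tendsto (fun k : ℕ => (k : ℝ) + 1) atTop atTop :=
    tendsto_atTop_add_const_right _ _ tendsto_natCast_atTop_atTop
  refine ((hlim.comp ht).const_mul c₀).congr fun k => ?_
  simp only [Function.comp_apply, finrank_euclideanSpace, Fintype.card_fin, smul_eq_mul]
  rw [← integral_const_mul]
  congr 1; ext x
  rw [norm_smul, Real.norm_of_nonneg (by positivity)]
  field_simp

end Planar

section PlanarEnergy

/-- The symmetric traceless matrix with first row `(a, b)`, as a continuous linear map. -/
noncomputable def symTraceless (a b : ℝ) : Eu 2 →L[ℝ] Eu 2 :=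
  LinearMap.toContinuousLinearMap
    { toFun := fun y => !₂[a * y 0 + b * y 1, b * y 0 - a * y 1]
      map_add' := fun x y => by ext i; fin_cases i <;> simp <;> ring
      map_smul' := fun c y => by ext i; fin_cases i <;> simp <;> ring }

theorem symTraceless_apply (a b : ℝ) (y : Eu 2) :
    symTraceless a b y = !₂[a * y 0 + b * y 1, b * y 0 - a * y 1] := rfl

theorem norm_symTraceless_apply {a b : ℝ} (hab : a ^ 2 + b ^ 2 = 1) (y : Eu 2) :
    ‖symTraceless a b y‖ = ‖y‖ := by
  rw [← sq_eq_sq₀ (norm_nonneg _) (norm_nonneg _), EuclideanSpace.real_norm_sq_eq,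
    EuclideanSpace.real_norm_sq_eq, symTraceless_apply]
  simp only [Fin.sum_univ_two, Matrix.cons_val_zero, Matrix.cons_val_one]
  linear_combination (y 0 ^ 2 + y 1 ^ 2) * hab

theorem exists_inner_symTraceless_eq (g : Eu 2) :
    ∃ a b : ℝ, a ^ 2 + b ^ 2 = 1 ∧ inner ℝ (symTraceless a b g) g = ‖g‖ ^ 2 := by
  rcases eq_or_ne g 0 with rfl | hg
  · exact ⟨1, 0, by norm_num, by simp⟩
  have h : 0 < g 0 ^ 2 + g 1 ^ 2 := by
    have := pow_pos (norm_pos_iff.2 hg) 2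
    rwa [EuclideanSpace.real_norm_sq_eq, Fin.sum_univ_two] at this
  refine ⟨(g 0 ^ 2 - g 1 ^ 2) / (g 0 ^ 2 + g 1 ^ 2), 2 * g 0 * g 1 / (g 0 ^ 2 + g 1 ^ 2), ?_, ?_⟩
  · field_simp; ring
  · rw [EuclideanSpace.real_norm_sq_eq, symTraceless_apply]
    simp only [PiLp.inner_apply, Fin.sum_univ_two, Matrix.cons_val_zero, Matrix.cons_val_one,
      RCLike.inner_apply, conj_trivial]
    field_simp; ring

/-- The vector field `S (x - p) / (|x - p|² + N⁻²)`. -/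
noncomputable def kernelField (a b N : ℝ) (p x : Eu 2) : Eu 2 :=
  (N ^ 2 * (1 + N ^ 2 * ‖x - p‖ ^ 2)⁻¹) • symTraceless a b (x - p)

theorem contDiff_kernelField (a b N : ℝ) (p : Eu 2) : ContDiff ℝ 1 (kernelField a b N p) := by
  have h1 : ContDiff ℝ 1 fun x : Eu 2 => x - p := contDiff_id.sub contDiff_const
  have h2 : ContDiff ℝ 1 fun x : Eu 2 => 1 + N ^ 2 * ‖x - p‖ ^ 2 :=
    contDiff_const.add (contDiff_const.mul (h1.norm_sq ℝ))
  exact (contDiff_const.mul (h2.inv fun x => by positivity)).smul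
    ((symTraceless a b).contDiff.comp h1)

theorem fderiv_kernelField (a b N : ℝ) (p x v : Eu 2) :
    fderiv ℝ (kernelField a b N p) x v
      = -(2 * N ^ 4 * ((1 + N ^ 2 * ‖x - p‖ ^ 2) ^ 2)⁻¹ * inner ℝ (x - p) v) •
          symTraceless a b (x - p)
        + (N ^ 2 * (1 + N ^ 2 * ‖x - p‖ ^ 2)⁻¹) • symTraceless a b v := by
  have h0 : (1 + N ^ 2 * ‖x - p‖ ^ 2) ≠ 0 := by positivity
  have h1 : HasFDerivAt (fun x : Eu 2 => x - p) (ContinuousLinearMap.id ℝ (Eu 2)) x :=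
    (hasFDerivAt_id x).sub_const p
  have h2 : HasFDerivAt (fun x : Eu 2 => N ^ 2 * (1 + N ^ 2 * ‖x - p‖ ^ 2)⁻¹) _ x :=
    ((hasDerivAt_inv h0).comp_hasFDerivAt x
      ((h1.norm_sq.const_mul (N ^ 2)).const_add 1)).const_mul (N ^ 2)
  have h3 : HasFDerivAt (fun x : Eu 2 => symTraceless a b (x - p)) (symTraceless a b) x :=
    (symTraceless a b).hasFDerivAt.comp x h1
  have h4 : HasFDerivAt (kernelField a b N p) _ x := h2.smul h3
  rw [h4.fderiv]
  simp only [add_apply, smul_apply, ContinuousLinearMap.smulRight_apply,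
    ContinuousLinearMap.comp_apply, innerSL_apply_apply, ContinuousLinearMap.id_apply,
    smul_eq_mul, nsmul_eq_mul]
  rw [add_comm]
  congr 2
  push_cast
  ring

theorem kernelField_pohozaev (a b N : ℝ) (p x g : Eu 2) :
    inner ℝ (fderiv ℝ (kernelField a b N p) x g) g
        - 1 / 2 * ‖g‖ ^ 2 * divg (kernelField a b N p) x
      = N ^ 2 / (1 + (N * ‖p - x‖) ^ 2) ^ 2 * inner ℝ (symTraceless a b g) g := by
  have h0 : (1 + N ^ 2 * ‖x - p‖ ^ 2) ≠ 0 := by positivity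
  have hd : divg (kernelField a b N p) x
      = -(2 * N ^ 4 * ((1 + N ^ 2 * ‖x - p‖ ^ 2) ^ 2)⁻¹ *
        inner ℝ (symTraceless a b (x - p)) (x - p)) := by
    simp only [divg, fderiv_kernelField, Fin.sum_univ_two]
    simp [PiLp.inner_apply, symTraceless_apply]
    ring
  have hid := planar_identity a b (x - p) g
  rw [← symTraceless_apply, ← symTraceless_apply] at hid
  rw [hd, fderiv_kernelField, inner_add_left, inner_smul_left, inner_smul_left, norm_sub_rev p x]
  simp only [conj_trivial]
  field_simp
  linear_combination (-N ^ 4) * hid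

theorem norm_kernelField_le {a b : ℝ} (hab : a ^ 2 + b ^ 2 = 1) (N : ℝ) (p x : Eu 2) :
    ‖kernelField a b N p x‖ ≤ ‖x - p‖⁻¹ := by
  rw [kernelField, norm_smul, norm_symTraceless_apply hab, Real.norm_of_nonneg (by positivity)]
  rcases eq_or_ne (x - p) 0 with h | h
  · simp [h]
  have h : 0 < ‖x - p‖ := norm_pos_iff.2 h
  rw [← div_eq_mul_inv, div_mul_eq_mul_div, ← one_div, div_le_div_iff₀ (by positivity) h]
  nlinarith

end PlanarEnergy

section PlanarBound

theorem IsPositiveSolution.ofReal_integral_kernel_le {Ω : Set (Eu 2)} {f : ℝ → ℝ} {lam : ℝ}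
    {u : Eu 2 → ℝ} (hu : IsPositiveSolution Ω f lam u) (hΩ : IsOpen Ω) (hΩb : IsBounded Ω)
    (hf : Continuous f) (hfpos : ∀ t, 0 ≤ t → 0 ≤ f t) (hlam : 0 ≤ lam) {ε : ℝ} (hε : 0 < ε)
    {a b : ℝ} (hab : a ^ 2 + b ^ 2 = 1) (N : ℝ) (p : Eu 2) :
    ENNReal.ofReal (∫ x in Ω, N ^ 2 / (1 + (N * ‖p - x‖) ^ 2) ^ 2 *
        (cutStep ε (u x) * inner ℝ (symTraceless a b (gradient u x)) (gradient u x)))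
      ≤ ∫⁻ x in Ω, ENNReal.ofReal (lam * (f (u x) * ‖gradient u x‖)
          + 1 / 2 * (deriv (cutStep ε) (u x) * ‖gradient u x‖ ^ 3))
          * ENNReal.ofReal ‖x - p‖⁻¹ := by
  have huc := hu.continuous
  have hgu := hu.continuous_grad
  have hψ := continuous_cutStep ε
  have hψ' : Continuous (deriv (cutStep ε)) :=
    ((contDiff_cutStep ε (k := 1)).continuous_deriv le_rfl)
  have hX := contDiff_kernelField a b N p
  have hXc := hX.continuous
  have hP := hu.pohozaev hΩ hΩb hX hε
  set W : Eu 2 → ℝ := fun x => cutStep ε (u x) * (lam * f (u x) *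
      inner ℝ (kernelField a b N p x) (gradient u x))
    - 1 / 2 * deriv (cutStep ε) (u x) * ‖gradient u x‖ ^ 2 *
      inner ℝ (kernelField a b N p x) (gradient u x) with hW
  have hWc : Continuous W := by fun_prop
  have hKc : Continuous fun x => N ^ 2 / (1 + (N * ‖p - x‖) ^ 2) ^ 2 *
        (cutStep ε (u x) * inner ℝ (symTraceless a b (gradient u x)) (gradient u x)) := by
    refine Continuous.mul (continuous_const.div (by fun_prop) fun x => by positivity) ?_
    fun_prop
  have heq : ∫ x in Ω, N ^ 2 / (1 + (N * ‖p - x‖) ^ 2) ^ 2 *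
        (cutStep ε (u x) * inner ℝ (symTraceless a b (gradient u x)) (gradient u x))
      = ∫ x in Ω, W x := by
    rw [← sub_eq_zero, ← integral_sub (integrableOn_of_continuous hΩb hKc)
      (integrableOn_of_continuous hΩb hWc), ← hP]
    refine integral_congr_ae (ae_of_all _ fun x => ?_)
    simp only [kernelField_pohozaev, hW]
    ring
  rw [heq]
  refine (Real.ofReal_le_enorm _).trans ((enorm_integral_le_lintegral_enorm _).trans ?_)
  refine setLIntegral_mono' hΩ.measurableSet fun x hx => ?_
  have hfx := hfpos _ (hu.pos x hx).le
  have hd := deriv_cutStep_nonneg hε (u x)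
  rw [← ENNReal.ofReal_mul (by positivity), Real.enorm_eq_ofReal_abs]
  refine ENNReal.ofReal_le_ofReal ?_
  have hin : |inner ℝ (kernelField a b N p x) (gradient u x)| ≤ ‖x - p‖⁻¹ * ‖gradient u x‖ :=
    (abs_real_inner_le_norm _ _).trans
      (mul_le_mul_of_nonneg_right (norm_kernelField_le hab N p x) (norm_nonneg _))
  have h1 : |cutStep ε (u x) * (lam * f (u x) *
      inner ℝ (kernelField a b N p x) (gradient u x))|
      ≤ lam * f (u x) * (‖x - p‖⁻¹ * ‖gradient u x‖) := by
    rw [abs_mul, abs_of_nonneg (cutStep_nonneg _ _)]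
    refine (mul_le_of_le_one_left (abs_nonneg _) (cutStep_le_one _ _)).trans ?_
    rw [abs_mul, abs_of_nonneg (mul_nonneg hlam hfx)]
    exact mul_le_mul_of_nonneg_left hin (mul_nonneg hlam hfx)
  have h2 : |1 / 2 * deriv (cutStep ε) (u x) * ‖gradient u x‖ ^ 2 *
      inner ℝ (kernelField a b N p x) (gradient u x)|
      ≤ 1 / 2 * deriv (cutStep ε) (u x) * ‖gradient u x‖ ^ 2 * (‖x - p‖⁻¹ * ‖gradient u x‖) := by
    have : 0 ≤ 1 / 2 * deriv (cutStep ε) (u x) * ‖gradient u x‖ ^ 2 := by positivity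
    rw [abs_mul, abs_of_nonneg this]
    exact mul_le_mul_of_nonneg_left hin this
  refine (abs_sub _ _).trans ((add_le_add h1 h2).trans (le_of_eq ?_))
  ring

theorem exists_ofReal_mul_sq_gradient_le : ∃ c₀ > 0, ∀ {Ω : Set (Eu 2)} {f : ℝ → ℝ} {lam : ℝ}
    {u : Eu 2 → ℝ}, IsPositiveSolution Ω f lam u → IsOpen Ω → IsBounded Ω →
    Continuous f → (∀ t, 0 ≤ t → 0 ≤ f t) → 0 ≤ lam → ∀ {ε : ℝ}, 0 < ε →
    ∀ p ∈ Ω, 2 * ε ≤ u p → ENNReal.ofReal (c₀ * ‖gradient u p‖ ^ 2)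
      ≤ ∫⁻ x in Ω, ENNReal.ofReal (lam * (f (u x) * ‖gradient u x‖)
          + 1 / 2 * (deriv (cutStep ε) (u x) * ‖gradient u x‖ ^ 3))
          * ENNReal.ofReal ‖x - p‖⁻¹ := by
  obtain ⟨c₀, hc₀, hlim⟩ := exists_tendsto_integral_kernel
  refine ⟨c₀, hc₀, fun {Ω f lam u} hu hΩ hΩb hf hfpos hlam {ε} hε p hp hup => ?_⟩
  have huc := hu.continuous
  have hgu := hu.continuous_grad
  have hψ := continuous_cutStep ε
  obtain ⟨a, b, hab, hg⟩ := exists_inner_symTraceless_eq (gradient u p)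
  let V : Eu 2 → ℝ := fun x =>
    cutStep ε (u x) * inner ℝ (symTraceless a b (gradient u x)) (gradient u x)
  have hVc : Continuous V := by simp only [V]; fun_prop
  have hV : VanishesNearFrontier Ω V :=
    vanishesNearFrontier_of_eq_zero_of_le (ε := ε) huc (fun x hx => by rw [hu.bc x hx]; exact hε)
      fun x _ h => by simp [V, cutStep_of_le hε h]
  have hh : Continuous (Ω.indicator V) :=
    (contDiff_indicator (k := 0) hΩ hV (contDiffOn_zero.2 hVc.continuousOn)).continuous
  have ht := hlim _ p hh (hh.integrable_of_hasCompactSupport (hasCompactSupport_indicator hΩb V))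
  have hVp : Ω.indicator V p = ‖gradient u p‖ ^ 2 := by
    rw [Set.indicator_of_mem hp]
    simp only [V, cutStep_of_ge hε hup, hg, one_mul]
  rw [hVp] at ht
  refine le_of_tendsto' ((ENNReal.continuous_ofReal.tendsto _).comp ht) fun k => ?_
  refine le_trans (le_of_eq ?_)
    (hu.ofReal_integral_kernel_le hΩ hΩb hf hfpos hlam hε hab ((k : ℝ) + 1) p)
  simp only [Function.comp_apply]
  rw [← integral_indicator hΩ.measurableSet]
  congr 2; ext x
  by_cases hx : x ∈ Ω <;> simp [hx, V]

/-- Averaging the pointwise kernel bound over a small set. -/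
theorem exists_setIntegral_sq_gradient_le {κ : ℝ} (hκ : 0 < κ) : ∃ δ > 0, ∀ {Ω : Set (Eu 2)}
    {f : ℝ → ℝ} {lam : ℝ} {u : Eu 2 → ℝ}, IsPositiveSolution Ω f lam u → IsOpen Ω → IsBounded Ω →
    Continuous f → (∀ t, 0 ≤ t → 0 ≤ f t) → 0 ≤ lam → ∀ {ε : ℝ}, 0 < ε →
    ∀ S ⊆ Ω, MeasurableSet S → volume S < δ → (∀ p ∈ S, 2 * ε ≤ u p) →
    ∫ p in S, ‖gradient u p‖ ^ 2 ≤ κ * ∫ x in Ω, (lam * (f (u x) * ‖gradient u x‖)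
          + 1 / 2 * (deriv (cutStep ε) (u x) * ‖gradient u x‖ ^ 3)) := by
  obtain ⟨c₀, hc₀, hle⟩ := exists_ofReal_mul_sq_gradient_le
  obtain ⟨δ, hδ, hker⟩ := exists_setLIntegral_inv_norm_sub_le
    (η := ENNReal.ofReal (κ * c₀)) (by simpa using mul_pos hκ hc₀)
  refine ⟨δ, hδ, fun {Ω f lam u} hu hΩ hΩb hf hfpos hlam {ε} hε S hSΩ hS hvol hSu => ?_⟩
  have huc := hu.continuous
  have hgu := hu.continuous_grad
  have hψ' : Continuous (deriv (cutStep ε)) :=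
    ((contDiff_cutStep ε (k := 1)).continuous_deriv le_rfl)
  set ν : Eu 2 → ℝ := fun x => lam * (f (u x) * ‖gradient u x‖)
          + 1 / 2 * (deriv (cutStep ε) (u x) * ‖gradient u x‖ ^ 3) with hν
  have hνc : Continuous ν := by fun_prop
  have hνi : IntegrableOn ν Ω := integrableOn_of_continuous hΩb hνc
  have hν0 : ∀ x ∈ Ω, 0 ≤ ν x := fun x hx => by
    have := hfpos _ (hu.pos x hx).le
    have := deriv_cutStep_nonneg hε (u x)
    positivity
  have hνae : 0 ≤ᵐ[volume.restrict Ω] ν :=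
    (ae_restrict_iff' hΩ.measurableSet).2 (ae_of_all _ hν0)
  have hgi : IntegrableOn (fun p => c₀ * ‖gradient u p‖ ^ 2) S :=
    (integrableOn_of_continuous hΩb (by fun_prop)).mono_set hSΩ
  have key : ENNReal.ofReal (∫ p in S, c₀ * ‖gradient u p‖ ^ 2)
      ≤ ENNReal.ofReal (κ * c₀ * ∫ x in Ω, ν x) := by
    rw [ofReal_integral_eq_lintegral_ofReal hgi (ae_of_all _ fun p => by positivity),
      ENNReal.ofReal_mul (by positivity), ofReal_integral_eq_lintegral_ofReal hνi hνae]
    calc ∫⁻ p in S, ENNReal.ofReal (c₀ * ‖gradient u p‖ ^ 2)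
        ≤ ∫⁻ p in S, ∫⁻ x in Ω, ENNReal.ofReal (ν x) * ENNReal.ofReal ‖x - p‖⁻¹ :=
          setLIntegral_mono' hS fun p hp =>
            hle hu hΩ hΩb hf hfpos hlam hε p (hSΩ hp) (hSu p hp)
      _ = ∫⁻ x in Ω, ∫⁻ p in S, ENNReal.ofReal (ν x) * ENNReal.ofReal ‖x - p‖⁻¹ := by
          refine lintegral_lintegral_swap (Measurable.aemeasurable ?_)
          have := hνc.measurable
          fun_prop
      _ ≤ ∫⁻ x in Ω, ENNReal.ofReal (ν x) * ENNReal.ofReal (κ * c₀) := by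
          refine lintegral_mono fun x => ?_
          rw [lintegral_const_mul _ (by fun_prop)]
          exact mul_le_mul_right (hker S hS hvol x) _
      _ = ENNReal.ofReal (κ * c₀) * ∫⁻ x in Ω, ENNReal.ofReal (ν x) := by
          rw [lintegral_mul_const _ (by have := hνc.measurable; fun_prop), mul_comm]
  have h0 : 0 ≤ ∫ x in Ω, ν x := setIntegral_nonneg hΩ.measurableSet hν0
  have := (ENNReal.ofReal_le_ofReal_iff (by positivity)).1 key
  rw [integral_const_mul, mul_comm κ, mul_assoc] at this
  exact le_of_mul_le_mul_left this hc₀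

end PlanarBound

section EnergyBound

theorem IsPositiveSolution.integral_mul_le {n : ℕ} {Ω : Set (Eu n)} {f : ℝ → ℝ} {lam : ℝ}
    {u : Eu n → ℝ} (hu : IsPositiveSolution Ω f lam u) (hΩ : IsOpen Ω) (hΩb : IsBounded Ω)
    (hf : Continuous f) (hfpos : ∀ t, 0 ≤ t → 0 ≤ f t) (hfmono : MonotoneOn f (Set.Ici 0))
    (hlam : 0 ≤ lam) {β : ℝ → ℝ} (hβ : Continuous β) {T : ℝ} (hT : 0 < T)
    (hβT : ∀ t, 0 ≤ t → β t ≤ 2 * T) :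
    lam * ∫ x in Ω, f (u x) * β (u x)
      ≤ lam * (2 * T * f (8 * T) * volume.real Ω) + 1 / 4 * ∫ x in Ω, ‖gradient u x‖ ^ 2 := by
  have huc := hu.continuous
  rw [hu.integral_sq_gradient hΩ hΩb]
  have h1 : ∫ x in Ω, f (u x) * β (u x)
      ≤ ∫ x in Ω, (2 * T * f (8 * T) + 1 / 4 * (f (u x) * u x)) := by
    refine setIntegral_mono_on (integrableOn_of_continuous hΩb (by fun_prop))
      (integrableOn_of_continuous hΩb (by fun_prop)) hΩ.measurableSet fun x hx => ?_
    have hpos := (hu.pos x hx).le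
    have hfx := hfpos _ hpos
    have hf8 := hfpos (8 * T) (by positivity)
    refine (mul_le_mul_of_nonneg_left (hβT _ hpos) hfx).trans ?_
    rcases le_total (u x) (8 * T) with h | h
    · have := hfmono hpos (show (0 : ℝ) ≤ 8 * T by positivity) h
      nlinarith [mul_nonneg hfx hpos]
    · nlinarith [mul_nonneg hT.le hf8]
  rw [integral_add (integrableOn_of_continuous hΩb continuous_const)
    (integrableOn_of_continuous hΩb (by fun_prop)), setIntegral_const, integral_const_mul,
    smul_eq_mul] at h1
  have h2 := mul_le_mul_of_nonneg_left h1 hlam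
  linarith

theorem exists_integral_sq_gradient_le_planar {Ω : Set (Eu 2)} {f : ℝ → ℝ} (hΩ : IsOpen Ω)
    (hΩb : IsBounded Ω) (hΩc : Convex ℝ Ω) (hne : Ω.Nonempty) (hf : ContDiff ℝ 1 f)
    (hfpos : ∀ t, 0 ≤ t → 0 < f t) (hfmono : MonotoneOn f (Set.Ici 0)) (Λ M : ℝ) :
    ∃ C, ∀ lam u, 0 < lam → lam ≤ Λ → IsPositiveSolution Ω f lam u → IsStable Ω f lam u →
      ∫ x in Ω, u x ≤ M → ∫ x in Ω, ‖gradient u x‖ ^ 2 ≤ C := by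
  have hfpos' : ∀ t, 0 ≤ t → 0 ≤ f t := fun t ht => (hfpos t ht).le
  obtain ⟨z, hz⟩ := id hne
  obtain ⟨ρ, hρ, hball⟩ := Metric.nhds_basis_closedBall.mem_iff.1 (hΩ.mem_nhds hz)
  obtain ⟨R, hR0, hR⟩ : ∃ R, 0 ≤ R ∧ ∀ x ∈ Ω, ‖x - z‖ ≤ R := by
    obtain ⟨R, hR⟩ := hΩb.subset_closedBall z
    have hR' : ∀ x ∈ Ω, ‖x - z‖ ≤ R := fun x hx => by
      simpa [dist_eq_norm] using hR hx
    exact ⟨R, (norm_nonneg _).trans (hR' z hz), hR'⟩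
  obtain ⟨C₁, hC₁0, hC₁⟩ := exists_integral_mul_norm_gradient_le hΩ hΩb hΩc hne
  obtain ⟨C₂, hC₂⟩ := exists_integral_prim_le le_rfl hΩ hΩb hΩc hne hf hfpos Λ M one_pos
  set K : ℝ := (1 + R / ρ) * C₁ with hK
  have hK0 : 0 ≤ K := by positivity
  obtain ⟨δ, hδ, hsmall⟩ := exists_setIntegral_sq_gradient_le (κ := 1 / (8 * (K + 1)))
    (by positivity)
  obtain ⟨r, hr0, hrδ⟩ := ENNReal.lt_iff_exists_nnreal_btwn.1 hδ
  have hr : (0 : ℝ) < r := by exact_mod_cast hr0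
  set T : ℝ := (|M| + 1) / r with hT
  have hT0 : 0 < T := by positivity
  refine ⟨2 * (1 / (8 * (K + 1)) * (K * C₂ + 1 / (2 * ρ))
    + Λ * (2 * T * f (8 * T) * volume.real Ω)), fun lam u hlam hle hu hs hM => ?_⟩
  have huc := hu.continuous
  have hgu := hu.continuous_grad
  set E := ∫ x in Ω, ‖gradient u x‖ ^ 2 with hE
  set A := lam * ∫ x in Ω, f (u x) * ‖gradient u x‖ with hA
  have hA' : A ≤ C₁ * (2 * E + C₂) := by
    refine (hC₁ f lam u hf hfpos hlam hu hs).trans (mul_le_mul_of_nonneg_left ?_ hC₁0)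
    linarith [hC₂ lam u hlam hle hu hs hM]
  have hm : 0 ≤ lam * ∫ x in Ω, f (u x) := mul_nonneg hlam.le
    (setIntegral_nonneg hΩ.measurableSet fun x hx => hfpos' _ (hu.pos x hx).le)
  obtain ⟨ε₀, hε₀, hPoh⟩ := hu.pohozaev_radial_le hΩ hΩb hΩc hf.continuous hfpos' hlam.le
    hρ.le hball (τ := 1 / (lam * (∫ x in Ω, f (u x)) + 1)) (by positivity)
  set ε := min ε₀ (T / 2) with hε
  have hε0 : 0 < ε := by positivity
  have hψ := continuous_cutStep ε
  have hψ' : Continuous (deriv (cutStep ε)) :=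
    ((contDiff_cutStep ε (k := 1)).continuous_deriv le_rfl)
  set J := ∫ x in Ω, deriv (cutStep ε) (u x) * ‖gradient u x‖ ^ 3 with hJ
  have hJ' : ρ / 2 * J ≤ 1 / 2 + R * A := by
    have h1 := hPoh ε hε0 (min_le_left _ _)
    have h2 : 1 / (lam * (∫ x in Ω, f (u x)) + 1) / 2 * (lam * ∫ x in Ω, f (u x)) ≤ 1 / 2 := by
      rw [div_div, div_mul_eq_mul_div, div_le_div_iff₀ (by positivity) two_pos]
      nlinarith
    have h3 : -∫ x in Ω, cutStep ε (u x) * (f (u x) * inner ℝ (gradient u x) (x - z))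
        ≤ R * ∫ x in Ω, f (u x) * ‖gradient u x‖ := by
      rw [← integral_neg, ← integral_const_mul]
      refine setIntegral_mono_on (integrableOn_of_continuous hΩb (by fun_prop))
        (integrableOn_of_continuous hΩb (by fun_prop)) hΩ.measurableSet fun x hx => ?_
      have hfx := hfpos' _ (hu.pos x hx).le
      refine (neg_le_abs _).trans ?_
      rw [abs_mul, abs_of_nonneg (cutStep_nonneg _ _)]
      refine (mul_le_of_le_one_left (abs_nonneg _) (cutStep_le_one _ _)).trans ?_
      rw [abs_mul, abs_of_nonneg hfx]
      have : |inner ℝ (gradient u x) (x - z)| ≤ ‖gradient u x‖ * R :=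
        (abs_real_inner_le_norm _ _).trans (mul_le_mul_of_nonneg_left (hR x hx) (norm_nonneg _))
      exact (mul_le_mul_of_nonneg_left this hfx).trans (le_of_eq (by ring))
    have h4 := mul_le_mul_of_nonneg_left h3 hlam.le
    have h5 : lam * (R * ∫ x in Ω, f (u x) * ‖gradient u x‖) = R * A := by rw [hA]; ring
    have h0 : ((2 : ℕ) : ℝ) / 2 - 1 = 0 := by norm_num
    rw [h0, zero_mul, zero_add] at h1
    linarith
  set S := {x ∈ Ω | T < u x} with hS
  have hSΩ : S ⊆ Ω := fun x hx => hx.1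
  have hSm : MeasurableSet S :=
    hΩ.measurableSet.inter (isOpen_lt continuous_const huc).measurableSet
  have hvol : volume S < δ := by
    have h1 := measureReal_superlevel_le hΩ hu.pos (integrableOn_of_continuous hΩb huc) hT0 hM
    have h2 : M / T < r := by
      rw [div_lt_iff₀ hT0, hT, mul_div_cancel₀ _ hr.ne']
      linarith [le_abs_self M]
    have hfin : volume S ≠ ∞ := ((measure_mono hSΩ).trans_lt hΩb.measure_lt_top).ne
    refine lt_trans ?_ hrδ
    rw [← ENNReal.toReal_lt_toReal hfin ENNReal.coe_ne_top]
    exact h1.trans_lt h2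
  have hES : ∫ p in S, ‖gradient u p‖ ^ 2
      ≤ 1 / (8 * (K + 1)) * (K * C₂ + 1 / (2 * ρ)) + 1 / 4 * E := by
    have h1 := hsmall hu hΩ hΩb hf.continuous hfpos' hlam.le hε0 S hSΩ hSm hvol fun p hp => by
      have := hp.2
      linarith [min_le_right ε₀ (T / 2)]
    rw [integral_add (integrableOn_of_continuous hΩb (by fun_prop))
      (integrableOn_of_continuous hΩb (by fun_prop)), integral_const_mul, integral_const_mul,
      ← hA, ← hJ] at h1
    have hJ2 : 1 / 2 * J ≤ 1 / (2 * ρ) + R / ρ * A := by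
      have : 1 / 2 * J = ρ / 2 * J / ρ := by field_simp
      rw [this, div_le_iff₀ hρ]
      refine hJ'.trans (le_of_eq ?_)
      field_simp
    have h2 : A + 1 / 2 * J ≤ K * (2 * E + C₂) + 1 / (2 * ρ) := by
      have := mul_le_mul_of_nonneg_left hA' (by positivity : (0 : ℝ) ≤ 1 + R / ρ)
      rw [hK]
      linarith
    refine h1.trans ((mul_le_mul_of_nonneg_left h2 (by positivity)).trans ?_)
    have hE0 : 0 ≤ E := integral_nonneg fun x => by positivity
    have h3 : 1 / (8 * (K + 1)) * (2 * K) ≤ 1 / 4 := by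
      rw [div_mul_eq_mul_div, div_le_div_iff₀ (by positivity) (by norm_num)]
      linarith
    have := mul_le_mul_of_nonneg_right h3 hE0
    linarith
  have hsplit : E ≤ (∫ p in S, ‖gradient u p‖ ^ 2)
      + ∫ x in Ω, (1 - cutStep T (u x)) * ‖gradient u x‖ ^ 2 := by
    have hi1 : IntegrableOn (fun x => ‖gradient u x‖ ^ 2) Ω :=
      integrableOn_of_continuous hΩb (by fun_prop)
    have hψT := continuous_cutStep T
    have hi2 : IntegrableOn (fun x => (1 - cutStep T (u x)) * ‖gradient u x‖ ^ 2) Ω :=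
      integrableOn_of_continuous hΩb (by fun_prop)
    have h1 : ∫ p in S, ‖gradient u p‖ ^ 2
        = ∫ x in Ω, S.indicator (fun p => ‖gradient u p‖ ^ 2) x := by
      rw [setIntegral_indicator hSm, Set.inter_eq_self_of_subset_right hSΩ]
    rw [h1, ← integral_add (hi1.indicator hSm) hi2]
    refine setIntegral_mono_on hi1 ((hi1.indicator hSm).add hi2) hΩ.measurableSet fun x hx => ?_
    by_cases h : T < u x
    · rw [Set.indicator_of_mem (show x ∈ S from ⟨hx, h⟩)]
      have := cutStep_le_one T (u x)
      nlinarith [sq_nonneg ‖gradient u x‖]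
    · rw [Set.indicator_of_notMem (fun hx' => h hx'.2), cutStep_of_le hT0 (not_lt.1 h)]
      simp
  have hβ := hu.integral_deriv_mul_sq hΩ hΩb (β := fun t => t - cutPos T t)
    (contDiff_id.sub (contDiff_cutPos T)) (by simp [cutPos_zero])
    fun t ht => sub_nonneg.2 (cutPos_le hT0 ht)
  have hdβ : deriv (fun t => t - cutPos T t) = fun t => 1 - cutStep T t :=
    funext fun t => ((hasDerivAt_id t).sub (hasDerivAt_cutPos T t)).deriv
  rw [hdβ] at hβ
  have hlow := hu.integral_mul_le hΩ hΩb hf.continuous hfpos' hfmono hlam.le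
    (β := fun t => t - cutPos T t) (continuous_id.sub (continuous_cutPos T)) hT0
    fun t _ => by linarith [le_cutPos_add hT0 t]
  have hΛ : lam * (2 * T * f (8 * T) * volume.real Ω) ≤ Λ * (2 * T * f (8 * T) * volume.real Ω) := by
    have := hfpos' (8 * T) (by positivity)
    exact mul_le_mul_of_nonneg_right hle (by positivity)
  rw [hβ] at hsplit
  linarith

theorem exists_integral_sq_gradient_le {n : ℕ} (hn : 2 ≤ n) {Ω : Set (Eu n)} {f : ℝ → ℝ}
    (hΩ : IsOpen Ω) (hΩb : IsBounded Ω) (hΩc : Convex ℝ Ω) (hf : ContDiff ℝ 1 f)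
    (hfpos : ∀ t, 0 ≤ t → 0 < f t) (hfmono : MonotoneOn f (Set.Ici 0)) (Λ M : ℝ) :
    ∃ C, ∀ lam u, 0 < lam → lam ≤ Λ → IsPositiveSolution Ω f lam u → IsStable Ω f lam u →
      ∫ x in Ω, u x ≤ M → ∫ x in Ω, ‖gradient u x‖ ^ 2 ≤ C := by
  rcases Ω.eq_empty_or_nonempty with rfl | hne
  · exact ⟨0, fun _ _ _ _ _ _ _ => by simp⟩
  obtain rfl | hn3 := hn.eq_or_lt
  · exact exists_integral_sq_gradient_le_planar hΩ hΩb hΩc hne hf hfpos hfmono Λ M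
  · exact exists_integral_sq_gradient_le_of_three_le hn3 hΩ hΩb hΩc hne hf hfpos Λ M

end EnergyBound

section Family

variable {n : ℕ} {Ω : Set (Eu n)} {f : ℝ → ℝ} {L : ℝ} {u : ℝ → Eu n → ℝ} {ustar : Eu n → ℝ}

/-- A nondecreasing family of positive solutions parametrized by `0 < lam < L`. -/
structure IsMonotoneFamily (Ω : Set (Eu n)) (f : ℝ → ℝ) (L : ℝ) (u : ℝ → Eu n → ℝ) : Prop where
  sol : ∀ lam ∈ Set.Ioo 0 L, IsPositiveSolution Ω f lam (u lam)
  mono : ∀ lam ∈ Set.Ioo 0 L, ∀ mu ∈ Set.Ioo 0 L, lam ≤ mu → ∀ x ∈ Ω, u lam x ≤ u mu x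

namespace IsMonotoneFamily

theorem integral_sq_gradient_sub_le (h : IsMonotoneFamily Ω f L u) (hΩ : IsOpen Ω)
    (hΩb : IsBounded Ω) (hf : Continuous f) (hfpos : ∀ t, 0 ≤ t → 0 < f t)
    (hfmono : MonotoneOn f (Set.Ici 0)) {lam mu : ℝ} (hlam : lam ∈ Set.Ioo 0 L)
    (hmu : mu ∈ Set.Ioo 0 L) (hle : lam ≤ mu) :
    ∫ x in Ω, ‖gradient (u mu) x - gradient (u lam) x‖ ^ 2
      ≤ (∫ x in Ω, ‖gradient (u mu) x‖ ^ 2) - ∫ x in Ω, ‖gradient (u lam) x‖ ^ 2 := by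
  have h1 := h.sol lam hlam
  have h2 := h.sol mu hmu
  have hc1 := h1.continuous_grad
  have hc2 := h2.continuous_grad
  have hu1 := h1.continuous
  have hu2 := h2.continuous
  have hcross : ∫ x in Ω, ‖gradient (u lam) x‖ ^ 2
      ≤ ∫ x in Ω, inner ℝ (gradient (u lam) x) (gradient (u mu) x) := by
    rw [h2.integral_inner_gradient hΩ hΩb (h1.contDiff (k := 1)) (fun x hx => (h1.pos x hx).le) h1.bc,
      h1.integral_sq_gradient hΩ hΩb, ← integral_const_mul, ← integral_const_mul]
    refine setIntegral_mono_on (integrableOn_of_continuous hΩb (by fun_prop))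
      (integrableOn_of_continuous hΩb (by fun_prop)) hΩ.measurableSet fun x hx => ?_
    have hp1 := (h1.pos x hx).le
    have hp2 := (h2.pos x hx).le
    have := hfmono hp1 hp2 (h.mono lam hlam mu hmu hle x hx)
    have hf1 := (hfpos _ hp1).le
    rw [← mul_assoc, ← mul_assoc]
    exact mul_le_mul_of_nonneg_right (mul_le_mul hle this hf1 hmu.1.le) hp1
  have hexp : ∫ x in Ω, ‖gradient (u mu) x - gradient (u lam) x‖ ^ 2
      = (∫ x in Ω, ‖gradient (u mu) x‖ ^ 2)
        - 2 * (∫ x in Ω, inner ℝ (gradient (u lam) x) (gradient (u mu) x))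
        + ∫ x in Ω, ‖gradient (u lam) x‖ ^ 2 := by
    rw [← integral_const_mul, ← integral_sub (integrableOn_of_continuous hΩb (by fun_prop))
      (integrableOn_of_continuous hΩb (by fun_prop)),
      ← integral_add (integrableOn_of_continuous hΩb (by fun_prop))
      (integrableOn_of_continuous hΩb (by fun_prop))]
    congr 1; ext x
    rw [norm_sub_sq_real, real_inner_comm]
  linarith

theorem integral_sq_gradient_mono (h : IsMonotoneFamily Ω f L u) (hΩ : IsOpen Ω)
    (hΩb : IsBounded Ω) (hf : Continuous f) (hfpos : ∀ t, 0 ≤ t → 0 < f t)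
    (hfmono : MonotoneOn f (Set.Ici 0)) {lam mu : ℝ} (hlam : lam ∈ Set.Ioo 0 L)
    (hmu : mu ∈ Set.Ioo 0 L) (hle : lam ≤ mu) :
    ∫ x in Ω, ‖gradient (u lam) x‖ ^ 2 ≤ ∫ x in Ω, ‖gradient (u mu) x‖ ^ 2 :=
  sub_nonneg.1 ((integral_nonneg fun x => by positivity).trans
    (h.integral_sq_gradient_sub_le hΩ hΩb hf hfpos hfmono hlam hmu hle))

theorem exists_isStable_gt (h : IsMonotoneFamily Ω f L u) (hΩ : IsOpen Ω)
    (hΩb : IsBounded Ω) (hf : ContDiff ℝ 1 f) (hfpos : ∀ t, 0 ≤ t → 0 < f t)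
    (hfmono : StrictMonoOn f (Set.Ici 0)) {lam : ℝ} (hlam : lam ∈ Set.Ioo 0 L) :
    ∃ mu ∈ Set.Ioo lam L, IsStable Ω f mu (u mu) := by
  have hint : ∀ mu ∈ Set.Ioo 0 L, IntegrableOn (u mu) Ω := fun mu hmu =>
    integrableOn_of_continuous hΩb (h.sol mu hmu).continuous
  have hI : MonotoneOn (fun mu => ∫ x in Ω, u mu x) (Set.Ioo 0 L) := fun a ha b hb hab =>
    setIntegral_mono_on (hint a ha) (hint b hb) hΩ.measurableSet (h.mono a ha b hb hab)
  obtain ⟨mu, hmu, hmuc⟩ : ∃ mu ∈ Set.Ioo lam L,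
      ContinuousWithinAt (fun mu => ∫ x in Ω, u mu x) (Set.Ioo 0 L) mu := by
    by_contra! hcon
    refine (Cardinal.Real.Ioo_countable_iff.1
      (hI.countable_not_continuousWithinAt.mono fun x hx => ?_)).not_gt hlam.2
    exact ⟨⟨hlam.1.trans hx.1, hx.2⟩, hcon x hx⟩
  have hmu0 : mu ∈ Set.Ioo 0 L := ⟨hlam.1.trans hmu.1, hmu.2⟩
  refine ⟨mu, hmu, ?_⟩
  have hpos : 0 < L - mu := sub_pos.2 hmu.2
  let nu : ℕ → ℝ := fun k => mu + (L - mu) / 2 * epsSeq k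
  have hnu_gt : ∀ k, mu < nu k := fun k =>
    lt_add_of_pos_right _ (mul_pos (half_pos hpos) (epsSeq_pos k))
  have hle1 : ∀ k, epsSeq k ≤ 1 := fun k => by
    rw [epsSeq, div_le_one (by positivity)]; linarith [(Nat.cast_nonneg k : (0 : ℝ) ≤ k)]
  have hnu : ∀ k, nu k ∈ Set.Ioo 0 L := fun k => by
    refine ⟨hmu0.1.trans (hnu_gt k), ?_⟩
    have := mul_le_of_le_one_right (half_pos hpos).le (hle1 k)
    simp only [nu]; linarith
  have hanti : Antitone nu := fun k l hkl => by
    have : epsSeq l ≤ epsSeq k := Nat.one_div_le_one_div hkl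
    simp only [nu]; gcongr
  have hnulim : Tendsto nu atTop (𝓝 mu) := by
    simpa using (tendsto_epsSeq.const_mul ((L - mu) / 2)).const_add mu
  refine isStable_of_tendsto hΩ hΩb hf hfpos hfmono hmu0.1 (h.sol mu hmu0) hnu_gt
    (v := fun k => u (nu k)) (fun k => h.sol _ (hnu k))
    (fun k x hx => h.mono mu hmu0 _ (hnu k) (hnu_gt k).le x hx) ?_
  refine tendsto_of_integral_tendsto_of_antitone (fun k => hint _ (hnu k)) (hint mu hmu0) ?_ ?_ ?_
  · exact hmuc.tendsto.comp (tendsto_nhdsWithin_iff.2 ⟨hnulim, Eventually.of_forall hnu⟩)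
  · exact (ae_restrict_iff' hΩ.measurableSet).2 (ae_of_all _ fun x hx k l hkl =>
      h.mono _ (hnu l) _ (hnu k) (hanti hkl) x hx)
  · exact (ae_restrict_iff' hΩ.measurableSet).2 (ae_of_all _ fun x hx k =>
      h.mono _ hmu0 _ (hnu k) (hnu_gt k).le x hx)

theorem le_of_tendsto (h : IsMonotoneFamily Ω f L u)
    (hlim : ∀ x ∈ Ω, Tendsto (fun lam => u lam x) (𝓝[<] L) (𝓝 (ustar x)))
    {lam : ℝ} (hlam : lam ∈ Set.Ioo 0 L) {x : Eu n} (hx : x ∈ Ω) : u lam x ≤ ustar x := by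
  refine ge_of_tendsto (hlim x hx) ?_
  filter_upwards [Ioo_mem_nhdsLT hlam.2] with mu hmu
  exact h.mono lam hlam mu ⟨hlam.1.trans hmu.1, hmu.2⟩ hmu.1.le x hx

theorem exists_integral_sq_gradient_le (h : IsMonotoneFamily Ω f L u) (hn : 2 ≤ n)
    (hΩ : IsOpen Ω) (hΩb : IsBounded Ω) (hΩc : Convex ℝ Ω) (hf : ContDiff ℝ 1 f)
    (hfpos : ∀ t, 0 ≤ t → 0 < f t) (hfmono : StrictMonoOn f (Set.Ici 0))
    (hlim : ∀ x ∈ Ω, Tendsto (fun lam => u lam x) (𝓝[<] L) (𝓝 (ustar x)))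
    (hL1 : IntegrableOn ustar Ω) :
    ∃ C, ∀ lam ∈ Set.Ioo 0 L, ∫ x in Ω, ‖gradient (u lam) x‖ ^ 2 ≤ C := by
  obtain ⟨C, hC⟩ := _root_.exists_integral_sq_gradient_le hn hΩ hΩb hΩc hf hfpos
    hfmono.monotoneOn L (∫ x in Ω, ustar x)
  refine ⟨C, fun lam hlam => ?_⟩
  obtain ⟨mu, hmu, hs⟩ := h.exists_isStable_gt hΩ hΩb hf hfpos hfmono hlam
  have hmu0 : mu ∈ Set.Ioo 0 L := ⟨hlam.1.trans hmu.1, hmu.2⟩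
  have hsol := h.sol mu hmu0
  exact (h.integral_sq_gradient_mono hΩ hΩb hf.continuous hfpos hfmono.monotoneOn hlam hmu0
    hmu.1.le).trans (hC mu (u mu) hmu0.1 hmu0.2.le hsol hs
      (setIntegral_mono_on (integrableOn_of_continuous hΩb hsol.continuous) hL1 hΩ.measurableSet
        fun x hx => h.le_of_tendsto hlim hmu0 hx))

end IsMonotoneFamily

end Family

section Convergence

theorem exists_tendsto_integral_norm_sub_sq {α E : Type*} [MeasurableSpace α] {μ : Measure α}
    [NormedAddCommGroup E] [InnerProductSpace ℝ E] [CompleteSpace E] {g : ℕ → α → E}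
    (hg : ∀ k, MemLp (g k) 2 μ) {a : ℕ → ℝ} (ha : CauchySeq a)
    (hga : ∀ k l, k ≤ l → ∫ x, ‖g l x - g k x‖ ^ 2 ∂μ ≤ a l - a k) :
    ∃ G, MemLp G 2 μ ∧ Tendsto (fun k => ∫ x, ‖g k x - G x‖ ^ 2 ∂μ) atTop (𝓝 0) := by
  have hnorm : ∀ F : Lp E 2 μ, ‖F‖ ^ 2 = ∫ x, ‖F x‖ ^ 2 ∂μ := fun F => by
    rw [← real_inner_self_eq_norm_sq, L2.inner_def]
    simp only [real_inner_self_eq_norm_sq]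
  let F : ℕ → Lp E 2 μ := fun k => (hg k).toLp (g k)
  have hF : CauchySeq F := by
    rw [Metric.cauchySeq_iff'] at ha ⊢
    intro ε hε
    obtain ⟨N, hN⟩ := ha (ε ^ 2) (by positivity)
    refine ⟨N, fun k hk => ?_⟩
    rw [dist_eq_norm, ← abs_of_pos hε, ← abs_norm, ← sq_lt_sq, hnorm]
    have h1 : ∫ x, ‖(F k - F N) x‖ ^ 2 ∂μ = ∫ x, ‖g k x - g N x‖ ^ 2 ∂μ := by
      refine integral_congr_ae ?_
      filter_upwards [Lp.coeFn_sub (F k) (F N), (hg k).coeFn_toLp, (hg N).coeFn_toLp]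
        with x h1 h2 h3
      rw [h1, Pi.sub_apply, h2, h3]
    rw [h1]
    refine (hga N k hk).trans_lt ((le_abs_self _).trans_lt ?_)
    simpa [Real.dist_eq] using hN k hk
  obtain ⟨G, hG⟩ := cauchySeq_tendsto_of_complete hF
  refine ⟨G, Lp.memLp G, ?_⟩
  have h0 : Tendsto (fun k => ‖F k - G‖ ^ 2) atTop (𝓝 0) := by
    simpa using (tendsto_iff_norm_sub_tendsto_zero.1 hG).pow 2
  refine h0.congr fun k => ?_
  rw [hnorm]
  refine integral_congr_ae ?_
  filter_upwards [Lp.coeFn_sub (F k) G, (hg k).coeFn_toLp] with x h1 h2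
  rw [h1, Pi.sub_apply, h2]

variable {n : ℕ} {Ω : Set (Eu n)} {f : ℝ → ℝ} {lam : ℝ} {u : Eu n → ℝ}

/-- The truncation of a positive solution, extended by zero. -/
noncomputable def truncation (Ω : Set (Eu n)) (u : Eu n → ℝ) (ε : ℝ) : Eu n → ℝ :=
  Ω.indicator fun x => cutPos ε (u x)

theorem hasCompactSupport_truncation (hΩb : IsBounded Ω) (u : Eu n → ℝ) (ε : ℝ) :
    HasCompactSupport (truncation Ω u ε) :=
  hasCompactSupport_indicator hΩb _

namespace IsPositiveSolution

theorem vanishesNearFrontier_cutPos (hu : IsPositiveSolution Ω f lam u) {ε : ℝ} (hε : 0 < ε) :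
    VanishesNearFrontier Ω fun x => cutPos ε (u x) :=
  vanishesNearFrontier_of_eq_zero_of_le hu.continuous (fun x hx => by rw [hu.bc x hx]; exact hε)
    fun x _ h => cutPos_of_le hε h

theorem contDiff_truncation (hu : IsPositiveSolution Ω f lam u) (hΩ : IsOpen Ω) {ε : ℝ}
    (hε : 0 < ε) {k : ℕ∞} : ContDiff ℝ k (truncation Ω u ε) :=
  contDiff_indicator hΩ (hu.vanishesNearFrontier_cutPos hε)
    ((contDiff_cutPos ε).comp hu.contDiff).contDiffOn

theorem gradient_truncation (hu : IsPositiveSolution Ω f lam u) (hΩ : IsOpen Ω) (ε : ℝ)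
    {x : Eu n} (hx : x ∈ Ω) :
    gradient (truncation Ω u ε) x = cutStep ε (u x) • gradient u x := by
  have h1 : fderiv ℝ (truncation Ω u ε) x = fderiv ℝ (fun x => cutPos ε (u x)) x :=
    (indicator_eventuallyEq_self hΩ _ hx).fderiv_eq
  have h2 : gradient (truncation Ω u ε) x = gradient (fun x => cutPos ε (u x)) x := by
    simp only [gradient, h1]
  rw [h2, gradient_comp ((hasDerivAt_cutPos ε _).differentiableAt) (hu.differentiable x),
    deriv_cutPos]

theorem tendsto_integral_truncation_sub (hu : IsPositiveSolution Ω f lam u) (hΩ : IsOpen Ω)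
    (hΩb : IsBounded Ω) : Tendsto (fun k => ∫ x in Ω,
      ((truncation Ω u (epsSeq k) x - u x) ^ 2
        + ‖gradient (truncation Ω u (epsSeq k)) x - gradient u x‖ ^ 2)) atTop (𝓝 0) := by
  have huc := hu.continuous
  have hgu := hu.continuous_grad
  have hlim := tendsto_setIntegral_of_dominated hΩ hΩb
    (g := fun k x => (cutPos (epsSeq k) (u x) - u x) ^ 2
        + (cutStep (epsSeq k) (u x) - 1) ^ 2 * ‖gradient u x‖ ^ 2) (G := fun _ => 0)
    (fun x => u x ^ 2 + ‖gradient u x‖ ^ 2)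
    (fun k => by
      have h1 := continuous_cutPos (epsSeq k)
      have h2 := continuous_cutStep (epsSeq k)
      exact Continuous.continuousOn (by fun_prop)) (by fun_prop)
    (fun k x hx => by
      have hp := (hu.pos x hx).le
      rw [abs_of_nonneg (by positivity)]
      have h1 := cutPos_nonneg (epsSeq_pos k) (u x)
      have h2 := cutPos_le (epsSeq_pos k) hp
      have h3 := cutStep_nonneg (epsSeq k) (u x)
      have h4 := cutStep_le_one (epsSeq k) (u x)
      refine add_le_add (by nlinarith) (mul_le_of_le_one_left (by positivity) (by nlinarith)))
    (fun x hx => by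
      have hp := hu.pos x hx
      have h1 := ((tendsto_cutPos (u x)).sub_const (u x)).pow 2
      have h2 := (((tendsto_cutStep_of_pos hp).sub_const 1).pow 2).mul_const (‖gradient u x‖ ^ 2)
      simpa [max_eq_left hp.le] using h1.add h2)
  simp only [integral_zero] at hlim
  refine hlim.congr fun k => setIntegral_congr_fun hΩ.measurableSet fun x hx => ?_
  have h1 : cutStep (epsSeq k) (u x) • gradient u x - gradient u x
      = (cutStep (epsSeq k) (u x) - 1) • gradient u x := by rw [sub_smul, one_smul]
  simp only [hu.gradient_truncation hΩ _ hx, h1, norm_smul, mul_pow, Real.norm_eq_abs, sq_abs]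
  simp only [truncation, Set.indicator_of_mem hx]

end IsPositiveSolution

end Convergence

section Limit

variable {n : ℕ} {Ω : Set (Eu n)} {f : ℝ → ℝ} {L : ℝ} {u : ℝ → Eu n → ℝ} {ustar : Eu n → ℝ}

theorem IsPositiveSolution.eLpNorm_truncation_le {lam : ℝ} {v : Eu n → ℝ}
    (hv : IsPositiveSolution Ω f lam v) (hΩ : IsOpen Ω) (hΩb : IsBounded Ω) {ε : ℝ} (hε : 0 < ε)
    {p' : NNReal} (hn : 0 < n) (hp' : (p' : ℝ)⁻¹ = (2 : ℝ)⁻¹ - (n : ℝ)⁻¹) {C : ℝ}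
    (hC : ∫ x in Ω, ‖gradient v x‖ ^ 2 ≤ C) :
    eLpNorm (truncation Ω v ε) p' (volume.restrict Ω)
      ≤ SNormLESNormFDerivOfEqConst ℝ (volume : Measure (Eu n)) 2
        * ENNReal.ofReal (C ^ (2 : ℝ)⁻¹) := by
  have hgv := hv.continuous_grad
  have hsob := eLpNorm_le_eLpNorm_fderiv_of_eq (volume : Measure (Eu n))
    (hv.contDiff_truncation hΩ hε (k := 1)) (hasCompactSupport_truncation hΩb v ε) (p := 2)
    (p' := p') (by norm_num) (by simpa using hn) (by simpa using hp')
  refine (eLpNorm_mono_measure _ Measure.restrict_le_self).trans (hsob.trans ?_)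
  refine mul_le_mul_right ?_ _
  have hsupp : Function.support (fderiv ℝ (truncation Ω v ε)) ⊆ Ω :=
    (support_fderiv_subset ℝ).trans
      (tsupport_indicator_subset hΩ (hv.vanishesNearFrontier_cutPos hε))
  have hle : eLpNorm (fderiv ℝ (truncation Ω v ε)) 2 volume
      ≤ eLpNorm (gradient v) 2 (volume.restrict Ω) := by
    rw [← eLpNorm_indicator_eq_eLpNorm_restrict hΩ.measurableSet]
    refine eLpNorm_mono fun x => ?_
    by_cases hx : x ∈ Ω
    · rw [Set.indicator_of_mem hx, ← norm_gradient, hv.gradient_truncation hΩ _ hx, norm_smul,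
        Real.norm_of_nonneg (cutStep_nonneg _ _)]
      exact mul_le_of_le_one_left (norm_nonneg _) (cutStep_le_one _ _)
    · rw [Function.notMem_support.1 fun hx' => hx (hsupp hx'), norm_zero]
      exact norm_nonneg _
  have hmem : MemLp (gradient v) 2 (volume.restrict Ω) :=
    (memLp_two_iff_integrable_sq_norm hgv.aestronglyMeasurable).2
      (integrableOn_of_continuous hΩb (by fun_prop))
  refine hle.trans ?_
  rw [hmem.eLpNorm_eq_integral_rpow_norm (by norm_num) (by norm_num)]
  refine ENNReal.ofReal_le_ofReal ?_
  simp only [ENNReal.toReal_ofNat, Real.rpow_ofNat]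
  exact Real.rpow_le_rpow (integral_nonneg fun x => by positivity) hC (by norm_num)

namespace IsMonotoneFamily

theorem integrableOn_rpow (h : IsMonotoneFamily Ω f L u) (hn : 2 ≤ n) (hL : 0 < L)
    (hΩ : IsOpen Ω) (hΩb : IsBounded Ω)
    (hlim : ∀ x ∈ Ω, Tendsto (fun lam => u lam x) (𝓝[<] L) (𝓝 (ustar x)))
    (hL1 : IntegrableOn ustar Ω) {C : ℝ}
    (hC : ∀ lam ∈ Set.Ioo 0 L, ∫ x in Ω, ‖gradient (u lam) x‖ ^ 2 ≤ C) :
    IntegrableOn (fun x => ustar x ^ (2 * (n : ℝ) / ((n : ℝ) - 2))) Ω := by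
  obtain rfl | hn3 := hn.eq_or_lt
  · simpa using integrableOn_of_continuous hΩb (continuous_const (y := (1 : ℝ)))
  have hn' : (2 : ℝ) < n := by exact_mod_cast hn3
  have hn0 : (0 : ℝ) < (n : ℝ) - 2 := by linarith
  obtain ⟨nu, -, hnu, hnulim⟩ := exists_seq_strictMono_tendsto' hL
  have hnulim' : Tendsto nu atTop (𝓝[<] L) :=
    tendsto_nhdsWithin_iff.2 ⟨hnulim, Eventually.of_forall fun k => (hnu k).2⟩
  set p : ℝ := 2 * (n : ℝ) / ((n : ℝ) - 2) with hp
  have hp0 : 0 < p := by positivity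
  obtain ⟨q, hq⟩ : ∃ q : NNReal, (q : ℝ) = p := ⟨⟨p, hp0.le⟩, rfl⟩
  have hbound := fun k => (h.sol _ (hnu k)).eLpNorm_truncation_le hΩ hΩb (epsSeq_pos k)
    (p' := q) (by omega) (by rw [hq, hp]; field_simp) (hC _ (hnu k))
  have hpt : ∀ x ∈ Ω, Tendsto (fun k => truncation Ω (u (nu k)) (epsSeq k) x) atTop
      (𝓝 (ustar x)) := fun x hx => by
    have h1 : Tendsto (fun k => u (nu k) x) atTop (𝓝 (ustar x)) := (hlim x hx).comp hnulim'
    have h2 : Tendsto (fun k => u (nu k) x - 2 * epsSeq k) atTop (𝓝 (ustar x)) := by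
      simpa using h1.sub (tendsto_epsSeq.const_mul 2)
    refine tendsto_of_tendsto_of_tendsto_of_le_of_le h2 h1 (fun k => ?_) fun k => ?_
    · simp only [truncation, Set.indicator_of_mem hx]
      linarith [le_cutPos_add (epsSeq_pos k) (u (nu k) x)]
    · simp only [truncation, Set.indicator_of_mem hx]
      exact cutPos_le (epsSeq_pos k) ((h.sol _ (hnu k)).pos x hx).le
  have hmem : MemLp ustar q (volume.restrict Ω) := by
    refine ⟨hL1.1, lt_of_le_of_lt (Lp.eLpNorm_lim_le_liminf_eLpNorm (fun k =>
      ((h.sol _ (hnu k)).contDiff_truncation hΩ (epsSeq_pos k)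
        (k := 0)).continuous.aestronglyMeasurable) ustar
      ((ae_restrict_iff' hΩ.measurableSet).2 (ae_of_all _ hpt))) ?_⟩
    refine (liminf_le_of_frequently_le' (Frequently.of_forall hbound)).trans_lt ?_
    exact ENNReal.mul_lt_top ENNReal.coe_lt_top ENNReal.ofReal_lt_top
  have hne : (q : ℝ≥0∞) ≠ 0 := by
    rw [ENNReal.coe_ne_zero, ← NNReal.coe_ne_zero, hq]
    exact hp0.ne'
  refine (hmem.integrable_norm_rpow hne ENNReal.coe_ne_top).congr
    ((ae_restrict_iff' hΩ.measurableSet).2 (ae_of_all _ fun x hx => ?_))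
  have hpos : 0 ≤ ustar x :=
    ((h.sol _ (hnu 0)).pos x hx).le.trans (h.le_of_tendsto hlim (hnu 0) hx)
  simp only [Real.norm_of_nonneg hpos, ENNReal.coe_toReal, hq]

theorem exists_tendsto_truncation (h : IsMonotoneFamily Ω f L u) (hn : 2 ≤ n) (hL : 0 < L)
    (hΩ : IsOpen Ω) (hΩb : IsBounded Ω) (hf : Continuous f) (hfpos : ∀ t, 0 ≤ t → 0 < f t)
    (hfmono : MonotoneOn f (Set.Ici 0))
    (hlim : ∀ x ∈ Ω, Tendsto (fun lam => u lam x) (𝓝[<] L) (𝓝 (ustar x)))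
    (hL1 : IntegrableOn ustar Ω) {C : ℝ}
    (hC : ∀ lam ∈ Set.Ioo 0 L, ∫ x in Ω, ‖gradient (u lam) x‖ ^ 2 ≤ C) :
    ∃ (G : Eu n → Eu n) (φ : ℕ → Eu n → ℝ),
      (∀ k, ContDiff ℝ (⊤ : ℕ∞) (φ k) ∧ HasCompactSupport (φ k) ∧ tsupport (φ k) ⊆ Ω) ∧
        Tendsto (fun k => ∫ x in Ω, ((φ k x - ustar x) ^ 2 + ‖gradient (φ k) x - G x‖ ^ 2))
          atTop (𝓝 0) := by
  obtain ⟨nu, hnumono, hnu, hnulim⟩ := exists_seq_strictMono_tendsto' hL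
  have hnulim' : Tendsto nu atTop (𝓝[<] L) :=
    tendsto_nhdsWithin_iff.2 ⟨hnulim, Eventually.of_forall fun k => (hnu k).2⟩
  have hsol := fun k => h.sol _ (hnu k)
  have huc := fun k => (hsol k).continuous
  have hgc := fun k => (hsol k).continuous_grad
  have hgmem : ∀ k, MemLp (gradient (u (nu k))) 2 (volume.restrict Ω) := fun k => by
    have := hgc k
    exact (memLp_two_iff_integrable_sq_norm this.aestronglyMeasurable).2
      (integrableOn_of_continuous hΩb (by fun_prop))
  have hEmono : Monotone fun k => ∫ x in Ω, ‖gradient (u (nu k)) x‖ ^ 2 := fun k l hkl =>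
    h.integral_sq_gradient_mono hΩ hΩb hf hfpos hfmono (hnu k) (hnu l) (hnumono.monotone hkl)
  have hEcauchy : CauchySeq fun k => ∫ x in Ω, ‖gradient (u (nu k)) x‖ ^ 2 :=
    (tendsto_atTop_ciSup hEmono ⟨C, by rintro _ ⟨k, rfl⟩; exact hC _ (hnu k)⟩).cauchySeq
  obtain ⟨G, hG, hGlim⟩ := exists_tendsto_integral_norm_sub_sq hgmem hEcauchy fun k l hkl =>
    h.integral_sq_gradient_sub_le hΩ hΩb hf hfpos hfmono (hnu k) (hnu l) (hnumono.monotone hkl)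
  have hpt : ∀ x ∈ Ω, Tendsto (fun k => u (nu k) x) atTop (𝓝 (ustar x)) := fun x hx =>
    (hlim x hx).comp hnulim'
  have hle : ∀ k, ∀ x ∈ Ω, u (nu k) x ≤ ustar x := fun k x hx => h.le_of_tendsto hlim (hnu k) hx
  obtain ⟨R, hR⟩ := hΩb.subset_closedBall (0 : Eu n)
  have hsq : IntegrableOn (fun x => ustar x ^ 2) Ω := by
    refine (integrable_and_integral_le_of_tendsto (g := fun k x => u (nu k) x ^ 2)
      (C := R ^ 2 * C) (fun k => ?_) (fun k => ae_of_all _ fun x => sq_nonneg _) (fun k => ?_)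
      ((ae_restrict_iff' hΩ.measurableSet).2 (ae_of_all _ fun x hx => (hpt x hx).pow 2))).1
    · exact integrableOn_of_continuous hΩb ((huc k).pow 2)
    · exact (integral_sq_le_integral_sq_gradient hn hΩ hΩb ((hsol k).contDiff (k := 1))
        (hsol k).bc (y := 0) fun x hx => by simpa using hR hx).trans
        (mul_le_mul_of_nonneg_left (hC _ (hnu k)) (sq_nonneg R))
  have humem : MemLp ustar 2 (volume.restrict Ω) := (memLp_two_iff_integrable_sq hL1.1).2 hsq
  have hukmem : ∀ k, MemLp (u (nu k)) 2 (volume.restrict Ω) := fun k =>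
    (memLp_two_iff_integrable_sq (huc k).aestronglyMeasurable).2
      (integrableOn_of_continuous hΩb ((huc k).pow 2))
  have hL2 : Tendsto (fun k => ∫ x in Ω, (u (nu k) x - ustar x) ^ 2) atTop (𝓝 0) := by
    have := tendsto_integral_of_dominated_convergence (μ := volume.restrict Ω)
      (F := fun k x => (u (nu k) x - ustar x) ^ 2) (f := fun _ => (0 : ℝ))
      (fun x => ustar x ^ 2) (fun k => ((hukmem k).sub humem).integrable_sq.1) hsq
      (fun k => (ae_restrict_iff' hΩ.measurableSet).2 (ae_of_all _ fun x hx => by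
        have h1 := hle k x hx
        have h2 := ((hsol k).pos x hx).le
        rw [Real.norm_of_nonneg (sq_nonneg _)]
        nlinarith))
      ((ae_restrict_iff' hΩ.measurableSet).2 (ae_of_all _ fun x hx => by
        simpa using ((hpt x hx).sub_const (ustar x)).pow 2))
    simpa using this
  have hsmall : ∀ k, ∃ j, ∫ x in Ω, ((truncation Ω (u (nu k)) (epsSeq j) x - u (nu k) x) ^ 2
      + ‖gradient (truncation Ω (u (nu k)) (epsSeq j)) x - gradient (u (nu k)) x‖ ^ 2)
      < epsSeq k := fun k =>
    (((hsol k).tendsto_integral_truncation_sub hΩ hΩb).eventually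
      (gt_mem_nhds (epsSeq_pos k))).exists
  choose j hj using hsmall
  refine ⟨G, fun k => truncation Ω (u (nu k)) (epsSeq (j k)), fun k => ⟨?_, ?_, ?_⟩, ?_⟩
  · exact (hsol k).contDiff_truncation hΩ (epsSeq_pos _) (k := ⊤)
  · exact hasCompactSupport_truncation hΩb _ _
  · exact tsupport_indicator_subset hΩ ((hsol k).vanishesNearFrontier_cutPos (epsSeq_pos _))
  have hup : Tendsto (fun k => 2 * epsSeq k + 2 * (∫ x in Ω, (u (nu k) x - ustar x) ^ 2)
      + 2 * ∫ x in Ω, ‖gradient (u (nu k)) x - G x‖ ^ 2) atTop (𝓝 0) := by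
    simpa using ((tendsto_epsSeq.const_mul 2).add (hL2.const_mul 2)).add (hGlim.const_mul 2)
  refine squeeze_zero (fun k => integral_nonneg fun x => by positivity) (fun k => ?_) hup
  set ψ := truncation Ω (u (nu k)) (epsSeq (j k)) with hψ
  have hψ1 : ContDiff ℝ 1 ψ := (hsol k).contDiff_truncation hΩ (epsSeq_pos _) (k := 1)
  have hψc := hψ1.continuous
  have hψg := continuous_gradient hψ1
  have hukc := huc k
  have hgkc := hgc k
  have hi1 : IntegrableOn (fun x => (ψ x - u (nu k) x) ^ 2
      + ‖gradient ψ x - gradient (u (nu k)) x‖ ^ 2) Ω :=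
    integrableOn_of_continuous hΩb (by fun_prop)
  have hi2 : IntegrableOn (fun x => (u (nu k) x - ustar x) ^ 2) Ω :=
    ((hukmem k).sub humem).integrable_sq
  have hi3 : IntegrableOn (fun x => ‖gradient (u (nu k)) x - G x‖ ^ 2) Ω :=
    (memLp_two_iff_integrable_sq_norm ((hgmem k).sub hG).1).1 ((hgmem k).sub hG)
  have hi12 : IntegrableOn (fun x => 2 * ((ψ x - u (nu k) x) ^ 2
      + ‖gradient ψ x - gradient (u (nu k)) x‖ ^ 2) + 2 * (u (nu k) x - ustar x) ^ 2) Ω :=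
    (hi1.const_mul 2).add (hi2.const_mul 2)
  calc ∫ x in Ω, ((ψ x - ustar x) ^ 2 + ‖gradient ψ x - G x‖ ^ 2)
      ≤ ∫ x in Ω, (2 * ((ψ x - u (nu k) x) ^ 2
          + ‖gradient ψ x - gradient (u (nu k)) x‖ ^ 2) + 2 * (u (nu k) x - ustar x) ^ 2
          + 2 * ‖gradient (u (nu k)) x - G x‖ ^ 2) := by
        refine integral_mono_of_nonneg (ae_of_all _ fun x => by positivity)
          (hi12.add (hi3.const_mul 2)) (ae_of_all _ fun x => ?_)
        have h1 : ‖gradient ψ x - G x‖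
            ≤ ‖gradient ψ x - gradient (u (nu k)) x‖ + ‖gradient (u (nu k)) x - G x‖ :=
          norm_sub_le_norm_sub_add_norm_sub _ _ _
        have h2 := norm_nonneg (gradient ψ x - G x)
        simp only
        nlinarith [sq_nonneg (ψ x - u (nu k) x - (u (nu k) x - ustar x)),
          sq_nonneg (‖gradient ψ x - gradient (u (nu k)) x‖ - ‖gradient (u (nu k)) x - G x‖)]
    _ = 2 * (∫ x in Ω, ((ψ x - u (nu k) x) ^ 2
          + ‖gradient ψ x - gradient (u (nu k)) x‖ ^ 2))
        + 2 * (∫ x in Ω, (u (nu k) x - ustar x) ^ 2)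
        + 2 * ∫ x in Ω, ‖gradient (u (nu k)) x - G x‖ ^ 2 := by
        rw [integral_add hi12 (hi3.const_mul 2), integral_add (hi1.const_mul 2) (hi2.const_mul 2),
          integral_const_mul, integral_const_mul, integral_const_mul]
    _ ≤ _ := by linarith [hj k]

end IsMonotoneFamily

end Limit

/-- Nedev's theorem (Theorem 2.5): for `Ω` convex and `n ≥ 2`, the minimal solutions `u_λ` of
`-Δu = λ f(u)` have uniformly bounded energy, so `u* ∈ H¹₀(Ω)`; in particular
`u* ∈ L^{2n/(n-2)}(Ω)`. -/
theorem stmt_16 (n : ℕ) (hn : 2 ≤ n)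
    (Ω : Set (EuclideanSpace ℝ (Fin n))) (hΩo : IsOpen Ω) (hΩb : IsBounded Ω)
    (hΩc : Convex ℝ Ω)
    (f : ℝ → ℝ) (hf : ContDiff ℝ 1 f)
    (hfpos : ∀ t, 0 ≤ t → 0 < f t) (hfmono : StrictMonoOn f (Set.Ici 0))
    (hfsuper : Tendsto (fun t => f t / t) atTop atTop)
    (lamStar : ℝ) (hls : 0 < lamStar)
    (u : ℝ → EuclideanSpace ℝ (Fin n) → ℝ)
    (hureg : ∀ lam ∈ Set.Ioo 0 lamStar, ContDiff ℝ (⊤ : ℕ∞) (u lam))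
    (hupos : ∀ lam ∈ Set.Ioo 0 lamStar, ∀ x ∈ Ω, 0 < u lam x)
    (hueq : ∀ lam ∈ Set.Ioo 0 lamStar, ∀ x ∈ Ω, -lap (u lam) x = lam * f (u lam x))
    (hubc : ∀ lam ∈ Set.Ioo 0 lamStar, ∀ x ∈ frontier Ω, u lam x = 0)
    -- minimality: `u_λ ≤ v` for every nonnegative classical solution `v` of the same problem
    (hmin : ∀ lam ∈ Set.Ioo 0 lamStar,
      ∀ v : EuclideanSpace ℝ (Fin n) → ℝ, ContDiff ℝ 2 v → (∀ x ∈ Ω, 0 ≤ v x) →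
        (∀ x ∈ Ω, -lap v x = lam * f (v x)) → (∀ x ∈ frontier Ω, v x = 0) →
          ∀ x ∈ Ω, u lam x ≤ v x)
    (hmono : ∀ lam ∈ Set.Ioo 0 lamStar, ∀ mu ∈ Set.Ioo 0 lamStar, lam ≤ mu →
      ∀ x ∈ Ω, u lam x ≤ u mu x)
    (ustar : EuclideanSpace ℝ (Fin n) → ℝ)
    (hlim : ∀ x ∈ Ω, Tendsto (fun lam => u lam x) (𝓝[<] lamStar) (𝓝 (ustar x)))
    (hL1 : IntegrableOn ustar Ω) :
    (∃ C : ℝ, ∀ lam ∈ Set.Ioo 0 lamStar,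
        ∫ x in Ω, ‖gradient (u lam) x‖ ^ 2 ≤ C) ∧
      -- `u* ∈ H¹₀(Ω)`: there are `φ_k ∈ C_c^∞(Ω)` converging in `H¹` norm, with limit `u*` in `L²(Ω)`
      (∃ (G : EuclideanSpace ℝ (Fin n) → EuclideanSpace ℝ (Fin n))
          (φ : ℕ → EuclideanSpace ℝ (Fin n) → ℝ),
        (∀ k, ContDiff ℝ (⊤ : ℕ∞) (φ k) ∧ HasCompactSupport (φ k) ∧ tsupport (φ k) ⊆ Ω) ∧
          Tendsto (fun k => ∫ x in Ω, ((φ k x - ustar x) ^ 2 + ‖gradient (φ k) x - G x‖ ^ 2))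
            atTop (𝓝 0)) ∧
      IntegrableOn (fun x => ustar x ^ (2 * (n : ℝ) / ((n : ℝ) - 2))) Ω := by
  have h : IsMonotoneFamily Ω f lamStar u :=
    ⟨fun lam hl => ⟨hureg lam hl, hupos lam hl, fun x hx => by
      rw [← hueq lam hl x hx, neg_neg], hubc lam hl⟩, hmono⟩
  obtain ⟨C, hC⟩ := h.exists_integral_sq_gradient_le hn hΩo hΩb hΩc hf hfpos hfmono hlim hL1
  exact ⟨⟨C, hC⟩, h.exists_tendsto_truncation hn hls hΩo hΩb hf.continuous hfpos
    hfmono.monotoneOn hlim hL1 hC, h.integrableOn_rpow hn hls hΩo hΩb hlim hL1 hC⟩
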